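/- Fix an integer n ≥ 4. There exists a constant c = c(n) such that the following holds for every polynomial f ∈ ℤ[x_1,…,x_n] of total degree d ≥ 2 which is irreducible in ℚ[x_1,…,x_n] and NCC over ℚ. For every finite set I of (n−2)-dimensional affine subspaces of ℚ^n each of which is contained in the zero set of f (i.e., f vanishes at every ℚ-point of the subspace), and every positive integer B: if the homogeneous degree-d part f_d is 2-irreducible over ℚ, then the number of points x ∈ ℤ^n with |x_i| ≤ B for all i lying on at least one subspace of I is at most c · (d^7 · B^{n−2} + #I · B^{n−3}); and if f_d is merely 1-irreducible over ℚ, this number is at most c · (d^7 · B^{n−2} · log B + #I · B^{n−3}) for B ≥ 2. -/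

import Mathlib

open MvPolynomial

/-- The number of integral points of height at most `B` on the zero set of `f`. -/
noncomputable def Naff {n : ℕ} (f : MvPolynomial (Fin n) ℤ) (B : ℝ) : ℕ :=
  Set.ncard {x : Fin n → ℤ | MvPolynomial.eval x f = 0 ∧ ∀ i, (|x i| : ℝ) ≤ B}

/-- The linear form with coefficients `c`. -/
noncomputable def linForm {K : Type*} [CommSemiring K] {n : ℕ} (c : Fin n → K) :
    MvPolynomial (Fin n) K :=
  ∑ i, MvPolynomial.C (c i) * MvPolynomial.X i

/-- `f` is NCC (not cylindrical over a curve) over `K`: it cannot be written as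
`g(ℓ₁(x), ℓ₂(x))` for linear forms `ℓ₁, ℓ₂` over `K` and `g ∈ K[y₁,y₂]`. -/
def IsNCC {K : Type*} [CommSemiring K] {n : ℕ} (f : MvPolynomial (Fin n) K) : Prop :=
  ¬ ∃ (c c' : Fin n → K) (g : MvPolynomial (Fin 2) K),
      f = MvPolynomial.aeval ![linForm c, linForm c'] g

/-- `f` is `r`-irreducible: every divisor of `f` of total degree at most `r` is a unit. -/
def RIrreducible {K : Type*} [CommSemiring K] {n : ℕ} (r : ℕ) (f : MvPolynomial (Fin n) K) : Prop :=
  ∀ g : MvPolynomial (Fin n) K, g ∣ f → g.totalDegree ≤ r → IsUnit g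


/-- `S` is an `(n-2)`-dimensional affine subspace of `ℚⁿ`. -/
def IsAffinePlane (n : ℕ) (S : Set (Fin n → ℚ)) : Prop :=
  ∃ (a : Fin n → ℚ) (V : Submodule ℚ (Fin n → ℚ)), Module.finrank ℚ V = n - 2 ∧
    S = {x | ∃ v ∈ V, x = a + v}

/-- The expansion of `f (x + t v)` as a polynomial in `t`. -/
noncomputable def lineShift {R : Type*} [CommRing R] {n : ℕ} (v : Fin n → R)
    (f : MvPolynomial (Fin n) R) : Polynomial (MvPolynomial (Fin n) R) :=
  eval₂ (Polynomial.C.comp C)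
    (fun i => Polynomial.C (X i) + Polynomial.X * Polynomial.C (C (v i))) f

theorem eval_lineShift {R : Type*} [CommRing R] {n : ℕ} (v x : Fin n → R) (t : R)
    (f : MvPolynomial (Fin n) R) :
    ((lineShift v f).map (eval x)).eval t = eval (x + t • v) f := by
  unfold lineShift
  induction f using MvPolynomial.induction_on with
  | C a => simp
  | add p q hp hq => simp_all
  | mul_X p i hp =>
    rw [eval₂_mul, Polynomial.map_mul, Polynomial.eval_mul, hp, eval₂_X, map_mul, eval_X]
    simp only [Polynomial.map_add, Polynomial.map_mul, Polynomial.map_C, Polynomial.map_X, eval_X,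
      eval_C, Polynomial.eval_add, Polynomial.eval_mul, Polynomial.eval_C, Polynomial.eval_X,
      Pi.add_apply, Pi.smul_apply, smul_eq_mul]

theorem lineShift_mul {R : Type*} [CommRing R] {n : ℕ} (v : Fin n → R)
    (f g : MvPolynomial (Fin n) R) : lineShift v (f * g) = lineShift v f * lineShift v g := by
  simp [lineShift]

theorem lineShift_sum {R : Type*} [CommRing R] {n : ℕ} (v : Fin n → R) {ι : Type*} (s : Finset ι)
    (f : ι → MvPolynomial (Fin n) R) :
    lineShift v (∑ i ∈ s, f i) = ∑ i ∈ s, lineShift v (f i) := by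
  simp [lineShift, eval₂_sum]

theorem lineShift_monomial {R : Type*} [CommRing R] {n : ℕ} (v : Fin n → R) (m : Fin n →₀ ℕ)
    (c : R) : lineShift v (monomial m c) = Polynomial.C (C c) *
      ∏ i, (Polynomial.C (X i) + Polynomial.X * Polynomial.C (C (v i))) ^ m i := by
  simp [lineShift, eval₂_monomial, Finsupp.prod_fintype]

theorem natDegree_linear_pow_le {R : Type*} [CommRing R] (a b : R) (k : ℕ) :
    ((Polynomial.C a + Polynomial.X * Polynomial.C b) ^ k).natDegree ≤ k := by
  have h : (Polynomial.C a + Polynomial.X * Polynomial.C b).natDegree ≤ 1 := by compute_degree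
  exact (Polynomial.natDegree_pow_le_of_le k h).trans (by rw [mul_one])

theorem natDegree_lineShift_monomial {R : Type*} [CommRing R] {n : ℕ} (v : Fin n → R)
    (m : Fin n →₀ ℕ) (c : R) : (lineShift v (monomial m c)).natDegree ≤ m.degree := by
  rw [lineShift_monomial, Finsupp.degree_eq_sum]
  refine (Polynomial.natDegree_C_mul_le _ _).trans ((Polynomial.natDegree_prod_le _ _).trans ?_)
  exact Finset.sum_le_sum fun i _ => natDegree_linear_pow_le _ _ _

theorem coeff_prod_sum_of_natDegree_le {R ι : Type*} [CommRing R] (s : Finset ι)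
    (p : ι → Polynomial R) (m : ι → ℕ) (h : ∀ i ∈ s, (p i).natDegree ≤ m i) :
    (∏ i ∈ s, p i).coeff (∑ i ∈ s, m i) = ∏ i ∈ s, (p i).coeff (m i) := by
  classical
  induction s using Finset.induction_on with
  | empty => simp
  | insert i s hi ih =>
    rw [Finset.prod_insert hi, Finset.sum_insert hi, Finset.prod_insert hi,
      ← ih fun j hj => h j (Finset.mem_insert_of_mem hj)]
    refine Polynomial.coeff_mul_add_eq_of_natDegree_le (h i (Finset.mem_insert_self _ _)) ?_
    refine (Polynomial.natDegree_prod_le _ _).trans (Finset.sum_le_sum fun j hj => ?_)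
    exact h j (Finset.mem_insert_of_mem hj)

theorem coeff_lineShift_monomial {R : Type*} [CommRing R] {n : ℕ} (v : Fin n → R)
    (m : Fin n →₀ ℕ) (c : R) :
    (lineShift v (monomial m c)).coeff m.degree = C (eval v (monomial m c)) := by
  rw [lineShift_monomial, Finsupp.degree_eq_sum, Polynomial.coeff_C_mul,
    coeff_prod_sum_of_natDegree_le]
  · simp only [eval_monomial, Finsupp.prod_fintype, pow_zero, implies_true, map_mul, map_prod,
      map_pow]
    congr 1
    refine Finset.prod_congr rfl fun i _ => ?_
    have := Polynomial.coeff_pow_of_natDegree_le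
      (p := Polynomial.C (X i : MvPolynomial (Fin n) R) + Polynomial.X * Polynomial.C (C (v i)))
      (m := m i) (n := 1) (by compute_degree)
    rw [mul_one] at this
    rw [this]
    simp [Polynomial.coeff_C]
  · intro i _
    exact natDegree_linear_pow_le _ _ _

theorem natDegree_lineShift_le {R : Type*} [CommRing R] {n : ℕ} (v : Fin n → R)
    (f : MvPolynomial (Fin n) R) : (lineShift v f).natDegree ≤ f.totalDegree := by
  conv_lhs => rw [f.as_sum, lineShift_sum]
  refine Polynomial.natDegree_sum_le_of_forall_le _ _ fun m hm => ?_
  exact (natDegree_lineShift_monomial v m _).trans (le_totalDegree hm)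

theorem coeff_lineShift {R : Type*} [CommRing R] {n : ℕ} (v : Fin n → R)
    (f : MvPolynomial (Fin n) R) :
    (lineShift v f).coeff f.totalDegree =
      C (eval v (homogeneousComponent f.totalDegree f)) := by
  classical
  conv_lhs => enter [1]; rw [f.as_sum, lineShift_sum]
  rw [homogeneousComponent_apply, Polynomial.finsetSum_coeff, Finset.sum_filter, map_sum, map_sum]
  refine Finset.sum_congr rfl fun m hm => ?_
  split_ifs with h
  · rw [← h, coeff_lineShift_monomial]
  · rw [map_zero, map_zero]
    apply Polynomial.coeff_eq_zero_of_natDegree_lt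
    refine (natDegree_lineShift_monomial v m _).trans_lt (lt_of_le_of_ne (le_totalDegree hm) h)

theorem totalDegree_coeff_mul_le {R : Type*} [CommRing R] {n : ℕ}
    {p q : Polynomial (MvPolynomial (Fin n) R)} {a b : ℕ}
    (hp : ∀ k, (p.coeff k).totalDegree ≤ a) (hq : ∀ k, (q.coeff k).totalDegree ≤ b) (k : ℕ) :
    ((p * q).coeff k).totalDegree ≤ a + b := by
  rw [Polynomial.coeff_mul]
  refine totalDegree_finsetSum_le fun i _ => ?_
  exact (totalDegree_mul _ _).trans (add_le_add (hp _) (hq _))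

theorem totalDegree_coeff_one_le {R : Type*} [CommRing R] {n : ℕ} (k : ℕ) :
    ((1 : Polynomial (MvPolynomial (Fin n) R)).coeff k).totalDegree ≤ 0 := by
  rw [Polynomial.coeff_one]; split_ifs <;> simp

theorem totalDegree_coeff_pow_le {R : Type*} [CommRing R] {n : ℕ}
    {p : Polynomial (MvPolynomial (Fin n) R)}
    (hp : ∀ k, (p.coeff k).totalDegree ≤ 1) (m k : ℕ) :
    ((p ^ m).coeff k).totalDegree ≤ m := by
  induction m generalizing k with
  | zero => simpa using totalDegree_coeff_one_le k
  | succ m ih => rw [pow_succ]; exact totalDegree_coeff_mul_le ih hp k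

theorem totalDegree_coeff_prod_le {R : Type*} [CommRing R] {n : ℕ} {ι : Type*} (s : Finset ι)
    (p : ι → Polynomial (MvPolynomial (Fin n) R)) (a : ι → ℕ)
    (hp : ∀ i k, ((p i).coeff k).totalDegree ≤ a i) (k : ℕ) :
    ((∏ i ∈ s, p i).coeff k).totalDegree ≤ ∑ i ∈ s, a i := by
  classical
  induction s using Finset.induction_on generalizing k with
  | empty => simpa using totalDegree_coeff_one_le k
  | insert i s hi ih =>
    rw [Finset.prod_insert hi, Finset.sum_insert hi]
    exact totalDegree_coeff_mul_le (hp i) ih k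

theorem totalDegree_coeff_lineShift_le {R : Type*} [CommRing R] {n : ℕ} (v : Fin n → R)
    (f : MvPolynomial (Fin n) R) (k : ℕ) :
    ((lineShift v f).coeff k).totalDegree ≤ f.totalDegree := by
  conv_lhs => rw [f.as_sum, lineShift_sum, Polynomial.finsetSum_coeff]
  refine totalDegree_finsetSum_le fun m hm => ?_
  rw [lineShift_monomial, Polynomial.coeff_C_mul]
  refine (totalDegree_mul _ _).trans ?_
  rw [totalDegree_C, zero_add]
  refine (totalDegree_coeff_prod_le _ _ (fun i => m i) (fun i k => ?_) k).trans ?_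
  · refine totalDegree_coeff_pow_le (fun k => ?_) _ k
    rw [Polynomial.coeff_add, Polynomial.coeff_mul_C, Polynomial.coeff_C, Polynomial.coeff_X]
    refine (totalDegree_add _ _).trans (max_le ?_ ?_)
    · split_ifs
      · exact (totalDegree_monomial_le _ _).trans (by simp)
      · simp
    · split_ifs <;> simp
  · rw [← Finsupp.degree_eq_sum]
    exact le_totalDegree hm

theorem totalDegree_det_le {R : Type*} [CommRing R] {n : ℕ} {ι : Type*} [Fintype ι] [DecidableEq ι]
    (M : Matrix ι ι (MvPolynomial (Fin n) R)) (a : ι → ℕ)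
    (h : ∀ i j, (M i j).totalDegree ≤ a j) : M.det.totalDegree ≤ ∑ j, a j := by
  rw [Matrix.det_apply]
  refine totalDegree_finsetSum_le fun σ _ => ?_
  refine (totalDegree_smul_le _ _).trans ?_
  refine (totalDegree_finsetProd _ _).trans ?_
  exact Finset.sum_le_sum fun i _ => h _ _

theorem resultant_ne_zero_of_isRelPrime {R : Type*} [CommRing R] [IsDomain R]
    [IsIntegrallyClosed R] {p q : Polynomial R} (hp : IsUnit p.leadingCoeff)
    (h : IsRelPrime p q) : p.resultant q ≠ 0 := by
  intro h0
  obtain ⟨u, hu⟩ := hp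
  let K := FractionRing R
  have hinj : Function.Injective (algebraMap R K) := IsFractionRing.injective R K
  have hmap : (p.map (algebraMap R K)).resultant (q.map (algebraMap R K)) = 0 := by
    rw [Polynomial.natDegree_map_eq_of_injective hinj,
      Polynomial.natDegree_map_eq_of_injective hinj,
      Polynomial.resultant_map_map, h0, map_zero]
  rw [Polynomial.resultant_eq_zero_iff] at hmap
  obtain ⟨-, hcop⟩ := hmap
  apply hcop
  rw [← isRelPrime_iff_isCoprime]
  intro k hk1 hk2
  set p' := Polynomial.C (↑u⁻¹ : R) * p with hp'
  have hmon : p'.Monic := by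
    rw [Polynomial.Monic, hp', Polynomial.leadingCoeff_mul, Polynomial.leadingCoeff_C, ← hu]
    simp
  have hpp : p' ∣ p := ⟨Polynomial.C (u : R), by
    rw [hp', mul_right_comm, ← Polynomial.C_mul]; simp⟩
  have hpp' : p ∣ p' := ⟨Polynomial.C (↑u⁻¹ : R), by rw [hp', mul_comm]⟩
  have hk3 : k ∣ p'.map (algebraMap R K) := hk1.trans (Polynomial.map_dvd _ hpp')
  have hk0 : k ≠ 0 := by
    rintro rfl
    have := zero_dvd_iff.mp hk3
    exact (hmon.map (algebraMap R K)).ne_zero this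
  obtain ⟨g, hg⟩ := IsIntegrallyClosed.eq_map_mul_C_of_dvd K hmon hk3
  have hlc : k.leadingCoeff ≠ 0 := Polynomial.leadingCoeff_ne_zero.mpr hk0
  have hgm : g.Monic := by
    have := congrArg Polynomial.leadingCoeff hg
    rw [Polynomial.leadingCoeff_mul, Polynomial.leadingCoeff_C,
      Polynomial.leadingCoeff_map_of_injective hinj] at this
    have h1 := mul_right_cancel₀ hlc (this.trans (one_mul _).symm)
    exact hinj (by rw [h1, map_one])
  have hgk : g.map (algebraMap R K) ∣ k := ⟨_, hg.symm⟩
  have hg1 : g ∣ p := ((Polynomial.map_dvd_map _ hinj hgm).mp (hgk.trans hk1))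
  have hg2 : g ∣ q := ((Polynomial.map_dvd_map _ hinj hgm).mp (hgk.trans hk2))
  have hgu := h hg1 hg2
  rw [← hg]
  refine IsUnit.mul (hgu.map (Polynomial.mapRingHom (algebraMap R K))) ?_
  exact Polynomial.isUnit_C.mpr (IsUnit.mk0 _ hlc)

/-- The automorphism `x ↦ x + t v` of `R[x][t]`. -/
noncomputable def lineShiftHom {R : Type*} [CommRing R] {n : ℕ} (v : Fin n → R) :
    Polynomial (MvPolynomial (Fin n) R) →+* Polynomial (MvPolynomial (Fin n) R) :=
  Polynomial.eval₂RingHom (eval₂Hom (Polynomial.C.comp C)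
    (fun i => Polynomial.C (X i) + Polynomial.X * Polynomial.C (C (v i)))) Polynomial.X

theorem lineShiftHom_C {R : Type*} [CommRing R] {n : ℕ} (v : Fin n → R)
    (f : MvPolynomial (Fin n) R) : lineShiftHom v (Polynomial.C f) = lineShift v f := by
  simp [lineShiftHom, lineShift]

theorem lineShiftHom_neg {R : Type*} [CommRing R] {n : ℕ} (v : Fin n → R)
    (p : Polynomial (MvPolynomial (Fin n) R)) : lineShiftHom v (lineShiftHom (-v) p) = p := by
  have : (lineShiftHom v).comp (lineShiftHom (-v)) = RingHom.id _ := by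
    refine Polynomial.ringHom_ext' (MvPolynomial.ringHom_ext ?_ ?_) ?_
    · intro r; simp [lineShiftHom]
    · intro i; simp [lineShiftHom]; ring
    · simp [lineShiftHom]
  exact congrArg (fun φ => φ p) this

theorem isRelPrime_lineShift {R : Type*} [CommRing R] [IsDomain R] {n : ℕ} (v : Fin n → R)
    {f g : MvPolynomial (Fin n) R} (h : IsRelPrime f g) (hf : f ≠ 0) :
    IsRelPrime (lineShift v f) (lineShift v g) := by
  intro k hk1 hk2
  have key : ∀ F : MvPolynomial (Fin n) R, lineShiftHom (-v) (lineShift v F) = Polynomial.C F := by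
    intro F
    rw [← lineShiftHom_C]
    simpa using lineShiftHom_neg (-v) (Polynomial.C F)
  have h1 := map_dvd (lineShiftHom (-v)) hk1
  have h2 := map_dvd (lineShiftHom (-v)) hk2
  rw [key] at h1 h2
  obtain ⟨c, hc⟩ := h1
  have hdeg : (lineShiftHom (-v) k).natDegree = 0 := by
    have h0 : Polynomial.C f ≠ 0 := by simpa using hf
    have := congrArg Polynomial.natDegree hc
    rw [hc] at h0
    rw [Polynomial.natDegree_mul (left_ne_zero_of_mul h0) (right_ne_zero_of_mul h0),
      Polynomial.natDegree_C] at this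
    omega
  rw [Polynomial.natDegree_eq_zero] at hdeg
  obtain ⟨r, hr⟩ := hdeg
  have h1' : r ∣ f := by
    rw [← hr] at hc
    exact (Polynomial.C_dvd_iff_dvd_coeff r (Polynomial.C f)).mp ⟨c, hc⟩ 0 |>.trans (by simp)
  have h2' : r ∣ g := by
    rw [← hr] at h2
    exact (Polynomial.C_dvd_iff_dvd_coeff r (Polynomial.C g)).mp h2 0 |>.trans (by simp)
  have hu : IsUnit (lineShiftHom (-v) k) := by
    rw [← hr]; exact (h h1' h2').map Polynomial.C
  have := hu.map (lineShiftHom v)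
  rwa [lineShiftHom_neg] at this

theorem exists_eliminant {n : ℕ} {f g : MvPolynomial (Fin n) ℚ} (h : IsRelPrime f g)
    (hf0 : f.totalDegree ≠ 0) (v : Fin n → ℚ)
    (hv : eval v (homogeneousComponent f.totalDegree f) ≠ 0) :
    ∃ r : MvPolynomial (Fin n) ℚ, r ≠ 0 ∧ r.totalDegree ≤ 2 * f.totalDegree * g.totalDegree ∧
      ∀ (x : Fin n → ℚ) (t : ℚ), eval (x + t • v) f = 0 → eval (x + t • v) g = 0 →
        eval x r = 0 := by
  have hcoeff := coeff_lineShift v f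
  have hdeg : (lineShift v f).natDegree = f.totalDegree := by
    refine le_antisymm (natDegree_lineShift_le v f) (Polynomial.le_natDegree_of_ne_zero ?_)
    rw [hcoeff]
    simpa using hv
  have hunit : IsUnit (lineShift v f).leadingCoeff := by
    rw [Polynomial.leadingCoeff, hdeg, hcoeff]
    exact (IsUnit.mk0 _ hv).map C
  have hfne : f ≠ 0 := by rintro rfl; simp at hf0
  refine ⟨(lineShift v f).resultant (lineShift v g),
    resultant_ne_zero_of_isRelPrime hunit (isRelPrime_lineShift v h hfne), ?_, ?_⟩
  · rw [Polynomial.resultant]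
    refine (totalDegree_det_le _ (fun j => j.addCases (fun _ => g.totalDegree)
      (fun _ => f.totalDegree)) ?_).trans ?_
    · intro i j
      induction j using Fin.addCases with
      | left j =>
        simp only [Polynomial.sylvester, Matrix.of_apply, Fin.addCases_left]
        split_ifs
        · exact totalDegree_coeff_lineShift_le _ _ _
        · simp
      | right j =>
        simp only [Polynomial.sylvester, Matrix.of_apply, Fin.addCases_right]
        split_ifs
        · exact totalDegree_coeff_lineShift_le _ _ _
        · simp
    · rw [Fin.sum_univ_add]
      simp only [Fin.addCases_left, Fin.addCases_right, Finset.sum_const, Finset.card_univ,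
        Fintype.card_fin, smul_eq_mul, hdeg]
      have := natDegree_lineShift_le v g
      nlinarith
  · intro x t h1 h2
    obtain ⟨p, q, -, -, hpq⟩ := Polynomial.exists_mul_add_mul_eq_C_resultant (lineShift v f)
      (lineShift v g) le_rfl le_rfl (Or.inl (by rw [hdeg]; exact hf0))
    have := congrArg (fun P => (P.map (eval x)).eval t) hpq
    simp only [Polynomial.map_add, Polynomial.map_mul, Polynomial.eval_add, Polynomial.eval_mul,
      eval_lineShift, h1, h2, Polynomial.map_C, Polynomial.eval_C, zero_mul, zero_add] at this
    exact this.symm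

theorem eval_linForm {K : Type*} [CommSemiring K] {n : ℕ} (c x : Fin n → K) :
    eval x (linForm c) = ∑ i, c i * x i := by
  simp [linForm]

theorem exists_poly_eval_eq {K : Type*} [CommRing K] {n : ℕ} (φ : (Fin n → K) →ₗ[K] K) (c : K) :
    ∃ p : MvPolynomial (Fin n) K, p.totalDegree ≤ 1 ∧ ∀ x, eval x p = φ x + c := by
  refine ⟨linForm (fun i => φ (Pi.single i 1)) + C c, ?_, fun x => ?_⟩
  · refine (totalDegree_add _ _).trans (max_le (totalDegree_finsetSum_le fun i _ => ?_) (by simp))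
    refine (totalDegree_mul _ _).trans ?_
    rw [totalDegree_C, zero_add]
    exact (totalDegree_monomial_le _ _).trans (by simp)
  · rw [map_add, eval_linForm, eval_C, LinearMap.pi_apply_eq_sum_univ φ x]
    congr 1
    refine Finset.sum_congr rfl fun i _ => ?_
    rw [smul_eq_mul, mul_comm]
    congr 2
    ext j
    simp [Pi.single_apply, eq_comm]

theorem exists_eval_ne_zero {n : ℕ} {p : MvPolynomial (Fin n) ℚ} (hp : p ≠ 0) :
    ∃ x, eval x p ≠ 0 := by
  by_contra! h
  exact hp (MvPolynomial.funext fun x => by simpa using h x)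

theorem exists_poly_vanishing_on {n : ℕ} {W : Submodule ℚ (Fin n → ℚ)} (hW : W ≠ ⊤) :
    ∃ p : MvPolynomial (Fin n) ℚ, p ≠ 0 ∧ p.totalDegree ≤ 1 ∧ ∀ x ∈ W, eval x p = 0 := by
  obtain ⟨y, hy⟩ : ∃ y, y ∉ W := by
    by_contra! h
    exact hW (eq_top_iff.mpr fun x _ => h x)
  obtain ⟨φ, h1, h2⟩ := Submodule.exists_le_ker_of_notMem hy
  obtain ⟨p, hpd, hp⟩ := exists_poly_eval_eq φ 0
  refine ⟨p, ?_, hpd, fun x hx => ?_⟩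
  · rintro rfl
    have := hp y
    simp only [map_zero, add_zero] at this
    exact h1 this.symm
  · rw [hp, add_zero]; exact h2 hx

theorem exists_avoid {n : ℕ} {p : MvPolynomial (Fin n) ℚ} (hp : p ≠ 0) {ι : Type*} (s : Finset ι)
    (W : ι → Submodule ℚ (Fin n → ℚ)) (hW : ∀ i ∈ s, W i ≠ ⊤) :
    ∃ x, eval x p ≠ 0 ∧ ∀ i ∈ s, x ∉ W i := by
  classical
  choose! q hq0 _ hq using fun i (hi : i ∈ s) => exists_poly_vanishing_on (hW i hi)
  obtain ⟨x, hx⟩ := exists_eval_ne_zero (mul_ne_zero hp (Finset.prod_ne_zero_iff.mpr hq0))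
  rw [map_mul, map_prod] at hx
  refine ⟨x, left_ne_zero_of_mul hx, fun i hi hxi => ?_⟩
  exact Finset.prod_ne_zero_iff.mp (right_ne_zero_of_mul hx) i hi (hq i hi x hxi)

theorem finrank_sup_span_singleton_le {n : ℕ} (V : Submodule ℚ (Fin n → ℚ)) (v : Fin n → ℚ) :
    Module.finrank ℚ (V ⊔ Submodule.span ℚ {v} : Submodule ℚ (Fin n → ℚ)) ≤
      Module.finrank ℚ V + 1 :=
  (Submodule.finrank_add_le_finrank_add_finrank _ _).trans
    (Nat.add_le_add_left ((finrank_span_le_card ({v} : Set (Fin n → ℚ))).trans (by simp)) _)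

theorem ne_top_of_finrank_lt {n : ℕ} {V : Submodule ℚ (Fin n → ℚ)}
    (h : Module.finrank ℚ V < n) : V ≠ ⊤ := by
  rintro rfl
  rw [finrank_top, Module.finrank_fin_fun] at h
  exact h.false

/-- A nonzero top-degree part. -/
theorem homogeneousComponent_totalDegree_ne_zero {R : Type*} [CommRing R] {n : ℕ}
    {f : MvPolynomial (Fin n) R} (hf : f ≠ 0) : homogeneousComponent f.totalDegree f ≠ 0 := by
  intro h
  obtain ⟨m, hm, hmd⟩ := Finset.exists_mem_eq_sup f.support (support_nonempty.mpr hf)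
    (fun m => m.sum fun _ e => e)
  have := congrArg (coeff m) h
  rw [coeff_homogeneousComponent, if_pos (by rw [totalDegree, hmd]; rfl), coeff_zero] at this
  exact (mem_support_iff.mp hm) this

/-- A weak form of Bézout's theorem: the number of affine subspaces of codimension two in the
common zero set of two coprime polynomials. -/
theorem card_planes_le {n : ℕ} {f g : MvPolynomial (Fin n) ℚ} (h : IsRelPrime f g) {ι : Type*}
    (s : Finset ι) (a : ι → Fin n → ℚ) (V : ι → Submodule ℚ (Fin n → ℚ))
    (hV : ∀ i ∈ s, Module.finrank ℚ (V i) + 2 = n)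
    (hd : ∀ i ∈ s, ∀ j ∈ s, V i = V j → a i - a j ∈ V i → i = j)
    (hf : ∀ i ∈ s, ∀ v ∈ V i, eval (a i + v) f = 0)
    (hg : ∀ i ∈ s, ∀ v ∈ V i, eval (a i + v) g = 0) :
    s.card ≤ 2 * f.totalDegree * g.totalDegree := by
  classical
  obtain rfl | ⟨i₀, hi₀⟩ := s.eq_empty_or_nonempty
  · simp
  have hnu : ∀ F : MvPolynomial (Fin n) ℚ, (∀ i ∈ s, ∀ v ∈ V i, eval (a i + v) F = 0) →
      ¬ IsUnit F := fun F hF hu => by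
    have := hu.map (eval (a i₀ + 0))
    rw [hF i₀ hi₀ 0 (zero_mem _)] at this
    exact not_isUnit_zero this
  have hf0 : f ≠ 0 := by
    rintro rfl
    exact hnu g hg (h (dvd_zero g) dvd_rfl)
  have hdeg : f.totalDegree ≠ 0 := by
    intro h0
    have := totalDegree_eq_zero_iff_eq_C.mp h0
    refine hnu f hf ?_
    rw [this] at hf0 ⊢
    exact (IsUnit.mk0 _ (by simpa using hf0)).map C
  obtain ⟨v, hv, hvW⟩ := exists_avoid (homogeneousComponent_totalDegree_ne_zero hf0)
    ((s ×ˢ s ×ˢ (Finset.univ : Finset Bool)).filter fun p =>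
      (if p.2.2 then V p.1 ⊔ V p.2.1 else V p.1 ⊔ Submodule.span ℚ {a p.1 - a p.2.1}) ≠ ⊤)
    (fun p => if p.2.2 then V p.1 ⊔ V p.2.1 else V p.1 ⊔ Submodule.span ℚ {a p.1 - a p.2.1})
    (fun p hp => (Finset.mem_filter.mp hp).2)
  have hv1 : ∀ i ∈ s, ∀ j ∈ s, V i ⊔ V j ≠ ⊤ → v ∉ V i ⊔ V j := fun i hi j hj hij => by
    simpa using hvW (i, j, true) (by simp [hi, hj, hij])
  have hv2 : ∀ i ∈ s, ∀ j ∈ s, v ∉ V i ⊔ Submodule.span ℚ {a i - a j} := fun i hi j hj => by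
    have : V i ⊔ Submodule.span ℚ {a i - a j} ≠ ⊤ :=
      ne_top_of_finrank_lt ((finrank_sup_span_singleton_le _ _).trans_lt
        (by have := hV i hi; omega))
    simpa using hvW (i, j, false) (by simp [hi, hj, this])
  have hWr : ∀ i ∈ s, Module.finrank ℚ (V i ⊔ Submodule.span ℚ {v} : Submodule ℚ (Fin n → ℚ)) + 1
      = n := fun i hi => by
    refine le_antisymm ?_ ?_
    · have := finrank_sup_span_singleton_le (V i) v
      have := hV i hi
      omega
    · have : V i < V i ⊔ Submodule.span ℚ {v} := by
        refine lt_of_le_of_ne le_sup_left fun he => hv2 i hi i hi ?_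
        have : v ∈ V i := by
          rw [he]
          exact Submodule.mem_sup_right (Submodule.mem_span_singleton_self v)
        exact Submodule.mem_sup_left this
      have := Submodule.finrank_lt_finrank_of_lt this
      have := hV i hi
      omega
  obtain ⟨y₁, -, hy₁⟩ := exists_avoid (one_ne_zero (α := MvPolynomial (Fin n) ℚ)) s
    (fun i => V i ⊔ Submodule.span ℚ {v})
    (fun i hi => ne_top_of_finrank_lt (by have := hWr i hi; omega))
  choose! φ hφ1 hφ2 using fun i (hi : i ∈ s) => Submodule.exists_le_ker_of_notMem (hy₁ i hi)
  have hker : ∀ i ∈ s, ∀ x, φ i x = 0 → x ∈ V i ⊔ Submodule.span ℚ {v} := fun i hi x hx => by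
    have h1 : LinearMap.ker (φ i) ≠ ⊤ := by
      intro h0
      have : y₁ ∈ LinearMap.ker (φ i) := by rw [h0]; trivial
      exact hφ1 i hi this
    have h2 := Submodule.finrank_lt h1
    rw [Module.finrank_fin_fun] at h2
    rw [Submodule.eq_of_le_of_finrank_le (hφ2 i hi) (by have := hWr i hi; omega)]
    exact hx
  let ψ : ι → (Fin n → ℚ) →ₗ[ℚ] ℚ := fun i => (φ i y₁)⁻¹ • φ i
  have hψ1 : ∀ i ∈ s, ψ i y₁ = 1 := fun i hi => by
    simp [ψ, inv_mul_cancel₀ (hφ1 i hi)]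
  have hψ0 : ∀ i ∈ s, ∀ x, ψ i x = 0 ↔ x ∈ V i ⊔ Submodule.span ℚ {v} := fun i hi x => by
    have : ψ i x = 0 ↔ φ i x = 0 := by
      simp [ψ, hφ1 i hi]
    rw [this]
    exact ⟨hker i hi x, fun hx => hφ2 i hi hx⟩
  obtain ⟨r, hr0, hrd, hr⟩ := exists_eliminant h hdeg v hv
  choose q _ hq using fun p : ι × ι => exists_poly_eval_eq (ψ p.2 - ψ p.1)
    (ψ p.1 (a p.1) - ψ p.2 (a p.2))
  obtain ⟨y₀, hy₀⟩ := exists_eval_ne_zero (mul_ne_zero hr0 (Finset.prod_ne_zero_iff.mpr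
    (fun p (hp : p ∈ (s ×ˢ s).filter fun p => p.1 ≠ p.2) => show q p ≠ 0 from fun h0 => by
      obtain ⟨i, j⟩ := p
      simp only [Finset.mem_filter, Finset.mem_product] at hp
      obtain ⟨⟨hi, hj⟩, hij⟩ := hp
      apply hij
      have e : ∀ x, ψ j x - ψ i x + (ψ i (a i) - ψ j (a j)) = 0 := fun x => by
        have := hq (i, j) x
        rw [h0, map_zero] at this
        simpa using this.symm
      have e0 : ψ i (a i) = ψ j (a j) := by have := e 0; simp at this; linarith
      have e1 : ∀ x, ψ i x = ψ j x := fun x => by have := e x; linarith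
      have hW : V i ⊔ Submodule.span ℚ {v} = V j ⊔ Submodule.span ℚ {v} := by
        ext x; rw [← hψ0 i hi, ← hψ0 j hj, e1]
      have hVij : V i = V j := by
        by_contra hne
        have hle : ¬ V j ≤ V i := fun hle => hne
          (Submodule.eq_of_le_of_finrank_eq hle (by have := hV i hi; have := hV j hj; omega)).symm
        obtain ⟨u, huj, hui⟩ := Set.not_subset.mp hle
        have hu : u ∈ V i ⊔ Submodule.span ℚ {v} := by
          rw [hW]; exact Submodule.mem_sup_left huj
        obtain ⟨w, hw, z, hz, rfl⟩ := Submodule.mem_sup.mp hu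
        obtain ⟨c, rfl⟩ := Submodule.mem_span_singleton.mp hz
        have hc : c ≠ 0 := by
          rintro rfl
          exact hui (by simpa using hw)
        refine hv1 i hi j hj ?_ ?_
        · refine ne_top_of_finrank_lt (lt_of_le_of_lt (Submodule.finrank_mono
            (sup_le le_sup_left ?_ : V i ⊔ V j ≤ V i ⊔ Submodule.span ℚ {v})) ?_)
          · rw [hW]; exact le_sup_left
          · have := hWr i hi; omega
        · have : v = c⁻¹ • ((w + c • v) - w) := by
            rw [add_sub_cancel_left, smul_smul, inv_mul_cancel₀ hc, one_smul]
          rw [this]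
          exact Submodule.smul_mem _ _ (sub_mem (Submodule.mem_sup_right huj)
            (Submodule.mem_sup_left hw))
      refine hd i hi j hj hVij ?_
      have hmem : a i - a j ∈ V i ⊔ Submodule.span ℚ {v} := by
        rw [← hψ0 i hi, map_sub, e0, e1 (a j), sub_self]
      obtain ⟨w, hw, z, hz, hwz⟩ := Submodule.mem_sup.mp hmem
      obtain ⟨c, rfl⟩ := Submodule.mem_span_singleton.mp hz
      by_cases hc : c = 0
      · rw [hc, zero_smul, add_zero] at hwz
        rwa [← hwz]
      · exfalso
        refine hv2 i hi j hj ?_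
        have : v = c⁻¹ • ((a i - a j) - w) := by
          rw [← hwz, add_sub_cancel_left, smul_smul, inv_mul_cancel₀ hc, one_smul]
        rw [this]
        exact Submodule.smul_mem _ _ (sub_mem (Submodule.mem_sup_right
          (Submodule.mem_span_singleton_self _)) (Submodule.mem_sup_left hw)))))
  rw [map_mul, map_prod] at hy₀
  have hry := left_ne_zero_of_mul hy₀
  have hqy := Finset.prod_ne_zero_iff.mp (right_ne_zero_of_mul hy₀)
  set ρ := (lineShift y₁ r).map (eval y₀) with hρ
  have hρe : ∀ t, ρ.eval t = eval (y₀ + t • y₁) r := fun t => eval_lineShift _ _ _ _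
  have hρ0 : ρ ≠ 0 := by
    intro h0
    have := hρe 0
    rw [h0, Polynomial.eval_zero, zero_smul, add_zero] at this
    exact hry this.symm
  let t : ι → ℚ := fun i => ψ i (a i) - ψ i y₀
  have hinj : Set.InjOn t s := fun i hi j hj hij => by
    by_contra hne
    refine hqy (i, j) (by simp_all) ?_
    rw [hq]
    simp only [LinearMap.sub_apply]
    have : ψ i (a i) - ψ i y₀ = ψ j (a j) - ψ j y₀ := hij
    linarith
  have hroot : ∀ i ∈ s, t i ∈ ρ.roots := fun i hi => by
    rw [Polynomial.mem_roots hρ0, Polynomial.IsRoot, hρe]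
    have hmem : y₀ + t i • y₁ - a i ∈ V i ⊔ Submodule.span ℚ {v} := by
      rw [← hψ0 i hi, map_sub, map_add, map_smul, hψ1 i hi]
      simp [t]
    obtain ⟨w, hw, z, hz, hwz⟩ := Submodule.mem_sup.mp hmem
    obtain ⟨c, rfl⟩ := Submodule.mem_span_singleton.mp hz
    have hx : (y₀ + t i • y₁) + (-c) • v = a i + w := by
      rw [neg_smul, ← sub_eq_add_neg, sub_eq_iff_eq_add, add_assoc, hwz]; abel
    refine hr _ (-c) ?_ ?_
    · rw [hx]; exact hf i hi w hw
    · rw [hx]; exact hg i hi w hw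
  calc s.card = (s.image t).card := (Finset.card_image_of_injOn hinj).symm
    _ ≤ ρ.natDegree := Polynomial.card_le_degree_of_subset_roots (by
        intro x hx
        obtain ⟨i, hi, rfl⟩ := Finset.mem_image.mp hx
        exact hroot i hi)
    _ ≤ (lineShift y₁ r).natDegree := Polynomial.natDegree_map_le
    _ ≤ r.totalDegree := natDegree_lineShift_le _ _
    _ ≤ _ := hrd

/-- The directional derivative of `f`, as a linear function of the direction. -/
noncomputable def dirDeriv {n : ℕ} (f : MvPolynomial (Fin n) ℚ) :
    (Fin n → ℚ) →ₗ[ℚ] MvPolynomial (Fin n) ℚ :=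
  Fintype.linearCombination ℚ fun i => pderiv i f

theorem dirDeriv_apply {n : ℕ} (f : MvPolynomial (Fin n) ℚ) (w : Fin n → ℚ) :
    dirDeriv f w = ∑ i, C (w i) * pderiv i f := by
  simp [dirDeriv, Fintype.linearCombination_apply, MvPolynomial.smul_eq_C_mul]

theorem derivative_lineShift {n : ℕ} (w : Fin n → ℚ) (f : MvPolynomial (Fin n) ℚ) :
    Polynomial.derivative (lineShift w f) = lineShift w (dirDeriv f w) := by
  have hadd : ∀ p q : MvPolynomial (Fin n) ℚ, lineShift w (p + q) = lineShift w p + lineShift w q :=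
    fun p q => by simp [lineShift]
  have hC : ∀ c : ℚ, lineShift w (C c) = Polynomial.C (C c) := fun c => by simp [lineShift]
  have hX : ∀ i, lineShift w (X i) = Polynomial.C (X i) + Polynomial.X * Polynomial.C (C (w i)) :=
    fun i => by simp [lineShift]
  induction f using MvPolynomial.induction_on with
  | C a => simp [dirDeriv_apply, lineShift]
  | add p q hp hq =>
    have : dirDeriv (p + q) w = dirDeriv p w + dirDeriv q w := by
      simp [dirDeriv_apply, mul_add, Finset.sum_add_distrib]
    rw [hadd, this, hadd, ← hp, ← hq, Polynomial.derivative_add]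
  | mul_X p i hp =>
    have : dirDeriv (p * X i) w = dirDeriv p w * X i + C (w i) * p := by
      simp only [dirDeriv_apply, Derivation.leibniz, smul_eq_mul, pderiv_X, mul_add,
        Finset.sum_add_distrib, Finset.sum_mul]
      rw [add_comm]
      congr 1
      · exact Finset.sum_congr rfl fun j _ => by ring
      · simp [Pi.single_apply]
    rw [this, hadd, lineShift_mul, lineShift_mul, lineShift_mul, ← hp, Polynomial.derivative_mul,
      hX, hC]
    simp
    ring

theorem totalDegree_pderiv_le {R : Type*} [CommRing R] {n : ℕ} (f : MvPolynomial (Fin n) R)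
    (i : Fin n) : (pderiv i f).totalDegree ≤ f.totalDegree - 1 := by
  conv_lhs => rw [f.as_sum, map_sum]
  refine totalDegree_finsetSum_le fun m hm => ?_
  rw [pderiv_monomial]
  by_cases h0 : m i = 0
  · simp [h0]
  refine (totalDegree_monomial_le _ _).trans ?_
  have h1 : Finsupp.single i 1 ≤ m := by
    rw [Finsupp.single_le_iff]; omega
  have h2 := congrArg Finsupp.degree (tsub_add_cancel_of_le h1)
  have h3 := le_totalDegree hm
  rw [map_add, Finsupp.degree_single] at h2
  change (m - Finsupp.single i 1).degree ≤ _
  change m.degree ≤ _ at h3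
  omega

theorem totalDegree_dirDeriv_lt {n : ℕ} {f : MvPolynomial (Fin n) ℚ} (hf : f.totalDegree ≠ 0)
    (w : Fin n → ℚ) : (dirDeriv f w).totalDegree < f.totalDegree := by
  have : (dirDeriv f w).totalDegree ≤ f.totalDegree - 1 := by
    rw [dirDeriv_apply]
    refine totalDegree_finsetSum_le fun i _ => ?_
    refine (totalDegree_mul _ _).trans ?_
    rw [totalDegree_C, zero_add]
    exact totalDegree_pderiv_le f i
  omega

theorem not_dvd_of_totalDegree_lt {n : ℕ} {f g : MvPolynomial (Fin n) ℚ} (hg : g ≠ 0)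
    (h : g.totalDegree < f.totalDegree) : ¬ f ∣ g := by
  rintro ⟨k, rfl⟩
  rw [totalDegree_mul_of_isDomain (left_ne_zero_of_mul hg) (right_ne_zero_of_mul hg)] at h
  omega

theorem isRelPrime_of_totalDegree_lt {n : ℕ} {f g : MvPolynomial (Fin n) ℚ} (hf : Irreducible f)
    (hg : g ≠ 0) (h : g.totalDegree < f.totalDegree) : IsRelPrime f g :=
  (hf.isRelPrime_iff_not_dvd).mpr (not_dvd_of_totalDegree_lt hg h)

theorem eval_dirDeriv_eq_zero {n : ℕ} {f : MvPolynomial (Fin n) ℚ} {x w : Fin n → ℚ}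
    (h : ∀ t : ℚ, eval (x + t • w) f = 0) : eval x (dirDeriv f w) = 0 := by
  have h0 : (lineShift w f).map (eval x) = 0 :=
    Polynomial.funext fun t => by rw [eval_lineShift, h, Polynomial.eval_zero]
  have h1 := eval_lineShift w x 0 (dirDeriv f w)
  rw [← derivative_lineShift, ← Polynomial.derivative_map, h0, zero_smul, add_zero] at h1
  simpa using h1.symm

theorem eval_add_of_dirDeriv_eq_zero {n : ℕ} {f : MvPolynomial (Fin n) ℚ} {w : Fin n → ℚ}
    (h : dirDeriv f w = 0) (x : Fin n → ℚ) : eval (x + w) f = eval x f := by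
  have h0 : Polynomial.derivative ((lineShift w f).map (eval x)) = 0 := by
    rw [Polynomial.derivative_map, derivative_lineShift, h]
    simp [lineShift]
  have h1 := Polynomial.derivative_eq_zero.mp h0
  obtain ⟨c, hc⟩ := Polynomial.natDegree_eq_zero.mp h1
  have e0 := eval_lineShift w x 0 f
  have e1 := eval_lineShift w x 1 f
  rw [← hc, Polynomial.eval_C] at e0 e1
  rw [zero_smul, add_zero] at e0
  rw [one_smul] at e1
  rw [← e0, ← e1]

theorem eval_top_eq_zero_of_const {n : ℕ} {f : MvPolynomial (Fin n) ℚ} {x w : Fin n → ℚ} {c : ℚ}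
    (hf : f.totalDegree ≠ 0) (h : ∀ t : ℚ, eval (x + t • w) f = c) :
    eval w (homogeneousComponent f.totalDegree f) = 0 := by
  have h0 : (lineShift w f).map (eval x) = Polynomial.C c :=
    Polynomial.funext fun t => by rw [eval_lineShift, h, Polynomial.eval_C]
  have h1 := congrArg (eval x) (coeff_lineShift w f)
  rw [← Polynomial.coeff_map, h0, eval_C, Polynomial.coeff_C, if_neg hf] at h1
  exact h1.symm

theorem ker_dirDeriv_sup_ne_top {n : ℕ} {f : MvPolynomial (Fin n) ℚ} (hf : IsNCC f)
    (a b : Fin n → ℚ) :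
    LinearMap.ker (dirDeriv f) ⊔ Submodule.span ℚ {a, b} ≠ ⊤ := by
  intro htop
  apply hf
  have : ∀ i : Fin n, ∃ c c' : ℚ, dirDeriv f (Pi.single i 1 - (c • a + c' • b)) = 0 := fun i => by
    have hm : (Pi.single i 1 : Fin n → ℚ) ∈ LinearMap.ker (dirDeriv f) ⊔
      Submodule.span ℚ {a, b} := by
      rw [htop]; trivial
    obtain ⟨k, hk, z, hz, hkz⟩ := Submodule.mem_sup.mp hm
    obtain ⟨c, c', rfl⟩ := Submodule.mem_span_pair.mp hz
    refine ⟨c, c', ?_⟩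
    rw [← hkz, add_sub_cancel_right]
    exact hk
  choose c c' hc using this
  refine ⟨c, c', aeval (fun i => C (a i) * X 0 + C (b i) * X 1) f, MvPolynomial.funext fun x => ?_⟩
  have hx : dirDeriv f (x - ((∑ i, c i * x i) • a + (∑ i, c' i * x i) • b)) = 0 := by
    have : x - ((∑ i, c i * x i) • a + (∑ i, c' i * x i) • b) =
        ∑ i, x i • (Pi.single i 1 - (c i • a + c' i • b)) := by
      simp only [smul_sub, smul_add, Finset.sum_sub_distrib, Finset.sum_add_distrib,
        Finset.sum_smul, smul_smul]
      congr 1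
      · ext j; simp [Finset.sum_apply, Pi.single_apply]
      · congr 1 <;> exact Finset.sum_congr rfl fun i _ => by rw [mul_comm]
    rw [this, map_sum]
    exact Finset.sum_eq_zero fun i _ => by rw [map_smul, hc, smul_zero]
  have h1 := eval_add_of_dirDeriv_eq_zero hx ((∑ i, c i * x i) • a + (∑ i, c' i * x i) • b)
  rw [add_sub_cancel] at h1
  rw [h1]
  have h2 : ∀ g : MvPolynomial (Fin 2) ℚ, eval x (aeval ![linForm c, linForm c'] g) =
      eval ![∑ i, c i * x i, ∑ i, c' i * x i] g := fun g => by
    rw [aeval_def, ← eval_linForm, ← eval_linForm, eval_eval₂]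
    simp only [eval₂_eq', eval_eq']
    refine Finset.sum_congr rfl fun m _ => ?_
    simp
  rw [h2, aeval_def, eval_eval₂]
  simp only [eval₂_eq', eval_eq']
  refine Finset.sum_congr rfl fun m _ => ?_
  congr 1
  · simp
  · refine Finset.prod_congr rfl fun i _ => ?_
    rw [← eval_eq']
    simp [mul_comm]

/-- The affine planes `a i + V i`, `i ∈ s`, are distinct, of codimension two, and contained in the
zero set of `f`. -/
structure IsPlaneFamily {n : ℕ} {ι : Type*} (f : MvPolynomial (Fin n) ℚ) (s : Finset ι)
    (a : ι → Fin n → ℚ) (V : ι → Submodule ℚ (Fin n → ℚ)) : Prop where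
  finrank_eq : ∀ i ∈ s, Module.finrank ℚ (V i) + 2 = n
  distinct : ∀ i ∈ s, ∀ j ∈ s, V i = V j → a i - a j ∈ V i → i = j
  eval_eq_zero : ∀ i ∈ s, ∀ v ∈ V i, eval (a i + v) f = 0

namespace IsPlaneFamily

variable {n : ℕ} {ι : Type*} {f : MvPolynomial (Fin n) ℚ} {s : Finset ι} {a : ι → Fin n → ℚ}
  {V : ι → Submodule ℚ (Fin n → ℚ)}

theorem mono (h : IsPlaneFamily f s a V) {t : Finset ι} (hts : t ⊆ s) : IsPlaneFamily f t a V :=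
  ⟨fun i hi => h.1 i (hts hi), fun i hi j hj => h.2 i (hts hi) j (hts hj),
   fun i hi => h.3 i (hts hi)⟩

theorem eval_top (h : IsPlaneFamily f s a V) (hf : f.totalDegree ≠ 0) {i : ι} (hi : i ∈ s)
    {v : Fin n → ℚ} (hv : v ∈ V i) : eval v (homogeneousComponent f.totalDegree f) = 0 :=
  eval_top_eq_zero_of_const (x := a i) (c := 0) hf fun t =>
    h.eval_eq_zero i hi _ (Submodule.smul_mem _ t hv)

/-- Few planes of the family share a direction along which `f` is not constant. -/
theorem card_le_of_mem (h : IsPlaneFamily f s a V) (hf : Irreducible f) (hd : f.totalDegree ≠ 0)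
    {w : Fin n → ℚ} (hw : dirDeriv f w ≠ 0) (hs : ∀ i ∈ s, w ∈ V i) :
    s.card ≤ 2 * f.totalDegree ^ 2 := by
  have hlt := totalDegree_dirDeriv_lt hd w
  refine (card_planes_le (isRelPrime_of_totalDegree_lt hf hw hlt) s a V h.1 h.2 h.3
    fun i hi v hv => eval_dirDeriv_eq_zero fun t => ?_).trans ?_
  · rw [add_assoc]
    exact h.3 i hi _ (add_mem hv (Submodule.smul_mem _ _ (hs i hi)))
  · rw [sq, mul_assoc]
    exact Nat.mul_le_mul_left _ (Nat.mul_le_mul_left _ hlt.le)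

theorem exists_dirDeriv_ne_zero (h : IsPlaneFamily f s a V) (hf : IsNCC f) {i : ι} (hi : i ∈ s) :
    ∃ w ∈ V i, dirDeriv f w ≠ 0 := by
  by_contra! hcon
  have hle : V i ≤ LinearMap.ker (dirDeriv f) := fun w hw => hcon w hw
  have hr := h.1 i hi
  obtain ⟨x, hx⟩ : ∃ x, x ∉ V i := by
    by_contra! hall
    exact ne_top_of_finrank_lt (V := V i) (by omega) (eq_top_iff.mpr fun x _ => hall x)
  obtain ⟨y, hy⟩ : ∃ y, y ∉ V i ⊔ Submodule.span ℚ {x} := by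
    by_contra! hall
    refine ne_top_of_finrank_lt (V := V i ⊔ Submodule.span ℚ {x}) ?_
      (eq_top_iff.mpr fun x _ => hall x)
    have := finrank_sup_span_singleton_le (V i) x
    omega
  have l1 : Module.finrank ℚ (V i) < Module.finrank ℚ
      (V i ⊔ Submodule.span ℚ {x} : Submodule ℚ (Fin n → ℚ)) :=
    Submodule.finrank_lt_finrank_of_lt (lt_of_le_of_ne le_sup_left fun he => hx (by
      rw [he]; exact Submodule.mem_sup_right (Submodule.mem_span_singleton_self x)))
  have l2 : Module.finrank ℚ (V i ⊔ Submodule.span ℚ {x} : Submodule ℚ (Fin n → ℚ)) <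
      Module.finrank ℚ
        (V i ⊔ Submodule.span ℚ {x} ⊔ Submodule.span ℚ {y} : Submodule ℚ (Fin n → ℚ)) :=
    Submodule.finrank_lt_finrank_of_lt (lt_of_le_of_ne le_sup_left fun he => hy (by
      rw [he]; exact Submodule.mem_sup_right (Submodule.mem_span_singleton_self y)))
  refine ker_dirDeriv_sup_ne_top hf x y (eq_top_iff.mpr ?_)
  have htop : V i ⊔ Submodule.span ℚ {x} ⊔ Submodule.span ℚ {y} = ⊤ := by
    refine Submodule.eq_top_of_finrank_eq (le_antisymm (Submodule.finrank_le _) ?_)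
    rw [Module.finrank_fin_fun]
    omega
  rw [← htop, sup_assoc, ← Submodule.span_union]
  exact sup_le_sup hle (Submodule.span_mono (by intro z hz; simpa [or_comm] using hz))

theorem card_le_of_eq (h : IsPlaneFamily f s a V) (hf : Irreducible f) (hd : f.totalDegree ≠ 0)
    (hncc : IsNCC f) (W : Submodule ℚ (Fin n → ℚ)) (hs : ∀ i ∈ s, V i = W) :
    s.card ≤ 2 * f.totalDegree ^ 2 := by
  obtain rfl | ⟨i, hi⟩ := s.eq_empty_or_nonempty
  · simp
  obtain ⟨w, hw, hw0⟩ := h.exists_dirDeriv_ne_zero hncc hi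
  exact h.card_le_of_mem hf hd hw0 fun j hj => by rw [hs j hj, ← hs i hi]; exact hw

end IsPlaneFamily

/-- The restriction of `f` to the line `x + t v`. -/
noncomputable def linePoly {R : Type*} [CommRing R] {n : ℕ} (f : MvPolynomial (Fin n) R)
    (x v : Fin n → R) : Polynomial R :=
  eval₂ Polynomial.C (fun i => Polynomial.C (x i) + Polynomial.X * Polynomial.C (v i)) f

theorem eval_linePoly {R : Type*} [CommRing R] {n : ℕ} (f : MvPolynomial (Fin n) R)
    (x v : Fin n → R) (t : R) : (linePoly f x v).eval t = eval (x + t • v) f := by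
  have := eval₂_comp_left (Polynomial.evalRingHom t) Polynomial.C
    (fun i => Polynomial.C (x i) + Polynomial.X * Polynomial.C (v i)) f
  rw [Polynomial.coe_evalRingHom] at this
  rw [linePoly, this, eval₂_eq', eval_eq']
  simp [mul_comm t]

theorem linePoly_map {R S : Type*} [CommRing R] [CommRing S] (φ : R →+* S) {n : ℕ}
    (f : MvPolynomial (Fin n) R) (x v : Fin n → R) :
    (linePoly f x v).map φ = linePoly (map φ f) (φ ∘ x) (φ ∘ v) := by
  induction f using MvPolynomial.induction_on with
  | C a => simp [linePoly]
  | add p q hp hq => simp_all [linePoly]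
  | mul_X p i hp => simp_all [linePoly]

theorem linePoly_smul_right {R : Type*} [CommRing R] {n : ℕ} (f : MvPolynomial (Fin n) R)
    (x v : Fin n → R) (μ : R) :
    linePoly f x (μ • v) = (linePoly f x v).comp (Polynomial.C μ * Polynomial.X) := by
  induction f using MvPolynomial.induction_on with
  | C a => simp [linePoly]
  | add p q hp hq => simp_all [linePoly]
  | mul_X p i hp =>
    simp only [linePoly, eval₂_mul, eval₂_X, Polynomial.mul_comp] at hp ⊢
    rw [hp]
    simp only [Polynomial.add_comp, Polynomial.mul_comp, Polynomial.C_comp, Polynomial.X_comp,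
      Pi.smul_apply, smul_eq_mul, Polynomial.C_mul]
    ring

theorem linePoly_smul_smul {R : Type*} [CommRing R] {n e : ℕ} {f : MvPolynomial (Fin n) R}
    (hf : f.IsHomogeneous e) (x v : Fin n → R) (μ : R) :
    linePoly f (μ • x) (μ • v) = Polynomial.C (μ ^ e) * linePoly f x v := by
  simp only [linePoly, eval₂_eq', Finset.mul_sum]
  refine Finset.sum_congr rfl fun m hm => ?_
  have hdeg : m.degree = e := by
    rw [Finsupp.degree_eq_weight_one]; exact hf (mem_support_iff.mp hm)
  rw [← hdeg, Finsupp.degree_eq_sum, ← Finset.prod_pow_eq_pow_sum, map_prod, mul_left_comm,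
    ← Finset.prod_mul_distrib]
  congr 1
  refine Finset.prod_congr rfl fun i _ => ?_
  rw [Polynomial.C_pow, ← mul_pow]
  simp only [Pi.smul_apply, smul_eq_mul, Polynomial.C_mul]
  ring

theorem coeff_zero_linePoly {R : Type*} [CommRing R] {n : ℕ} (f : MvPolynomial (Fin n) R)
    (x v : Fin n → R) : (linePoly f x v).coeff 0 = eval x f := by
  rw [Polynomial.coeff_zero_eq_eval_zero, eval_linePoly, zero_smul, add_zero]

theorem coeff_one_linePoly {R : Type*} [CommRing R] {n : ℕ} (f : MvPolynomial (Fin n) R)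
    (x v : Fin n → R) : (linePoly f x v).coeff 1 = ∑ i, v i * eval x (pderiv i f) := by
  induction f using MvPolynomial.induction_on with
  | C a => simp [linePoly]
  | add p q hp hq =>
    have : linePoly (p + q) x v = linePoly p x v + linePoly q x v := by simp [linePoly]
    rw [this, Polynomial.coeff_add, hp, hq]
    simp [mul_add, Finset.sum_add_distrib]
  | mul_X p i hp =>
    have : linePoly (p * X i) x v = linePoly p x v * Polynomial.C (x i)
        + linePoly p x v * Polynomial.X * Polynomial.C (v i) := by simp [linePoly]; ring
    rw [this, Polynomial.coeff_add, Polynomial.coeff_mul_C, Polynomial.coeff_mul_C, hp,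
      Polynomial.coeff_mul_X, coeff_zero_linePoly]
    simp only [Derivation.leibniz, smul_eq_mul, pderiv_X, map_add, map_mul, mul_add,
      Finset.sum_add_distrib, Finset.sum_mul, eval_X]
    rw [add_comm]
    congr 1
    · simp [Pi.single_apply, apply_ite (eval x), mul_comm]
    · exact Finset.sum_congr rfl fun j _ => by ring

theorem pow_mul_coeff_linePoly {R : Type*} [CommRing R] {n e : ℕ} {f : MvPolynomial (Fin n) R}
    (hf : f.IsHomogeneous e) (x v : Fin n → R) (μ : R) (k : ℕ) :
    μ ^ k * (linePoly f (μ • x) v).coeff k = μ ^ e * (linePoly f x v).coeff k := by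
  have := congrArg (fun P => P.coeff k) (linePoly_smul_smul hf x v μ)
  simp only [Polynomial.coeff_C_mul] at this
  rw [← this, linePoly_smul_right, Polynomial.comp_C_mul_X_coeff, mul_comm]

theorem pow_three_dvd_eval_sub (P : Polynomial ℤ) (t : ℤ) :
    t ^ 3 ∣ P.eval t - (P.coeff 0 + P.coeff 1 * t + P.coeff 2 * t ^ 2) := by
  have h1 := Polynomial.X_mul_divX_add P
  have h2 := Polynomial.X_mul_divX_add P.divX
  have h3 := Polynomial.X_mul_divX_add P.divX.divX
  rw [Polynomial.coeff_divX] at h2 h3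
  rw [Polynomial.coeff_divX] at h3
  refine ⟨P.divX.divX.divX.eval t, ?_⟩
  conv_lhs => enter [1]; rw [← h1, ← h2, ← h3]
  simp only [Polynomial.eval_add, Polynomial.eval_mul, Polynomial.eval_X, Polynomial.eval_C]
  ring

/-- The congruences satisfied by the integral points of a plane curve in the residue class of a
nonsingular point modulo `p`. -/
theorem residue_class_dvd {p : ℕ} (hp : p.Prime) {e : ℕ} (he : 2 ≤ e)
    {F : MvPolynomial (Fin 3) ℤ} (hF : F.IsHomogeneous e) {i j k : Fin 3}
    (hijk : ∀ c : Fin 3 → ℤ, ∑ l, c l = c i + c j + c k) {w₀ : Fin 3 → ℤ} (hw₀ : eval w₀ F = 0)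
    (hi : ¬ (p : ℤ) ∣ w₀ i) {g : Fin 3 → ℤ} (hg : ∀ l, g l = eval w₀ (pderiv l F))
    (hj : ¬ (p : ℤ) ∣ g j) :
    ∃ κ : ℤ, ∀ w : Fin 3 → ℤ, eval w F = 0 → ¬ (p : ℤ) ∣ w i →
      (∀ l, (p : ℤ) ∣ w₀ i * w l - w i * w₀ l) →
      (p : ℤ) ^ 2 ∣ ∑ l, g l * w l ∧
      (p : ℤ) ^ 3 ∣ g j ^ 2 * w₀ i * (w i * ∑ l, g l * w l) +
        κ * (w₀ i * w k - w i * w₀ k) ^ 2 := by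
  have hpp : Prime (p : ℤ) := Nat.prime_iff_prime_int.mp hp
  have hp0 : (p : ℤ) ≠ 0 := hpp.ne_zero
  have hij : i ≠ j := by
    rintro rfl
    have h1 := hijk (Pi.single i 1)
    by_cases hik : k = i
    · subst hik; simp at h1
    · rw [Finset.sum_pi_single'] at h1; simp [hik] at h1
  have hik : i ≠ k := by
    rintro rfl
    have h1 := hijk (Pi.single i 1)
    simp [hij.symm] at h1
  have hjk : j ≠ k := by
    rintro rfl
    have h1 := hijk (Pi.single j 1)
    simp [hij] at h1
  let η₀ : Fin 3 → ℤ := fun l => if l = j then - g k else if l = k then g j else 0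
  refine ⟨(linePoly F w₀ η₀).coeff 2, fun w hw hwi hcl => ?_⟩
  choose η hη using hcl
  have heul : ∑ l, g l * w₀ l = 0 := by
    have := congrArg (eval w₀) hF.sum_X_mul_pderiv
    rw [map_sum] at this
    simp only [map_mul, eval_X, ← hg, map_nsmul, hw₀, smul_zero] at this
    rw [← this]; exact Finset.sum_congr rfl fun l _ => mul_comm _ _
  have hηi : η i = 0 := by
    have := hη i
    rw [mul_comm, sub_self] at this
    exact (mul_eq_zero.mp this.symm).resolve_left hp0
  have hgη : w₀ i * ∑ l, g l * w l = p * ∑ l, g l * η l := by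
    have : w₀ i * ∑ l, g l * w l = ∑ l, g l * (w₀ i * w l - w i * w₀ l)
        + w i * ∑ l, g l * w₀ l := by
      rw [Finset.mul_sum, Finset.mul_sum, ← Finset.sum_add_distrib]
      exact Finset.sum_congr rfl fun l _ => by ring
    rw [this, heul, mul_zero, add_zero, Finset.mul_sum]
    exact Finset.sum_congr rfl fun l _ => by rw [hη]; ring
  have hwi0 : w i ≠ 0 := fun h => hwi (by rw [h]; exact dvd_zero _)
  set P := linePoly F (w i • w₀) η with hP
  have hPe : P.eval (p : ℤ) = 0 := by
    rw [eval_linePoly]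
    have : w i • w₀ + (p : ℤ) • η = w₀ i • w := by
      ext l
      simp only [Pi.add_apply, Pi.smul_apply, smul_eq_mul, ← hη]
      ring
    rw [this]
    have h0 := congrArg (fun P => P.coeff 0) (linePoly_smul_smul hF w 0 (w₀ i))
    simp only [Polynomial.coeff_C_mul, coeff_zero_linePoly] at h0
    rw [h0, hw, mul_zero]
  have hc0 : P.coeff 0 = 0 := by
    have := pow_mul_coeff_linePoly hF w₀ η (w i) 0
    rw [coeff_zero_linePoly F w₀, hw₀, mul_zero, pow_zero, one_mul] at this
    exact this
  obtain ⟨r, hr⟩ : ∃ r, e = r + 2 := ⟨e - 2, by omega⟩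
  have hc1 : P.coeff 1 = w i ^ r * (w i * ∑ l, g l * η l) := by
    have := pow_mul_coeff_linePoly hF w₀ η (w i) 1
    rw [coeff_one_linePoly F w₀, hr] at this
    simp only [← hg] at this
    apply mul_left_cancel₀ hwi0
    rw [pow_one] at this
    rw [hP, this, Finset.mul_sum, Finset.mul_sum, Finset.mul_sum, Finset.mul_sum]
    exact Finset.sum_congr rfl fun l _ => by ring
  have hc2 : P.coeff 2 = w i ^ r * (linePoly F w₀ η).coeff 2 := by
    have := pow_mul_coeff_linePoly hF w₀ η (w i) 2
    apply mul_left_cancel₀ (pow_ne_zero 2 hwi0)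
    rw [hP, this, hr]
    ring
  have hmain : (p : ℤ) ^ 2 ∣ w i * ∑ l, g l * η l + (linePoly F w₀ η).coeff 2 * p := by
    have h3 := pow_three_dvd_eval_sub P p
    rw [hPe, hc0, hc1, hc2] at h3
    have h4 : (p : ℤ) ^ 3 ∣
      w i ^ r * (p * (w i * ∑ l, g l * η l + (linePoly F w₀ η).coeff 2 * p)) := by
      rw [← dvd_neg]
      exact (congrArg (fun z => (p : ℤ) ^ 3 ∣ z) (by ring)).mp h3
    have h5 : IsCoprime ((p : ℤ) ^ 3) (w i ^ r) :=
      IsCoprime.pow ((hpp.coprime_iff_not_dvd).mpr hwi)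
    have h6 := h5.dvd_of_dvd_mul_left h4
    rw [pow_succ', ] at h6
    exact (mul_dvd_mul_iff_left hp0).mp h6
  have hd1 : (p : ℤ) ∣ ∑ l, g l * η l := by
    have h1 : (p : ℤ) ∣ w i * ∑ l, g l * η l + (linePoly F w₀ η).coeff 2 * p :=
      (dvd_pow_self _ two_ne_zero).trans hmain
    exact (hpp.dvd_or_dvd ((dvd_add_left (dvd_mul_left _ _)).mp h1)).resolve_left hwi
  have hs : (p : ℤ) ^ 2 ∣ ∑ l, g l * w l := by
    have h1 : (p : ℤ) ^ 2 ∣ w₀ i * ∑ l, g l * w l := by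
      rw [hgη, sq]; exact mul_dvd_mul_left _ hd1
    exact (IsCoprime.pow_left ((hpp.coprime_iff_not_dvd).mpr hi)).dvd_of_dvd_mul_left h1
  refine ⟨hs, ?_⟩
  obtain ⟨γ, hγ⟩ := hs
  have hgη' : ∑ l, g l * η l = w₀ i * p * γ := by
    apply mul_left_cancel₀ hp0
    rw [← hgη, hγ]; ring
  have hrel : (p : ℤ) ∣ w i * w₀ i * γ + (linePoly F w₀ η).coeff 2 := by
    rw [hgη'] at hmain
    have : (p : ℤ) * p ∣ p * (w i * w₀ i * γ + (linePoly F w₀ η).coeff 2) := by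
      rw [← sq]; convert hmain using 1; ring
    exact (mul_dvd_mul_iff_left hp0).mp this
  have hquad : (p : ℤ) ∣ g j ^ 2 * (linePoly F w₀ η).coeff 2
      - η k ^ 2 * (linePoly F w₀ η₀).coeff 2 := by
    have hcomp : ∀ (μ : ℤ) (v : Fin 3 → ℤ), (linePoly F w₀ (μ • v)).coeff 2 =
        μ ^ 2 * (linePoly F w₀ v).coeff 2 := fun μ v => by
      rw [linePoly_smul_right, Polynomial.comp_C_mul_X_coeff, mul_comm]
    rw [← hcomp, ← hcomp, ← (ZMod.intCast_zmod_eq_zero_iff_dvd _ p), Int.cast_sub, sub_eq_zero,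
      ← eq_intCast (Int.castRingHom (ZMod p)), ← eq_intCast (Int.castRingHom (ZMod p)),
      ← Polynomial.coeff_map, ← Polynomial.coeff_map, linePoly_map, linePoly_map]
    congr 2
    ext l
    simp only [Function.comp, Pi.smul_apply, smul_eq_mul, eq_intCast]
    rw [ZMod.intCast_eq_intCast_iff_dvd_sub]
    by_cases hli : l = i
    · simp [η₀, hli, hij, hik, hηi]
    by_cases hlj : l = j
    · subst hlj
      have := hijk (fun l => g l * η l)
      simp only [hηi, mul_zero, zero_add] at this
      rw [this] at hd1
      simp only [η₀, if_true]
      exact (congrArg (fun z => (p : ℤ) ∣ z) (by simp; ring)).mp (dvd_neg.mpr hd1)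
    by_cases hlk : l = k
    · subst hlk
      simp [η₀, hlj, mul_comm]
    · omega
  rw [hγ]
  have hu : w₀ i * w k - w i * w₀ k = p * η k := hη k
  rw [hu, pow_succ]
  have : g j ^ 2 * w₀ i * (w i * ((p : ℤ) ^ 2 * γ)) + (linePoly F w₀ η₀).coeff 2 * (p * η k) ^ 2 =
      p ^ 2 * (g j ^ 2 * (w i * w₀ i * γ + (linePoly F w₀ η).coeff 2) -
      (g j ^ 2 * (linePoly F w₀ η).coeff 2 - η k ^ 2 * (linePoly F w₀ η₀).coeff 2)) := by ring
  rw [this]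
  exact mul_dvd_mul_left _ (dvd_sub (dvd_mul_of_dvd_right hrel _) hquad)

/-- The value at `w` of the monomial with exponents `m`. -/
def monVal {R : Type*} [CommRing R] (m : Fin 3 → ℕ) (w : Fin 3 → R) : R := ∏ l, w l ^ m l

/-- The residue class modulo `p` of a point `w₀` on the projective curve `F = 0`. -/
structure InClass (p : ℕ) (F : MvPolynomial (Fin 3) ℤ) (i : Fin 3) (w₀ w : Fin 3 → ℤ) : Prop where
  eval_eq_zero : eval w F = 0
  not_dvd : ¬ (p : ℤ) ∣ w i
  dvd_minor : ∀ l, (p : ℤ) ∣ w₀ i * w l - w i * w₀ l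

/-- The exponents `mon` run over all ternary monomials of degree `D`, the product of these
monomials is `(x₀x₁x₂)^m`, and their determinant at points of one residue class modulo `p` of a
curve is divisible by `p ^ K`. -/
structure Veronese (D s K m : ℕ) (mon : Fin s → Fin 3 → ℕ) : Prop where
  sum_eq : ∀ j, ∑ l, mon j l = D
  inj : Function.Injective mon
  surj : ∀ e : Fin 3 → ℕ, ∑ l, e l = D → ∃ j, mon j = e
  sum_exp : ∀ l, ∑ j, mon j l = m
  dvd_det : ∀ {p : ℕ}, p.Prime → ∀ {e : ℕ}, 2 ≤ e → ∀ {F : MvPolynomial (Fin 3) ℤ},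
    F.IsHomogeneous e → ∀ {i j : Fin 3} {w₀ : Fin 3 → ℤ}, eval w₀ F = 0 → ¬ (p : ℤ) ∣ w₀ i →
    i ≠ j → ¬ (p : ℤ) ∣ eval w₀ (pderiv j F) → ∀ w : Fin s → Fin 3 → ℤ,
    (∀ r, InClass p F i w₀ (w r)) →
    (p : ℤ) ^ K ∣ (Matrix.of fun r c => monVal (mon c) (w r)).det

theorem pow_dvd_det_of_mul_eq {s p : ℕ} (hp : p.Prime) {κ : ℤ} (hκ : ¬ (p : ℤ) ∣ κ)
    {M Q S : Matrix (Fin s) (Fin s) ℤ} (h : κ • M = Q * S) (k : Fin s → ℕ)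
    (hQ : ∀ r c, (p : ℤ) ^ k c ∣ Q r c) : (p : ℤ) ^ (∑ c, k c) ∣ M.det := by
  choose Q' hQ' using hQ
  have hQ'' : Q = Matrix.of fun r c => (p : ℤ) ^ k c * Matrix.of Q' r c := by
    ext r c; simp [hQ']
  have hdet := congrArg Matrix.det h
  rw [Matrix.det_smul, Matrix.det_mul, hQ'', Matrix.det_mul_row, Fintype.card_fin,
    Finset.prod_pow_eq_pow_sum] at hdet
  have hpp : Prime (p : ℤ) := Nat.prime_iff_prime_int.mp hp
  refine (IsCoprime.pow ((hpp.coprime_iff_not_dvd).mpr hκ)).dvd_of_dvd_mul_left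
    (y := κ ^ s) ?_
  rw [hdet, mul_assoc]
  exact dvd_mul_right _ _

/-- Coordinates adapted to a residue class: the functions `x`, `u`, `t` of a point of the class
have `p`-adic valuations at least `0`, `1`, `2`, and `G x t + κ u ^ 2` at least `3`. -/
theorem exists_class_coordinates {p : ℕ} (hp : p.Prime) {e : ℕ} (he : 2 ≤ e)
    {F : MvPolynomial (Fin 3) ℤ} (hF : F.IsHomogeneous e) {i j : Fin 3} {w₀ : Fin 3 → ℤ}
    (hw₀ : eval w₀ F = 0) (hi : ¬ (p : ℤ) ∣ w₀ i) (hij : i ≠ j)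
    (hj : ¬ (p : ℤ) ∣ eval w₀ (pderiv j F)) :
    ∃ (a G κ : ℤ) (α β γ : Fin 3 → ℤ), ¬ (p : ℤ) ∣ a ∧ ¬ (p : ℤ) ∣ G ∧
      ∀ w, InClass p F i w₀ w → ∃ x u t : ℤ, (p : ℤ) ∣ u ∧ (p : ℤ) ^ 2 ∣ t ∧
        (p : ℤ) ^ 3 ∣ G * (x * t) + κ * u ^ 2 ∧ ∀ l, a * w l = α l * x + β l * u + γ l * t := by
  have hpp : Prime (p : ℤ) := Nat.prime_iff_prime_int.mp hp
  obtain ⟨k, hik, hjk, hijk⟩ : ∃ k, i ≠ k ∧ j ≠ k ∧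
      ∀ c : Fin 3 → ℤ, ∑ l, c l = c i + c j + c k := by
    simp only [Fin.sum_univ_three]
    fin_cases i <;> fin_cases j <;> simp at hij ⊢
    · exact ⟨2, by decide, by decide, fun c => by ring⟩
    · exact ⟨1, by decide, by decide, fun c => by ring⟩
    · exact ⟨2, by decide, by decide, fun c => by ring⟩
    · exact ⟨0, by decide, by decide, fun c => by ring⟩
    · exact ⟨1, by decide, by decide, fun c => by ring⟩
    · exact ⟨0, by decide, by decide, fun c => by ring⟩
  set g : Fin 3 → ℤ := fun l => eval w₀ (pderiv l F) with hg
  have hj : ¬ (p : ℤ) ∣ g j := hj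
  obtain ⟨κ, hκ⟩ := residue_class_dvd hp he hF hijk hw₀ hi (g := g) (fun _ => rfl) hj
  refine ⟨w₀ i * g j, g j ^ 2 * w₀ i, κ,
    fun l => if l = i then w₀ i * g j else if l = j then - w₀ i * g i - g k * w₀ k else g j * w₀ k,
    fun l => if l = i then 0 else if l = j then - g k else g j,
    fun l => if l = i then 0 else if l = j then w₀ i else 0, ?_, ?_, fun w hw => ?_⟩
  · intro h; rcases hpp.dvd_or_dvd h with h | h <;> contradiction
  · intro h; rcases hpp.dvd_or_dvd h with h | h
    · exact hj (hpp.dvd_of_dvd_pow h)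
    · contradiction
  obtain ⟨h1, h2⟩ := hκ w hw.eval_eq_zero hw.not_dvd hw.dvd_minor
  refine ⟨w i, w₀ i * w k - w i * w₀ k, ∑ l, g l * w l, hw.dvd_minor k, h1, h2, fun l => ?_⟩
  by_cases hli : l = i
  · subst hli; simp
  by_cases hlj : l = j
  · subst hlj
    rw [hijk fun l => g l * w l]
    simp [hli]; ring
  · have hlk : l = k := by omega
    subst hlk
    simp [hli, hlj]; ring

/-- The exponents of the ternary monomials of degree one. -/
def monOne (j : Fin 3) (l : Fin 3) : ℕ := if l = j then 1 else 0

/-- The exponents of the ternary monomials of degree two. -/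
def monTwo : Fin 6 → Fin 3 → ℕ :=
  ![![2, 0, 0], ![1, 1, 0], ![1, 0, 1], ![0, 2, 0], ![0, 1, 1], ![0, 0, 2]]

theorem veronese_one : Veronese 1 3 3 1 monOne where
  sum_eq j := by simp [monOne]
  inj a b h := by
    have := congrFun h a
    by_contra hab
    simp [monOne, hab] at this
  surj e he := by
    rw [Fin.sum_univ_three] at he
    have h : e 0 = 1 ∧ e 1 = 0 ∧ e 2 = 0 ∨ e 0 = 0 ∧ e 1 = 1 ∧ e 2 = 0 ∨
      e 0 = 0 ∧ e 1 = 0 ∧ e 2 = 1 := by omega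
    rcases h with ⟨h0, h1, h2⟩ | ⟨h0, h1, h2⟩ | ⟨h0, h1, h2⟩
    · exact ⟨0, by ext l; fin_cases l <;> simp [monOne, *]⟩
    · exact ⟨1, by ext l; fin_cases l <;> simp [monOne, *]⟩
    · exact ⟨2, by ext l; fin_cases l <;> simp [monOne, *]⟩
  sum_exp l := by simp [monOne]
  dvd_det := by
    intro p hp e he F hF i j w₀ hw₀ hi hij hj w hw
    obtain ⟨a, G, κ, α, β, γ, ha, hG, h⟩ := exists_class_coordinates hp he hF hw₀ hi hij hj
    choose x u t hu ht hxt hwl using fun r => h (w r) (hw r)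
    have := pow_dvd_det_of_mul_eq hp ha (M := Matrix.of fun r c => monVal (monOne c) (w r))
      (Q := Matrix.of fun r => ![x r, u r, t r]) (S := Matrix.of ![α, β, γ]) (by
        ext r c
        have : monVal (monOne c) (w r) = w r c := by
          simp only [monVal, monOne]
          rw [Finset.prod_eq_single c] <;> simp +contextual
        simp only [Matrix.smul_apply, Matrix.of_apply, smul_eq_mul, this, hwl, Matrix.mul_apply,
          Fin.sum_univ_three]
        simp
        ring) ![0, 1, 2] (by
        intro r c
        fin_cases c
        · simp
        · simpa using hu r
        · simpa using ht r)
    simpa [Fin.sum_univ_three] using this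

theorem monVal_monTwo {R : Type*} [CommRing R] (c : Fin 6) (w : Fin 3 → R) :
    monVal (monTwo c) w =
      w ((![0, 0, 0, 1, 1, 2] : Fin 6 → Fin 3) c) *
        w ((![0, 1, 2, 1, 2, 2] : Fin 6 → Fin 3) c) := by
  fin_cases c <;> simp [monVal, monTwo, Fin.prod_univ_three, sq]

theorem veronese_two : Veronese 2 6 13 4 monTwo where
  sum_eq j := by fin_cases j <;> rfl
  inj := by decide
  surj e he := by
    rw [Fin.sum_univ_three] at he
    have h : e 0 = 2 ∧ e 1 = 0 ∧ e 2 = 0 ∨ e 0 = 1 ∧ e 1 = 1 ∧ e 2 = 0 ∨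
      e 0 = 1 ∧ e 1 = 0 ∧ e 2 = 1 ∨ e 0 = 0 ∧ e 1 = 2 ∧ e 2 = 0 ∨
      e 0 = 0 ∧ e 1 = 1 ∧ e 2 = 1 ∨ e 0 = 0 ∧ e 1 = 0 ∧ e 2 = 2 := by omega
    rcases h with ⟨h0, h1, h2⟩ | ⟨h0, h1, h2⟩ | ⟨h0, h1, h2⟩ | ⟨h0, h1, h2⟩ | ⟨h0, h1, h2⟩ |
      ⟨h0, h1, h2⟩
    · exact ⟨0, by ext l; fin_cases l <;> simp [monTwo, *]⟩
    · exact ⟨1, by ext l; fin_cases l <;> simp [monTwo, *]⟩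
    · exact ⟨2, by ext l; fin_cases l <;> simp [monTwo, *]⟩
    · exact ⟨3, by ext l; fin_cases l <;> simp [monTwo, *]⟩
    · exact ⟨4, by ext l; fin_cases l <;> simp [monTwo, *]⟩
    · exact ⟨5, by ext l; fin_cases l <;> simp [monTwo, *]⟩
  sum_exp l := by fin_cases l <;> rfl
  dvd_det := by
    intro p hp e he F hF i j w₀ hw₀ hi hij hj w hw
    obtain ⟨a, G, κ, α, β, γ, ha, hG, h⟩ := exists_class_coordinates hp he hF hw₀ hi hij hj
    choose x u t hu ht hxt hwl using fun r => h (w r) (hw r)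
    have hpp : Prime (p : ℤ) := Nat.prime_iff_prime_int.mp hp
    let b : Fin 6 → Fin 3 := ![0, 0, 0, 1, 1, 2]
    let b' : Fin 6 → Fin 3 := ![0, 1, 2, 1, 2, 2]
    have := pow_dvd_det_of_mul_eq hp (κ := G * a ^ 2)
      (fun h => (hpp.dvd_or_dvd h).elim hG fun h => ha (hpp.dvd_of_dvd_pow h))
      (M := Matrix.of fun r c => monVal (monTwo c) (w r))
      (Q := Matrix.of fun r => ![x r ^ 2, x r * u r, G * (x r * t r) + κ * u r ^ 2, u r ^ 2,
        u r * t r, t r ^ 2])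
      (S := Matrix.of ![fun c => G * (α (b c) * α (b' c)),
        fun c => G * (α (b c) * β (b' c) + α (b' c) * β (b c)),
        fun c => α (b c) * γ (b' c) + α (b' c) * γ (b c),
        fun c => G * (β (b c) * β (b' c)) - κ * (α (b c) * γ (b' c) + α (b' c) * γ (b c)),
        fun c => G * (β (b c) * γ (b' c) + β (b' c) * γ (b c)),
        fun c => G * (γ (b c) * γ (b' c))]) (by
        ext r c
        have : G * a ^ 2 * (w r (b c) * w r (b' c)) = G * ((a * w r (b c)) * (a * w r (b' c))) := by
          ring
        simp only [Matrix.smul_apply, Matrix.of_apply, smul_eq_mul, monVal_monTwo, Matrix.mul_apply,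
          Fin.sum_univ_six]
        change G * a ^ 2 * (w r (b c) * w r (b' c)) = _
        rw [this, hwl, hwl]
        simp
        ring) ![0, 1, 3, 2, 3, 4] (by
        intro r c
        have hu2 : (p : ℤ) ^ 2 ∣ u r ^ 2 := pow_dvd_pow_of_dvd (hu r) 2
        fin_cases c
        · simp
        · simpa using (hu r).mul_left (x r)
        · simpa using hxt r
        · simpa using hu2
        · simpa [pow_succ'] using mul_dvd_mul (hu r) (ht r)
        · simpa [← pow_mul] using pow_dvd_pow_of_dvd (ht r) 2)
    simpa [Fin.sum_univ_six] using this

theorem monVal_map {R S : Type*} [CommRing R] [CommRing S] (φ : R →+* S) (m : Fin 3 → ℕ)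
    (w : Fin 3 → R) : φ (monVal m w) = monVal m (fun l => φ (w l)) := by
  simp [monVal]

/-- The matrix of values of the monomials with exponents `mon` at the points `w`. -/
def monMatrix {R : Type*} [CommRing R] {s k : ℕ} (mon : Fin s → Fin 3 → ℕ) (w : Fin k → Fin 3 → R) :
    Matrix (Fin k) (Fin s) R :=
  Matrix.of fun r c => monVal (mon c) (w r)

theorem det_monMatrix_map {R S : Type*} [CommRing R] [CommRing S] (φ : R →+* S) {s : ℕ}
    (mon : Fin s → Fin 3 → ℕ) (w : Fin s → Fin 3 → R) :
    φ (monMatrix mon w).det = (monMatrix mon fun r l => φ (w r l)).det := by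
  rw [RingHom.map_det]
  congr 1
  ext r c
  simp [monMatrix, monVal_map]

theorem Veronese.abs_det_le {D s K m : ℕ} {mon : Fin s → Fin 3 → ℕ} (hV : Veronese D s K m mon)
    (w : Fin s → Fin 3 → ℤ) (X : Fin 3 → ℕ) (hX : ∀ r l, |w r l| ≤ X l) :
    |(monMatrix mon w).det| ≤ s.factorial * (∏ l, X l : ℕ) ^ m := by
  have hbd : ∏ c, monVal (mon c) (fun l => (X l : ℤ)) = ((∏ l, X l : ℕ) : ℤ) ^ m := by
    simp only [monVal]
    rw [Finset.prod_comm]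
    push_cast
    rw [← Finset.prod_pow]
    exact Finset.prod_congr rfl fun l _ => by rw [Finset.prod_pow_eq_pow_sum, hV.sum_exp]
  rw [Matrix.det_apply]
  refine (Finset.abs_sum_le_sum_abs _ _).trans ?_
  have hterm : ∀ σ : Equiv.Perm (Fin s),
      |Equiv.Perm.sign σ • ∏ i, monMatrix mon w (σ i) i| ≤ ((∏ l, X l : ℕ) : ℤ) ^ m := by
    intro σ
    rw [Units.smul_def, smul_eq_mul, abs_mul, Int.abs_eq_natAbs, Int.units_natAbs, ← hbd,
      Finset.abs_prod]
    simp only [Nat.cast_one, one_mul]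
    refine Finset.prod_le_prod (fun _ _ => abs_nonneg _) fun c _ => ?_
    simp only [monMatrix, monVal, Matrix.of_apply, Finset.abs_prod, abs_pow]
    exact Finset.prod_le_prod (fun _ _ => by positivity)
      fun l _ => pow_le_pow_left₀ (abs_nonneg _) (hX _ _) _
  refine (Finset.sum_le_sum fun σ _ => hterm σ).trans ?_
  simp [Fintype.card_perm]

/-- The form with coefficients `c`. -/
noncomputable def formOf {R : Type*} [CommRing R] {s : ℕ} (mon : Fin s → Fin 3 → ℕ)
    (c : Fin s → R) : MvPolynomial (Fin 3) R :=
  ∑ j, monomial (Finsupp.equivFunOnFinite.symm (mon j)) (c j)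

theorem eval_formOf {R : Type*} [CommRing R] {s : ℕ} (mon : Fin s → Fin 3 → ℕ)
    (c : Fin s → R) (w : Fin 3 → R) : eval w (formOf mon c) = ∑ j, c j * monVal (mon j) w := by
  simp [formOf, monVal, eval_monomial, Finsupp.prod_fintype]

theorem Veronese.isHomogeneous_formOf {R : Type*} [CommRing R] {D s K m : ℕ}
    {mon : Fin s → Fin 3 → ℕ} (hV : Veronese D s K m mon) (c : Fin s → R) :
    (formOf mon c).IsHomogeneous D := by
  refine IsHomogeneous.sum _ _ _ fun j _ => isHomogeneous_monomial _ ?_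
  rw [Finsupp.degree_eq_sum]
  exact hV.sum_eq j

theorem Veronese.coeff_formOf {R : Type*} [CommRing R] {D s K m : ℕ} {mon : Fin s → Fin 3 → ℕ}
    (hV : Veronese D s K m mon) (c : Fin s → R) (j : Fin s) :
    (formOf mon c).coeff (Finsupp.equivFunOnFinite.symm (mon j)) = c j := by
  classical
  simp only [formOf, coeff_sum, coeff_monomial]
  rw [Finset.sum_eq_single j]
  · simp
  · intro b _ hb
    rw [if_neg]
    exact fun h => hb (hV.inj (Finsupp.equivFunOnFinite.symm.injective h))
  · simp

theorem Veronese.exists_eq_formOf {R : Type*} [CommRing R] {D s K m : ℕ}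
    {mon : Fin s → Fin 3 → ℕ} (hV : Veronese D s K m mon) {q : MvPolynomial (Fin 3) R}
    (hq : q.IsHomogeneous D) : ∃ c, q = formOf mon c := by
  refine ⟨fun j => q.coeff (Finsupp.equivFunOnFinite.symm (mon j)), ?_⟩
  ext e
  by_cases he : ∑ l, e l = D
  · obtain ⟨j, hj⟩ := hV.surj e he
    have : e = Finsupp.equivFunOnFinite.symm (mon j) := by ext l; simp [hj]
    rw [this, hV.coeff_formOf]
  · rw [hq.coeff_eq_zero (by rwa [Finsupp.degree_eq_sum]),
      (hV.isHomogeneous_formOf _).coeff_eq_zero (by rwa [Finsupp.degree_eq_sum])]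

theorem Veronese.formOf_ne_zero {R : Type*} [CommRing R] {D s K m : ℕ} {mon : Fin s → Fin 3 → ℕ}
    (hV : Veronese D s K m mon) {c : Fin s → R} (hc : c ≠ 0) : formOf mon c ≠ 0 := by
  contrapose! hc
  ext j
  rw [← hV.coeff_formOf c j, hc, coeff_zero, Pi.zero_apply]

theorem Veronese.det_eq_zero {D s K m : ℕ} {mon : Fin s → Fin 3 → ℕ}
    (hV : Veronese D s K m mon) {q : MvPolynomial (Fin 3) ℚ} (hq : q.IsHomogeneous D) (hq0 : q ≠ 0)
    (w : Fin s → Fin 3 → ℚ) (hw : ∀ r, eval (w r) q = 0) : (monMatrix mon w).det = 0 := by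
  obtain ⟨c, rfl⟩ := hV.exists_eq_formOf hq
  refine Matrix.exists_mulVec_eq_zero_iff.mp ⟨c, ?_, ?_⟩
  · rintro rfl
    exact hq0 (by simp [formOf])
  · ext r
    rw [Pi.zero_apply, ← hw r, eval_formOf]
    simp [Matrix.mulVec, dotProduct, monMatrix, mul_comm]

theorem exists_functional_of_det_eq_zero {s : ℕ} (A : Set (Fin s → ℚ))
    (h : ∀ τ : Fin s → Fin s → ℚ, (∀ r, τ r ∈ A) → (Matrix.of τ).det = 0) :
    ∃ c : Fin s → ℚ, c ≠ 0 ∧ ∀ v ∈ A, ∑ j, c j * v j = 0 := by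
  have hlt : Submodule.span ℚ A < ⊤ := by
    rw [lt_top_iff_ne_top]
    intro htop
    obtain ⟨f, hf, -, hli⟩ := Submodule.exists_fun_fin_finrank_span_eq ℚ A
    have hs : Module.finrank ℚ (Submodule.span ℚ A) = s := by rw [htop]; simp
    let f' : Fin s → Fin s → ℚ := f ∘ Fin.cast hs.symm
    have hli' : LinearIndependent ℚ f' := hli.comp _ (Fin.cast_injective _)
    have h1 : IsUnit (Matrix.of f') := Matrix.linearIndependent_rows_iff_isUnit.mp hli'
    rw [Matrix.isUnit_iff_isUnit_det, h f' fun r => hf _] at h1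
    exact not_isUnit_zero h1
  obtain ⟨φ, hφ, hle⟩ := Submodule.exists_le_ker_of_lt_top _ hlt
  refine ⟨fun j => φ (fun i => if j = i then 1 else 0), ?_, fun v hv => ?_⟩
  · intro h0
    apply hφ
    ext j
    have := congrFun h0 j
    simp only [Pi.zero_apply] at this
    rw [LinearMap.comp_apply, LinearMap.zero_comp, LinearMap.zero_apply, ← this]
    congr 1
    ext i
    simp [LinearMap.single_apply, Pi.single_apply, eq_comm]
  · have := hle (Submodule.subset_span hv)
    rw [LinearMap.mem_ker, LinearMap.pi_apply_eq_sum_univ] at this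
    refine Eq.trans ?_ this
    exact Finset.sum_congr rfl fun j _ => by rw [smul_eq_mul, mul_comm]

theorem Veronese.exists_form {D s K m : ℕ} {mon : Fin s → Fin 3 → ℕ}
    (hV : Veronese D s K m mon) (A : Set (Fin 3 → ℚ))
    (h : ∀ τ : Fin s → Fin 3 → ℚ, (∀ r, τ r ∈ A) → (monMatrix mon τ).det = 0) :
    ∃ q : MvPolynomial (Fin 3) ℚ, q ≠ 0 ∧ q.IsHomogeneous D ∧ ∀ w ∈ A, eval w q = 0 := by
  obtain ⟨c, hc, hcv⟩ := exists_functional_of_det_eq_zero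
    ((fun w j => monVal (mon j) w) '' A) (fun τ hτ => by
      choose w hw hwτ using hτ
      rw [← h w hw]
      congr 1
      ext r j
      simp [monMatrix, ← hwτ])
  refine ⟨formOf mon c, hV.formOf_ne_zero hc, hV.isHomogeneous_formOf c, fun w hw => ?_⟩
  rw [eval_formOf]
  exact hcv _ ⟨w, hw, rfl⟩

theorem eval_smul_of_isHomogeneous {R : Type*} [CommRing R] {n e : ℕ}
    {F : MvPolynomial (Fin n) R} (hF : F.IsHomogeneous e) (μ : R) (x : Fin n → R) :
    eval (μ • x) F = μ ^ e * eval x F := by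
  have h0 := congrArg (fun P => P.coeff 0) (linePoly_smul_smul hF x 0 μ)
  simpa only [Polynomial.coeff_C_mul, coeff_zero_linePoly] using h0

theorem card_zeros_le {k : Type*} [Field k] [Fintype k] [DecidableEq k] {n : ℕ}
    {F : MvPolynomial (Fin (n + 1)) k} (hF : F ≠ 0) :
    (Finset.univ.filter fun v : Fin (n + 1) → k => eval v F = 0).card ≤
      F.totalDegree * Fintype.card k ^ n := by
  have h := schwartz_zippel_totalDegree hF Finset.univ
  have hk : (0 : ℚ≥0) < Fintype.card k := by exact_mod_cast Fintype.card_pos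
  rw [Finset.card_univ, div_le_iff₀ (by positivity), pow_succ', ← mul_assoc,
    div_mul_cancel₀ _ hk.ne', Fintype.piFinset_univ] at h
  exact_mod_cast h

theorem eval_map_castHom {p n : ℕ} (F : MvPolynomial (Fin n) ℤ) (w : Fin n → ℤ) :
    eval (fun l => (w l : ZMod p)) (map (Int.castRingHom (ZMod p)) F) = (eval w F : ZMod p) := by
  have := MvPolynomial.map_eval (Int.castRingHom (ZMod p)) w F
  rw [eq_intCast] at this
  rw [this]
  rfl

theorem eval_zero_of_isHomogeneous {R : Type*} [CommRing R] {σ : Type*} {F : MvPolynomial σ R}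
    {e : ℕ} (hF : F.IsHomogeneous e) (he : e ≠ 0) : eval (0 : σ → R) F = 0 := by
  rw [eval_zero, constantCoeff_eq]
  exact hF.coeff_eq_zero (by simpa using he.symm)

theorem sum_mul_eval_pderiv_eq_zero {R : Type*} [CommRing R] {n e : ℕ}
    {F : MvPolynomial (Fin n) R} (hF : F.IsHomogeneous e) {w : Fin n → R} (hw : eval w F = 0) :
    ∑ l, eval w (pderiv l F) * w l = 0 := by
  have := congrArg (eval w) hF.sum_X_mul_pderiv
  rw [map_sum] at this
  simp only [map_mul, eval_X, map_nsmul, hw, smul_zero] at this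
  rw [← this]
  exact Finset.sum_congr rfl fun l _ => mul_comm _ _

/-- Counting the points of a plane curve by residue classes modulo `p`. -/
theorem Veronese.card_le_of_prime {D s K m : ℕ} {mon : Fin s → Fin 3 → ℕ}
    (hV : Veronese D s K m mon) {p : ℕ} (hp : p.Prime) {e : ℕ} (he : 2 ≤ e)
    {F : MvPolynomial (Fin 3) ℤ} (hF : F.IsHomogeneous e) {ι : Type*} (A : Finset ι)
    (w : ι → Fin 3 → ℤ) (hw : ∀ a ∈ A, eval (w a) F = 0)
    (hns : ∀ a ∈ A, ∃ l, ¬ (p : ℤ) ∣ eval (w a) (pderiv l F)) (N : ℕ)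
    (hN : ∀ T ⊆ A, (∀ τ : Fin s → ι, (∀ r, τ r ∈ T) →
      (p : ℤ) ^ K ∣ (monMatrix mon fun r => w (τ r)).det) → T.card ≤ N) :
    A.card ≤ 2 * e * p * N := by
  classical
  have : Fact p.Prime := ⟨hp⟩
  have hpp : Prime (p : ℤ) := Nat.prime_iff_prime_int.mp hp
  let wb : ι → Fin 3 → ZMod p := fun a l => (w a l : ZMod p)
  let f : ι → Submodule (ZMod p) (Fin 3 → ZMod p) := fun a => Submodule.span (ZMod p) {wb a}
  have hdvd : ∀ z : ℤ, (p : ℤ) ∣ z ↔ (z : ZMod p) = 0 :=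
    fun z => (ZMod.intCast_zmod_eq_zero_iff_dvd z p).symm
  have hpd : ∀ l, ((map (Int.castRingHom (ZMod p)) (pderiv l F))).IsHomogeneous (e - 1) :=
    fun l => hF.pderiv.map _
  have hwb : ∀ a ∈ A, wb a ≠ 0 := by
    intro a ha h0
    obtain ⟨l, hl⟩ := hns a ha
    apply hl
    rw [hdvd, ← eval_map_castHom]
    change eval (wb a) _ = 0
    rw [h0, eval_zero_of_isHomogeneous (hpd l) (by omega)]
  have hfib : ∀ b ∈ A.image f, {a ∈ A | f a = b}.card ≤ N := by
    intro b hb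
    obtain ⟨a₀, ha₀, rfl⟩ := Finset.mem_image.mp hb
    refine hN _ (Finset.filter_subset _ _) fun τ hτ => ?_
    obtain ⟨i, hi⟩ : ∃ i, wb a₀ i ≠ 0 := by
      by_contra! h
      exact hwb a₀ ha₀ (funext h)
    have hi' : ¬ (p : ℤ) ∣ w a₀ i := by rwa [hdvd]
    obtain ⟨j, hij, hj⟩ : ∃ j, i ≠ j ∧ ¬ (p : ℤ) ∣ eval (w a₀) (pderiv j F) := by
      by_contra! h
      have hsum := sum_mul_eval_pderiv_eq_zero hF (hw a₀ ha₀)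
      rw [← Finset.add_sum_erase _ _ (Finset.mem_univ i)] at hsum
      have hd : (p : ℤ) ∣ ∑ l ∈ Finset.univ.erase i, eval (w a₀) (pderiv l F) * w a₀ l :=
        Finset.dvd_sum fun l hl => (h l (Finset.ne_of_mem_erase hl).symm).mul_right _
      have hd' : (p : ℤ) ∣ eval (w a₀) (pderiv i F) * w a₀ i := by
        rw [eq_neg_of_add_eq_zero_left hsum]; exact hd.neg_right
      have hdi := (hpp.dvd_or_dvd hd').resolve_right hi'
      obtain ⟨l, hl⟩ := hns a₀ ha₀
      by_cases hli : i = l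
      · exact hl (hli ▸ hdi)
      · exact hl (h l hli)
    refine hV.dvd_det hp he hF (hw a₀ ha₀) hi' hij hj _ fun r => ?_
    obtain ⟨hrA, hr⟩ := Finset.mem_filter.mp (hτ r)
    have hmem : wb (τ r) ∈ f a₀ := hr ▸ Submodule.mem_span_singleton_self _
    obtain ⟨u, hu⟩ := Submodule.mem_span_singleton.mp hmem
    have hul : ∀ l, (w (τ r) l : ZMod p) = u * w a₀ l := fun l => (congrFun hu l).symm
    refine ⟨hw _ hrA, ?_, fun l => ?_⟩
    · rw [hdvd, hul]
      refine mul_ne_zero ?_ hi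
      rintro rfl
      exact hwb _ hrA (by rw [← hu, zero_smul])
    · rw [hdvd]
      push_cast
      rw [hul, hul]
      ring
  have h1 := Finset.card_le_mul_card_image A N hfib
  rcases A.eq_empty_or_nonempty with rfl | ⟨a₁, ha₁⟩
  · simp
  set Fp := map (Int.castRingHom (ZMod p)) F with hFp
  have hFp0 : Fp ≠ 0 := by
    intro h0
    obtain ⟨l, hl⟩ := hns a₁ ha₁
    apply hl
    rw [hdvd, ← eval_map_castHom, ← pderiv_map, ← hFp, h0, map_zero, map_zero]
  set Z := Finset.univ.filter fun v : Fin 3 → ZMod p => eval v Fp = 0 with hZ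
  have hZc : Z.card ≤ e * p ^ 2 := by
    have := card_zeros_le hFp0
    rw [ZMod.card] at this
    exact this.trans (Nat.mul_le_mul_right _ (hF.map _).totalDegree_le)
  have h2 : (p - 1) * (A.image f).card ≤ Z.card := by
    let g : (Fin 3 → ZMod p) → Submodule (ZMod p) (Fin 3 → ZMod p) :=
      fun v => Submodule.span (ZMod p) {v}
    let Z' := Z.filter fun v => g v ∈ A.image f
    refine le_trans ?_ (Finset.card_le_card (Finset.filter_subset (fun v => g v ∈ A.image f) Z))
    refine Finset.mul_card_image_le_card_of_maps_to (f := g) (s := Z') (t := A.image f)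
      (fun v hv => (Finset.mem_filter.mp hv).2) _ fun b hb => ?_
    obtain ⟨a, ha, rfl⟩ := Finset.mem_image.mp hb
    have hinj : Function.Injective fun u : (ZMod p)ˣ => (u : ZMod p) • wb a := fun u u' huu' =>
      Units.ext (smul_left_injective _ (hwb a ha) huu')
    have hcard : (Finset.univ.image fun u : (ZMod p)ˣ => (u : ZMod p) • wb a).card = p - 1 := by
      rw [Finset.card_image_of_injective _ hinj, Finset.card_univ, ZMod.card_units]
    rw [← hcard]
    refine Finset.card_le_card fun v hv => ?_
    obtain ⟨u, -, rfl⟩ := Finset.mem_image.mp hv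
    have hspan : g ((u : ZMod p) • wb a) = f a :=
      Submodule.span_singleton_smul_eq (Units.isUnit u) _
    refine Finset.mem_filter.mpr ⟨Finset.mem_filter.mpr ⟨Finset.mem_filter.mpr
      ⟨Finset.mem_univ _, ?_⟩, ?_⟩, hspan⟩
    · rw [hFp, eval_smul_of_isHomogeneous (hF.map _)]
      have : eval (wb a) (map (Int.castRingHom (ZMod p)) F) = 0 := by
        rw [eval_map_castHom, hw a ha, Int.cast_zero]
      rw [this, mul_zero]
    · rw [hspan]; exact hb
  have h3 : (A.image f).card ≤ 2 * e * p := by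
    have hp2 := hp.two_le
    have h4 : p * (A.image f).card ≤ p * (2 * e * p) := by
      calc p * (A.image f).card ≤ 2 * (p - 1) * (A.image f).card :=
            Nat.mul_le_mul_right _ (by omega)
        _ = 2 * ((p - 1) * (A.image f).card) := by ring
        _ ≤ 2 * (e * p ^ 2) := Nat.mul_le_mul_left _ (h2.trans hZc)
        _ = p * (2 * e * p) := by ring
    exact Nat.le_of_mul_le_mul_left h4 hp.pos
  calc A.card ≤ N * (A.image f).card := h1
    _ ≤ N * (2 * e * p) := Nat.mul_le_mul_left _ h3
    _ = 2 * e * p * N := mul_comm _ _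

/-- An integral vector viewed as a rational one. -/
def ratVec {n : ℕ} (w : Fin n → ℤ) : Fin n → ℚ := fun l => (w l : ℚ)

theorem ratVec_ne_zero {n : ℕ} {w : Fin n → ℤ} (hw : w ≠ 0) : ratVec w ≠ 0 := by
  intro h
  apply hw
  ext l
  have := congrFun h l
  simpa [ratVec] using this

theorem eval_ratVec {n : ℕ} (F : MvPolynomial (Fin n) ℤ) (w : Fin n → ℤ) :
    eval (ratVec w) (map (Int.castRingHom ℚ) F) = (eval w F : ℚ) := by
  have := MvPolynomial.map_eval (Int.castRingHom ℚ) w F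
  rw [eq_intCast] at this
  rw [this]
  rfl

/-- A finite family of distinct points of the projective plane, given by integral coordinates. -/
structure IsPointFamily {ι : Type*} (A : Finset ι) (w : ι → Fin 3 → ℤ) : Prop where
  ne_zero : ∀ a ∈ A, w a ≠ 0
  inj : ∀ a ∈ A, ∀ b ∈ A,
    Submodule.span ℚ {ratVec (w a)} = Submodule.span ℚ {ratVec (w b)} → a = b

theorem IsPointFamily.mono {ι : Type*} {A B : Finset ι} {w : ι → Fin 3 → ℤ}
    (h : IsPointFamily A w) (hB : B ⊆ A) : IsPointFamily B w :=
  ⟨fun a ha => h.ne_zero a (hB ha), fun a ha b hb => h.inj a (hB ha) b (hB hb)⟩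

theorem eval_eq_zero_of_mem_span {n e : ℕ} {F : MvPolynomial (Fin n) ℚ} (hF : F.IsHomogeneous e)
    {w v : Fin n → ℚ} (hw : eval w F = 0) (hv : v ∈ Submodule.span ℚ {w}) : eval v F = 0 := by
  obtain ⟨t, rfl⟩ := Submodule.mem_span_singleton.mp hv
  rw [eval_smul_of_isHomogeneous hF, hw, mul_zero]

theorem IsPointFamily.card_le_of_isRelPrime {ι : Type*} {A : Finset ι} {w : ι → Fin 3 → ℤ}
    (h : IsPointFamily A w) {F G : MvPolynomial (Fin 3) ℚ} {e e' : ℕ} (hF : F.IsHomogeneous e)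
    (hG : G.IsHomogeneous e') (hFG : IsRelPrime F G) (hAF : ∀ a ∈ A, eval (ratVec (w a)) F = 0)
    (hAG : ∀ a ∈ A, eval (ratVec (w a)) G = 0) : A.card ≤ 2 * e * e' := by
  refine (card_planes_le hFG A (fun _ => 0) (fun a => Submodule.span ℚ {ratVec (w a)})
    (fun a ha => by rw [finrank_span_singleton (ratVec_ne_zero (h.ne_zero a ha))])
    (fun a ha b hb hab _ => h.inj a ha b hb hab)
    (fun a ha v hv => ?_) (fun a ha v hv => ?_)).trans ?_
  · rw [zero_add]; exact eval_eq_zero_of_mem_span hF (hAF a ha) hv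
  · rw [zero_add]; exact eval_eq_zero_of_mem_span hG (hAG a ha) hv
  · exact Nat.mul_le_mul (Nat.mul_le_mul_left _ hF.totalDegree_le) hG.totalDegree_le

theorem Veronese.card_le_of_not_dvd {D s K m : ℕ} {mon : Fin s → Fin 3 → ℕ}
    (hV : Veronese D s K m mon) (hD : 1 ≤ D) {p : ℕ} (hp : p.Prime) {e : ℕ} (he : D < e)
    {F : MvPolynomial (Fin 3) ℤ} (hF : F.IsHomogeneous e)
    (hirr : Irreducible (map (Int.castRingHom ℚ) F)) {ι : Type*} {A : Finset ι}
    {w : ι → Fin 3 → ℤ} (h : IsPointFamily A w) (hw : ∀ a ∈ A, eval (w a) F = 0)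
    (hns : ∀ a ∈ A, ∃ l, ¬ (p : ℤ) ∣ eval (w a) (pderiv l F)) {X : Fin 3 → ℕ}
    (hX : ∀ a ∈ A, ∀ l, |w a l| ≤ X l) (hp' : s.factorial * (∏ l, X l) ^ m < p ^ K) :
    A.card ≤ 4 * D * e ^ 2 * p := by
  have hcard := hV.card_le_of_prime hp (by omega) hF A w hw hns (2 * e * D) (by
    intro T hT hdvd
    obtain ⟨q, hq0, hq, hqT⟩ := hV.exists_form ((fun a => ratVec (w a)) '' (T : Set ι)) (by
      intro τ hτ
      choose σ hσ hστ using hτ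
      have h1 := Int.eq_zero_of_abs_lt_dvd (hdvd σ hσ)
        ((hV.abs_det_le _ X fun r => hX _ (hT (hσ r))).trans_lt (by exact_mod_cast hp'))
      have h2 := det_monMatrix_map (Int.castRingHom ℚ) mon fun r => w (σ r)
      rw [h1, map_zero] at h2
      rw [h2]
      congr 1
      ext r c
      simp only [monMatrix, ← hστ, Matrix.of_apply]
      rfl)
    have hdeg : (map (Int.castRingHom ℚ) F).totalDegree = e :=
      (hF.map _).totalDegree hirr.ne_zero
    refine (h.mono hT).card_le_of_isRelPrime (hF.map _) hq
      (isRelPrime_of_totalDegree_lt hirr hq0 (by rw [hdeg]; exact hq.totalDegree_le.trans_lt he))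
      (fun a ha => ?_) (fun a ha => hqT _ ⟨a, ha, rfl⟩)
    rw [eval_ratVec, hw a (hT ha), Int.cast_zero])
  refine hcard.trans (le_of_eq ?_)
  ring

/-- The polynomial `f(t x)`, whose coefficients in `t` are the homogeneous components of `f`. -/
noncomputable def scaleHom (n : ℕ) :
    MvPolynomial (Fin n) ℚ →+* Polynomial (MvPolynomial (Fin n) ℚ) :=
  eval₂Hom (Polynomial.C.comp C) fun i => Polynomial.C (X i) * Polynomial.X

theorem coeff_scaleHom {n : ℕ} (f : MvPolynomial (Fin n) ℚ) (k : ℕ) :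
    (scaleHom n f).coeff k = homogeneousComponent k f := by
  induction f using MvPolynomial.induction_on' with
  | monomial u a =>
    have h : scaleHom n (monomial u a) = Polynomial.C (monomial u a) * Polynomial.X ^ u.degree := by
      rw [scaleHom, coe_eval₂Hom, eval₂_monomial, monomial_eq, Finsupp.prod_fintype _ _ (by simp),
        Finsupp.prod_fintype _ _ (by simp), Finsupp.degree_eq_sum, ← Finset.prod_pow_eq_pow_sum,
        Polynomial.C_mul, RingHom.comp_apply, map_prod, mul_assoc, ← Finset.prod_mul_distrib]
      simp [mul_pow]
    rw [h, Polynomial.coeff_C_mul_X_pow, homogeneousComponent_of_mem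
      (isHomogeneous_monomial a rfl)]
  | add p q hp hq => rw [map_add, Polynomial.coeff_add, hp, hq, map_add]

theorem isHomogeneous_of_mul {n e : ℕ} {G H : MvPolynomial (Fin n) ℚ}
    (h : (G * H).IsHomogeneous e) (h0 : G * H ≠ 0) : G.IsHomogeneous G.totalDegree := by
  have hF : scaleHom n (G * H) = Polynomial.C (G * H) * Polynomial.X ^ e := by
    ext1 k
    rw [coeff_scaleHom, Polynomial.coeff_C_mul_X_pow, homogeneousComponent_of_mem h]
  have hinj : ∀ P : MvPolynomial (Fin n) ℚ, P ≠ 0 → scaleHom n P ≠ 0 := by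
    intro P hP h1
    apply hP
    ext u
    rw [← P.sum_homogeneousComponent]
    simp [← coeff_scaleHom, h1]
  have hG := hinj G (left_ne_zero_of_mul h0)
  have hH := hinj H (right_ne_zero_of_mul h0)
  have h1 := congrArg Polynomial.natDegree hF
  have h2 := congrArg Polynomial.natTrailingDegree hF
  rw [map_mul, Polynomial.natDegree_mul hG hH, Polynomial.natDegree_C_mul_X_pow _ _ h0] at h1
  rw [map_mul, Polynomial.natTrailingDegree_mul hG hH,
    Polynomial.C_mul_X_pow_eq_monomial, Polynomial.natTrailingDegree_monomial h0] at h2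
  have h3 := Polynomial.natTrailingDegree_le_natDegree (scaleHom n G)
  have h4 := Polynomial.natTrailingDegree_le_natDegree (scaleHom n H)
  have h5 : (scaleHom n G).natTrailingDegree = (scaleHom n G).natDegree := by omega
  have h6 : G = homogeneousComponent (scaleHom n G).natDegree G := by
    conv_lhs => rw [← G.sum_homogeneousComponent]
    have h7 : ∀ k, k ≠ (scaleHom n G).natDegree → homogeneousComponent k G = 0 := by
      intro k hk
      rw [← coeff_scaleHom]
      rcases lt_or_gt_of_ne hk with hk | hk
      · exact Polynomial.coeff_eq_zero_of_lt_natTrailingDegree (by rw [h5]; exact hk)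
      · exact Polynomial.coeff_eq_zero_of_natDegree_lt hk
    refine Finset.sum_eq_single _ (fun k _ hk => h7 k hk) fun hk => ?_
    refine homogeneousComponent_eq_zero _ _ ?_
    simpa [Nat.lt_succ_iff] using hk
  have h8 : G.IsHomogeneous (scaleHom n G).natDegree := by
    generalize (scaleHom n G).natDegree = k at h6
    rw [h6]
    exact homogeneousComponent_isHomogeneous k G
  rwa [h8.totalDegree (left_ne_zero_of_mul h0)]

/-- A form of Siegel's lemma: a rational linear system with a nonzero rational solution has a small
nonzero integral one. -/
theorem exists_small_int_solution {ι β : Type*} [Fintype β] (A : Set ι) (R : ι → β → ℤ) {Y : ℕ}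
    (hY : 1 ≤ Y) (hR : ∀ a ∈ A, ∀ b, |R a b| ≤ Y) {c : β → ℚ} (hc0 : c ≠ 0)
    (hc : ∀ a ∈ A, ∑ b, c b * R a b = 0) :
    ∃ t : β → ℤ, t ≠ 0 ∧ (∀ a ∈ A, ∑ b, t b * R a b = 0) ∧
      ∀ b, |t b| ≤ ((Fintype.card β * Y : ℕ) : ℤ) ^ Fintype.card β := by
  classical
  let Rq : ι → β → ℚ := fun a b => (R a b : ℚ)
  obtain ⟨b₀, hb₀⟩ : ∃ b, c b ≠ 0 := by
    by_contra! h
    exact hc0 (funext h)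
  have hβ : 0 < Fintype.card β := Fintype.card_pos_iff.mpr ⟨b₀⟩
  let L : (β → ℚ) →ₗ[ℚ] ℚ := ∑ b, c b • LinearMap.proj b
  have hL : ∀ v, L v = ∑ b, c b * v b := fun v => by simp [L]
  have hker : Submodule.span ℚ (Rq '' A) ≤ LinearMap.ker L := by
    rw [Submodule.span_le]
    rintro _ ⟨a, ha, rfl⟩
    exact (hL _).trans (hc a ha)
  have hlt : Module.finrank ℚ (Submodule.span ℚ (Rq '' A)) < Fintype.card β := by
    rw [← Module.finrank_fintype_fun_eq_card ℚ]
    refine Submodule.finrank_lt fun htop => ?_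
    have h1 : Pi.single b₀ (1 : ℚ) ∈ Submodule.span ℚ (Rq '' A) := htop ▸ Submodule.mem_top
    have h2 := hker h1
    rw [LinearMap.mem_ker, hL] at h2
    exact hb₀ (by simpa [Pi.single_apply] using h2)
  obtain ⟨k, hk, f, hf, hspan⟩ : ∃ k, k = Module.finrank ℚ (Submodule.span ℚ (Rq '' A)) ∧
      ∃ f : Fin k → β → ℚ, (∀ i, f i ∈ Rq '' A) ∧
        Submodule.span ℚ (Set.range f) = Submodule.span ℚ (Rq '' A) := by
    obtain ⟨f, hf, hspan, -⟩ := Submodule.exists_fun_fin_finrank_span_eq ℚ (Rq '' A)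
    exact ⟨_, rfl, f, hf, hspan⟩
  rw [← hk] at hlt
  choose σ hσA hσ using hf
  rcases Nat.eq_zero_or_pos k with hk0 | hk0
  · refine ⟨Pi.single b₀ 1, by simp, fun a ha => ?_, fun b => ?_⟩
    · have h1 : Submodule.span ℚ (Rq '' A) = ⊥ := Submodule.finrank_eq_zero.mp (hk ▸ hk0)
      have h2 : Rq a ∈ Submodule.span ℚ (Rq '' A) := Submodule.subset_span ⟨a, ha, rfl⟩
      rw [h1, Submodule.mem_bot] at h2
      have h3 : R a b₀ = 0 := by
        have := congrFun h2 b₀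
        simpa [Rq] using this
      simp [Pi.single_apply, h3]
    · have h1 : (1 : ℤ) ≤ ((Fintype.card β * Y : ℕ) : ℤ) ^ Fintype.card β :=
        one_le_pow₀ (by exact_mod_cast Nat.mul_pos hβ hY)
      refine le_trans ?_ h1
      by_cases hb : b = b₀
      · subst hb; simp
      · simp [Pi.single_eq_of_ne hb]
  · let M : Matrix (Fin k) β ℤ := Matrix.of fun i b => R (σ i) b
    obtain ⟨t, ht0, htM, htn⟩ := Int.Matrix.exists_ne_zero_int_vec_norm_le M
      (by rwa [Fintype.card_fin]) (by rwa [Fintype.card_fin])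
    refine ⟨t, ht0, fun a ha => ?_, fun b => ?_⟩
    · let T : (β → ℚ) →ₗ[ℚ] ℚ := ∑ b, (t b : ℚ) • LinearMap.proj b
      have hT : ∀ v, T v = ∑ b, (t b : ℚ) * v b := fun v => by simp [T]
      have h1 : Submodule.span ℚ (Set.range f) ≤ LinearMap.ker T := by
        rw [Submodule.span_le]
        rintro _ ⟨i, rfl⟩
        refine (hT _).trans ?_
        have h2 := congrFun htM i
        rw [← hσ i]
        simp only [Matrix.mulVec, dotProduct, M, Matrix.of_apply, Pi.zero_apply] at h2
        simp only [Rq, mul_comm (t _ : ℚ)]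
        exact_mod_cast h2
      rw [hspan] at h1
      have h2 := h1 (Submodule.subset_span ⟨a, ha, rfl⟩)
      rw [LinearMap.mem_ker, hT] at h2
      simp only [Rq] at h2
      exact_mod_cast h2
    · let := @Matrix.seminormedAddCommGroup (Fin k) β ℤ _ _ _
      have hM : ‖M‖ ≤ Y := (Matrix.norm_le_iff (by positivity)).mpr fun i j => by
        rw [Int.norm_eq_abs]
        exact_mod_cast hR _ (hσA i) j
      have hbase : (Fintype.card β : ℝ) * max 1 ‖M‖ ≤ (Fintype.card β * Y : ℕ) := by
        push_cast
        gcongr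
        exact max_le (by exact_mod_cast hY) hM
      have h1 : (1 : ℝ) ≤ (Fintype.card β * Y : ℕ) := by exact_mod_cast Nat.mul_pos hβ hY
      have h2 : ‖t‖ ≤ ((Fintype.card β * Y : ℕ) : ℝ) ^ (Fintype.card β : ℝ) := by
        refine htn.trans ((Real.rpow_le_rpow (by positivity) hbase ?_).trans
          (Real.rpow_le_rpow_of_exponent_le h1 ?_))
        · rw [Fintype.card_fin]
          have : (k : ℝ) < Fintype.card β := by exact_mod_cast hlt
          exact div_nonneg (by positivity) (by linarith)
        · rw [Fintype.card_fin]
          have : (k : ℝ) + 1 ≤ Fintype.card β := by exact_mod_cast hlt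
          rw [div_le_iff₀ (by linarith)]
          have h0 : (0 : ℝ) ≤ Fintype.card β := by positivity
          nlinarith
      have h3 := (norm_le_pi_norm t b).trans h2
      rw [Real.rpow_natCast, Int.norm_eq_abs] at h3
      exact_mod_cast h3

/-- The exponents of the monomials of degree `e` in three variables. -/
def expSet (e : ℕ) : Finset (Fin 3 →₀ ℕ) := (Finset.univ : Finset (Fin 3)).finsuppAntidiag e

theorem mem_expSet {e : ℕ} {u : Fin 3 →₀ ℕ} : u ∈ expSet e ↔ ∑ l, u l = e := by
  simp [expSet, Finset.mem_finsuppAntidiag]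

theorem card_expSet_le (e : ℕ) : (expSet e).card ≤ (e + 1) ^ 2 := by
  have h := Finset.card_le_card_of_injOn (s := expSet e)
    (t := Finset.range (e + 1) ×ˢ Finset.range (e + 1)) (fun u => (u 0, u 1))
    (fun u hu => by
      have := mem_expSet.mp hu
      rw [Fin.sum_univ_three] at this
      simp only [Finset.coe_product, Set.mem_prod, Finset.coe_range, Set.mem_Iio]
      omega)
    (fun u hu v hv huv => by
      have h1 := mem_expSet.mp hu
      have h2 := mem_expSet.mp hv
      rw [Fin.sum_univ_three] at h1 h2
      simp only [Prod.mk.injEq] at huv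
      ext l
      fin_cases l <;> simp <;> omega)
  rwa [Finset.card_product, Finset.card_range, ← sq] at h

theorem sum_expSet_eq {R : Type*} [CommRing R] {e : ℕ} {F : MvPolynomial (Fin 3) R}
    (hF : F.IsHomogeneous e) : F = ∑ u ∈ expSet e, monomial u (coeff u F) := by
  conv_lhs => rw [F.as_sum]
  refine Finset.sum_subset (fun u hu => ?_) fun u _ hu => ?_
  · have := hF (mem_support_iff.mp hu)
    rw [mem_expSet, ← this, ← Finsupp.degree_eq_sum]
    exact DFunLike.congr_fun Finsupp.degree_eq_weight_one u
  · rw [notMem_support_iff.mp hu, monomial_zero]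

theorem prod_pow_le {w : Fin 3 → ℤ} {Y : ℕ} (hw : ∀ l, |w l| ≤ Y) (hY : 1 ≤ Y) {u : Fin 3 →₀ ℕ}
    {e : ℕ} (hu : ∑ l, u l ≤ e) : |∏ l, w l ^ u l| ≤ (Y : ℤ) ^ e := by
  rw [Finset.abs_prod]
  calc ∏ l, |w l ^ u l| ≤ ∏ l, (Y : ℤ) ^ u l := by
        refine Finset.prod_le_prod (fun _ _ => abs_nonneg _) fun l _ => ?_
        rw [abs_pow]
        exact pow_le_pow_left₀ (abs_nonneg _) (hw l) _
    _ = (Y : ℤ) ^ ∑ l, u l := Finset.prod_pow_eq_pow_sum _ _ _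
    _ ≤ (Y : ℤ) ^ e := pow_le_pow_right₀ (by exact_mod_cast hY) hu

theorem succ_le_pow {Y : ℕ} (hY : 2 ≤ Y) (e : ℕ) : e + 1 ≤ Y ^ e :=
  (Nat.lt_two_pow_self (n := e)).trans_le (Nat.pow_le_pow_left hY e)

/-- Points of bounded height on a plane curve lie on a curve of the same degree with an equation of
bounded height. -/
theorem exists_small_form {ι : Type*} (A : Set ι) (w : ι → Fin 3 → ℤ) {Y e : ℕ} (hY : 2 ≤ Y)
    (he : 1 ≤ e) (hw : ∀ a ∈ A, ∀ l, |w a l| ≤ Y) {F : MvPolynomial (Fin 3) ℚ}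
    (hF : F.IsHomogeneous e) (hF0 : F ≠ 0) (hFA : ∀ a ∈ A, eval (ratVec (w a)) F = 0) :
    ∃ G : MvPolynomial (Fin 3) ℤ, G ≠ 0 ∧ G.IsHomogeneous e ∧ (∀ a ∈ A, eval (w a) G = 0) ∧
      ∀ u, |coeff u G| ≤ (Y : ℤ) ^ (12 * e ^ 3) := by
  classical
  obtain ⟨t, ht0, htA, htY⟩ := exists_small_int_solution (β := expSet e) A
    (fun a u => ∏ l, w a l ^ (u : Fin 3 →₀ ℕ) l) (Y := Y ^ e) (Nat.one_le_pow _ _ (by omega))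
    (fun a ha u => by
      push_cast
      exact prod_pow_le (hw a ha) (by omega) (mem_expSet.mp u.2).le)
    (c := fun u => coeff (u : Fin 3 →₀ ℕ) F)
    (fun h => hF0 (by
      rw [sum_expSet_eq hF]
      refine Finset.sum_eq_zero fun u hu => ?_
      rw [show coeff u F = 0 from congrFun h ⟨u, hu⟩, monomial_zero]))
    (fun a ha => by
      have h := hFA a ha
      rw [sum_expSet_eq hF, map_sum, ← Finset.sum_coe_sort] at h
      rw [← h]
      refine Finset.sum_congr rfl fun u _ => ?_
      rw [eval_monomial, Finsupp.prod_fintype _ _ (by simp)]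
      push_cast
      rfl)
  have hcoeff : ∀ u : expSet e,
      coeff (u : Fin 3 →₀ ℕ) (∑ u : expSet e, monomial (u : Fin 3 →₀ ℕ) (t u)) = t u := by
    intro u
    rw [coeff_sum, Finset.sum_eq_single u]
    · rw [coeff_monomial, if_pos rfl]
    · intro v _ hv
      rw [coeff_monomial, if_neg (fun h => hv (Subtype.ext h))]
    · simp
  refine ⟨∑ u : expSet e, monomial (u : Fin 3 →₀ ℕ) (t u), fun h => ?_, ?_, fun a ha => ?_,
    fun u => ?_⟩
  · apply ht0
    ext u
    rw [← hcoeff u, h, coeff_zero, Pi.zero_apply]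
  · refine IsHomogeneous.sum _ _ _ fun u _ => isHomogeneous_monomial _ ?_
    rw [Finsupp.degree_eq_sum]
    exact mem_expSet.mp u.2
  · rw [map_sum, ← htA a ha]
    refine Finset.sum_congr rfl fun u _ => ?_
    rw [eval_monomial, Finsupp.prod_fintype _ _ (by simp)]
  · by_cases hu : u ∈ expSet e
    · rw [hcoeff ⟨u, hu⟩]
      refine (htY _).trans ?_
      rw [Fintype.card_coe]
      have h1 : (expSet e).card ≤ 4 * e ^ 2 := (card_expSet_le e).trans (by nlinarith)
      have h2 : (expSet e).card * Y ^ e ≤ Y ^ (3 * e) := by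
        calc _ ≤ (Y ^ e) ^ 2 * Y ^ e := Nat.mul_le_mul_right _ ((card_expSet_le e).trans
              (Nat.pow_le_pow_left (succ_le_pow hY e) 2))
          _ = Y ^ (3 * e) := by ring
      have h3 : ((expSet e).card * Y ^ e) ^ (expSet e).card ≤ Y ^ (12 * e ^ 3) := by
        calc _ ≤ (Y ^ (3 * e)) ^ (expSet e).card := Nat.pow_le_pow_left h2 _
          _ ≤ (Y ^ (3 * e)) ^ (4 * e ^ 2) :=
              Nat.pow_le_pow_right (Nat.pow_pos (by omega)) h1
          _ = Y ^ (12 * e ^ 3) := by rw [← pow_mul]; ring_nf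
      exact_mod_cast h3
    · rw [coeff_sum, Finset.sum_eq_zero, abs_zero]
      · positivity
      · intro v _
        rw [coeff_monomial, if_neg]
        rintro rfl
        exact hu v.2

theorem abs_eval_pderiv_le {w : Fin 3 → ℤ} {Y e : ℕ} (hY : 2 ≤ Y) (he : 1 ≤ e)
    (hw : ∀ l, |w l| ≤ Y) {G : MvPolynomial (Fin 3) ℤ} (hG : G.IsHomogeneous e)
    (hcoeff : ∀ u, |coeff u G| ≤ (Y : ℤ) ^ (12 * e ^ 3)) (l : Fin 3) :
    |eval w (pderiv l G)| ≤ (Y : ℤ) ^ (16 * e ^ 3) := by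
  rw [sum_expSet_eq hG, map_sum, map_sum]
  have hY0 : (0 : ℤ) ≤ Y := by positivity
  have h1 : ∀ u ∈ expSet e, |eval w (pderiv l (monomial u (coeff u G)))| ≤
      (Y : ℤ) ^ (12 * e ^ 3) * e * (Y : ℤ) ^ e := by
    intro u hu
    have hu' := mem_expSet.mp hu
    rw [pderiv_monomial, eval_monomial, Finsupp.prod_fintype _ _ (by simp), abs_mul, abs_mul]
    refine mul_le_mul (mul_le_mul (hcoeff u) ?_ (abs_nonneg _) (by positivity))
      (prod_pow_le hw (by omega) ?_) (abs_nonneg _) (by positivity)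
    · rw [Nat.abs_cast]
      exact_mod_cast hu' ▸ Finset.single_le_sum (fun _ _ => Nat.zero_le _) (Finset.mem_univ l)
    · rw [← hu']
      exact Finset.sum_le_sum fun i _ => by simp
  refine (Finset.abs_sum_le_sum_abs _ _).trans ((Finset.sum_le_card_nsmul _ _ _ h1).trans ?_)
  have h2 : (expSet e).card * (Y ^ (12 * e ^ 3) * e * Y ^ e) ≤ Y ^ (16 * e ^ 3) := by
    have h3 := succ_le_pow hY e
    calc _ ≤ (Y ^ e) ^ 2 * (Y ^ (12 * e ^ 3) * Y ^ e * Y ^ e) := by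
          refine Nat.mul_le_mul ((card_expSet_le e).trans (Nat.pow_le_pow_left h3 2)) ?_
          gcongr
          omega
      _ = Y ^ (12 * e ^ 3 + 4 * e) := by ring
      _ ≤ Y ^ (16 * e ^ 3) := by
          refine Nat.pow_le_pow_right (by omega) ?_
          have : e ≤ e ^ 3 := Nat.le_self_pow (by omega) e
          omega
  rw [nsmul_eq_mul]
  exact_mod_cast h2

theorem card_primes_dvd_le {S : Finset ℕ} {P k : ℕ} (hP : 2 ≤ P)
    (hS : ∀ p ∈ S, p.Prime ∧ P ≤ p) {δ : ℤ} (hδ : δ ≠ 0) (hδP : |δ| ≤ (P : ℤ) ^ k) :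
    (S.filter fun p : ℕ => (p : ℤ) ∣ δ).card ≤ k := by
  set T := S.filter fun p : ℕ => (p : ℤ) ∣ δ
  have h1 : ∏ p ∈ T, p ∣ δ.natAbs := Finset.prod_primes_dvd _
    (fun p hp => (hS p (Finset.mem_filter.mp hp).1).1.prime)
    fun p hp => Int.natCast_dvd.mp (Finset.mem_filter.mp hp).2
  have h2 : P ^ T.card ≤ ∏ p ∈ T, p := by
    rw [← Finset.prod_const]
    exact Finset.prod_le_prod' fun p hp => (hS p (Finset.mem_filter.mp hp).1).2
  have h3 : δ.natAbs ≤ P ^ k := by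
    rw [Int.abs_eq_natAbs] at hδP
    exact_mod_cast hδP
  exact (Nat.pow_le_pow_iff_right hP).mp
    ((h2.trans (Nat.le_of_dvd (Int.natAbs_pos.mpr hδ) h1)).trans h3)

theorem irreducible_of_dvd_of_isHomogeneous {n e : ℕ} {F G : MvPolynomial (Fin n) ℚ}
    (hF : F.IsHomogeneous e) (hG : G.IsHomogeneous e) (hG0 : G ≠ 0) (hirr : Irreducible F)
    (h : F ∣ G) : Irreducible G := by
  obtain ⟨H, rfl⟩ := h
  have hH0 := right_ne_zero_of_mul hG0
  have h1 := totalDegree_mul_of_isDomain hirr.ne_zero hH0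
  rw [hG.totalDegree hG0, hF.totalDegree hirr.ne_zero] at h1
  rw [totalDegree_eq_zero_iff_eq_C.mp (by omega : H.totalDegree = 0)] at hH0 ⊢
  refine (irreducible_mul_isUnit (IsUnit.map C ?_)).mpr hirr
  exact isUnit_iff_ne_zero.mpr fun h0 => hH0 (by rw [h0, map_zero])

theorem IsPointFamily.card_singular_le {ι : Type*} {A : Finset ι} {w : ι → Fin 3 → ℤ}
    (h : IsPointFamily A w) {F : MvPolynomial (Fin 3) ℚ} {e : ℕ} (he : 1 ≤ e)
    (hF : F.IsHomogeneous e) (hirr : Irreducible F) (hA : ∀ a ∈ A, eval (ratVec (w a)) F = 0)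
    (hA' : ∀ a ∈ A, ∀ l, eval (ratVec (w a)) (pderiv l F) = 0) : A.card ≤ 2 * e ^ 2 := by
  obtain ⟨l, hl⟩ : ∃ l, pderiv l F ≠ 0 := by
    by_contra! hcon
    have := hF.sum_X_mul_pderiv
    simp only [hcon, mul_zero, Finset.sum_const_zero] at this
    exact (smul_ne_zero (by omega : e ≠ 0) hirr.ne_zero) this.symm
  have hl' := hF.pderiv (i := l)
  have hrp := isRelPrime_of_totalDegree_lt hirr hl (by
    rw [hl'.totalDegree hl, hF.totalDegree hirr.ne_zero]; omega)
  refine (h.card_le_of_isRelPrime hF hl' hrp hA fun a ha => hA' a ha l).trans ?_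
  calc 2 * e * (e - 1) ≤ 2 * e * e := Nat.mul_le_mul_left _ (Nat.sub_le _ _)
    _ = 2 * e ^ 2 := by ring

theorem Veronese.card_le {D s K m : ℕ} {mon : Fin s → Fin 3 → ℕ} (hV : Veronese D s K m mon)
    (hD : 1 ≤ D) {e : ℕ} (he : D < e) {F : MvPolynomial (Fin 3) ℚ} (hF : F.IsHomogeneous e)
    (hirr : Irreducible F) {ι : Type*} {A : Finset ι} {w : ι → Fin 3 → ℤ}
    (h : IsPointFamily A w) (hA : ∀ a ∈ A, eval (ratVec (w a)) F = 0) {X : Fin 3 → ℕ}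
    (hX : ∀ a ∈ A, ∀ l, |w a l| ≤ X l) {P Q : ℕ} (hP : 2 ≤ P) (hXP : ∀ l, X l ≤ P ^ 4)
    (hXK : s.factorial * (∏ l, X l) ^ m < P ^ K) {S : Finset ℕ}
    (hS : ∀ p ∈ S, p.Prime ∧ P ≤ p ∧ p ≤ Q) (hScard : 128 * e ^ 3 ≤ S.card) :
    A.card ≤ 12 * D * e ^ 2 * Q := by
  classical
  have hSpos : 0 < S.card := by
    have : 0 < e ^ 3 := Nat.pow_pos (by omega)
    omega
  obtain ⟨p₀, hp₀⟩ := Finset.card_pos.mp hSpos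
  have hQ : 2 ≤ Q := hP.trans ((hS p₀ hp₀).2.1.trans (hS p₀ hp₀).2.2)
  obtain ⟨G, hG0, hG, hGA, hGY⟩ := exists_small_form (A : Set ι) w (Y := P ^ 4) (e := e)
    (hP.trans (Nat.le_self_pow (by omega) _)) (by omega)
    (fun a ha l => (hX a ha l).trans (by exact_mod_cast hXP l)) hF hirr.ne_zero hA
  set G' := map (Int.castRingHom ℚ) G with hG'
  have hG'0 : G' ≠ 0 := fun h0 =>
    hG0 ((map_injective _ Int.cast_injective) (h0.trans (map_zero _).symm))
  have hGA' : ∀ a ∈ A, eval (ratVec (w a)) G' = 0 := fun a ha => by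
    rw [hG', eval_ratVec, hGA a ha, Int.cast_zero]
  have hDQ : 2 ≤ D * Q := hQ.trans (Nat.le_mul_of_pos_left _ hD)
  by_cases hdvd : F ∣ G'
  swap
  · refine (h.card_le_of_isRelPrime hF (hG.map _) (hirr.isRelPrime_iff_not_dvd.mpr hdvd) hA
      hGA').trans ?_
    calc 2 * e * e ≤ 2 * e * e * (6 * (D * Q)) := Nat.le_mul_of_pos_right _ (by omega)
      _ = 12 * D * e ^ 2 * Q := by ring
  have hirr' := irreducible_of_dvd_of_isHomogeneous hF (hG.map _) hG'0 hirr hdvd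
  set A₁ := A.filter fun a => ∀ l, eval (w a) (pderiv l G) = 0 with hA₁
  set A₂ := A.filter fun a => ¬ ∀ l, eval (w a) (pderiv l G) = 0 with hA₂
  have hcard : A₁.card + A₂.card = A.card := Finset.card_filter_add_card_filter_not _
  have h1 : A₁.card ≤ 2 * e ^ 2 := (h.mono (Finset.filter_subset _ _)).card_singular_le
    (by omega) (hG.map _) hirr' (fun a ha => hGA' a (Finset.mem_filter.mp ha).1)
    fun a ha l => by
      rw [pderiv_map, eval_ratVec, (Finset.mem_filter.mp ha).2 l, Int.cast_zero]
  have h2 : ∀ a ∈ A₂, ∃ l, eval (w a) (pderiv l G) ≠ 0 := fun a ha => by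
    simpa using (Finset.mem_filter.mp ha).2
  choose! l hl using h2
  have hgood : ∀ a ∈ A₂, S.card ≤
      2 * (S.filter fun p : ℕ => ¬ (p : ℤ) ∣ eval (w a) (pderiv (l a) G)).card := by
    intro a ha
    have hb := card_primes_dvd_le (k := 64 * e ^ 3) hP (fun p hp => ⟨(hS p hp).1, (hS p hp).2.1⟩)
      (hl a ha) (by
        have := abs_eval_pderiv_le (Y := P ^ 4) (hP.trans (Nat.le_self_pow (by omega) _))
          (by omega : 1 ≤ e)
          (fun l => (hX a (Finset.mem_filter.mp ha).1 l).trans (by exact_mod_cast hXP l)) hG hGY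
          (l a)
        refine this.trans (le_of_eq ?_)
        push_cast
        rw [← pow_mul]
        congr 1
        ring)
    have := Finset.card_filter_add_card_filter_not (s := S)
      (fun p : ℕ => (p : ℤ) ∣ eval (w a) (pderiv (l a) G))
    omega
  have hp : ∀ p ∈ S, (A₂.filter fun a => ¬ (p : ℤ) ∣ eval (w a) (pderiv (l a) G)).card ≤
      4 * D * e ^ 2 * Q := by
    intro p hp
    obtain ⟨hpp, hPp, hpQ⟩ := hS p hp
    have hsub : (A₂.filter fun a => ¬ (p : ℤ) ∣ eval (w a) (pderiv (l a) G)) ⊆ A :=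
      (Finset.filter_subset _ _).trans (Finset.filter_subset _ _)
    exact (hV.card_le_of_not_dvd hD hpp he hG hirr' (h.mono hsub)
      (fun a ha => hGA a (hsub ha)) (fun a ha => ⟨l a, (Finset.mem_filter.mp ha).2⟩)
      (fun a ha => hX a (hsub ha)) (hXK.trans_le (Nat.pow_le_pow_left hPp K))).trans
      (Nat.mul_le_mul_left _ hpQ)
  have hsum : A₂.card * S.card ≤ 2 * (S.card * (4 * D * e ^ 2 * Q)) := by
    calc A₂.card * S.card = ∑ a ∈ A₂, S.card := by rw [Finset.sum_const, smul_eq_mul]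
      _ ≤ ∑ a ∈ A₂, 2 * (S.filter fun p : ℕ => ¬ (p : ℤ) ∣ eval (w a) (pderiv (l a) G)).card :=
          Finset.sum_le_sum hgood
      _ = 2 * ∑ p ∈ S, (A₂.filter fun a => ¬ (p : ℤ) ∣ eval (w a) (pderiv (l a) G)).card := by
          rw [← Finset.mul_sum]
          congr 1
          exact Finset.sum_card_bipartiteAbove_eq_sum_card_bipartiteBelow
            (fun a (p : ℕ) => ¬ (p : ℤ) ∣ eval (w a) (pderiv (l a) G))
      _ ≤ 2 * (S.card * (4 * D * e ^ 2 * Q)) := by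
          refine Nat.mul_le_mul_left _ ?_
          rw [← smul_eq_mul, ← Finset.sum_const]
          exact Finset.sum_le_sum hp
  have h3 : A₂.card ≤ 8 * D * e ^ 2 * Q := by
    refine Nat.le_of_mul_le_mul_right (hsum.trans (le_of_eq ?_)) hSpos
    ring
  have h4 : 2 * e ^ 2 ≤ e ^ 2 * (D * Q) := by rw [mul_comm]; exact Nat.mul_le_mul_left _ hDQ
  calc A.card ≤ e ^ 2 * (D * Q) + 8 * D * e ^ 2 * Q := by omega
    _ ≤ 12 * D * e ^ 2 * Q := by nlinarith [Nat.zero_le (e ^ 2 * (D * Q))]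

theorem isHomogeneous_right_of_mul {n e : ℕ} {G H : MvPolynomial (Fin n) ℚ}
    (h : (G * H).IsHomogeneous e) (h0 : G * H ≠ 0) :
    G.totalDegree ≤ e ∧ H.IsHomogeneous (e - G.totalDegree) := by
  have h1 := totalDegree_mul_of_isDomain (left_ne_zero_of_mul h0) (right_ne_zero_of_mul h0)
  rw [h.totalDegree h0] at h1
  have h2 := isHomogeneous_of_mul (mul_comm G H ▸ h) (mul_comm G H ▸ h0)
  exact ⟨by omega, by rwa [h1, Nat.add_sub_cancel_left]⟩

/-- Points of bounded height on a plane curve of degree `d` lie, up to few exceptions, on at most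
`d` curves of degree `D`. -/
theorem Veronese.exists_cover {D s K m : ℕ} {mon : Fin s → Fin 3 → ℕ} (hV : Veronese D s K m mon)
    (hD : 1 ≤ D) {ι : Type*} {w : ι → Fin 3 → ℤ} {X : Fin 3 → ℕ} {P Q : ℕ} (hP : 2 ≤ P)
    (hXP : ∀ l, X l ≤ P ^ 4) (hXK : s.factorial * (∏ l, X l) ^ m < P ^ K) {S : Finset ℕ}
    (hS : ∀ p ∈ S, p.Prime ∧ P ≤ p ∧ p ≤ Q) (d : ℕ) (hScard : 128 * d ^ 3 ≤ S.card)
    {F : MvPolynomial (Fin 3) ℚ} (hF : F.IsHomogeneous d) (hF0 : F ≠ 0) {A : Finset ι}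
    (h : IsPointFamily A w) (hA : ∀ a ∈ A, eval (ratVec (w a)) F = 0)
    (hX : ∀ a ∈ A, ∀ l, |w a l| ≤ X l) :
    ∃ 𝒢 : Finset (MvPolynomial (Fin 3) ℚ), 𝒢.card ≤ d ∧ (∀ G ∈ 𝒢, G ≠ 0 ∧ G.IsHomogeneous D) ∧
      ∃ E : Finset ι, E.card ≤ 12 * D * Q * d ^ 2 ∧
        ∀ a ∈ A, a ∈ E ∨ ∃ G ∈ 𝒢, eval (ratVec (w a)) G = 0 := by
  classical
  induction d using Nat.strong_induction_on generalizing F A with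
  | h d ih =>
    rcases Nat.eq_zero_or_pos d with rfl | hd
    · refine ⟨∅, by simp, by simp, ∅, by simp, fun a ha => ?_⟩
      have h1 := totalDegree_eq_zero_iff_eq_C.mp (Nat.le_zero.mp hF.totalDegree_le)
      have h2 := hA a ha
      rw [h1, eval_C] at h2
      exact absurd (by rw [h1, h2, map_zero]) hF0
    · have hnu : ¬ IsUnit F := fun hu => by
        obtain ⟨hr, -⟩ := MvPolynomial.isUnit_iff_totalDegree_of_isReduced.mp hu |>.symm
        have := hF.totalDegree hF0
        omega
      obtain ⟨p, hp, F', rfl⟩ := WfDvdMonoid.exists_irreducible_factor hnu hF0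
      have hp' := isHomogeneous_of_mul hF hF0
      obtain ⟨hle, hF'⟩ := isHomogeneous_right_of_mul hF hF0
      set e := p.totalDegree
      have he : 1 ≤ e := by
        by_contra! he
        have h1 := totalDegree_eq_zero_iff_eq_C.mp (by omega : p.totalDegree = 0)
        apply hp.not_isUnit
        rw [h1]
        refine IsUnit.map C (isUnit_iff_ne_zero.mpr fun h0 => hp.ne_zero ?_)
        rw [h1, h0, map_zero]
      obtain ⟨𝒢, h𝒢, h𝒢D, E, hE, hAE⟩ := ih (d - e) (by omega)
        (le_trans (Nat.mul_le_mul_left _ (Nat.pow_le_pow_left (Nat.sub_le _ _) _)) hScard) hF'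
        (right_ne_zero_of_mul hF0) (h.mono (Finset.filter_subset
          (fun a => eval (ratVec (w a)) F' = 0) A)) (fun a ha => (Finset.mem_filter.mp ha).2)
        (fun a ha => hX a (Finset.mem_filter.mp ha).1)
      have hsplit : ∀ a ∈ A, eval (ratVec (w a)) p = 0 ∨ eval (ratVec (w a)) F' = 0 := by
        intro a ha
        have := hA a ha
        rwa [map_mul, mul_eq_zero] at this
      have hsq : e ^ 2 + (d - e) ^ 2 ≤ d ^ 2 := by
        obtain ⟨k, rfl⟩ := Nat.exists_eq_add_of_le hle
        rw [Nat.add_sub_cancel_left]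
        nlinarith [Nat.zero_le (e * k)]
      rcases le_or_gt e D with heD | heD
      · refine ⟨insert (p * MvPolynomial.X 0 ^ (D - e)) 𝒢,
          (Finset.card_insert_le _ _).trans (by omega),
          ?_, E,
          hE.trans (Nat.mul_le_mul_left _ (Nat.pow_le_pow_left (Nat.sub_le _ _) _)), ?_⟩
        · intro G hG
          rcases Finset.mem_insert.mp hG with rfl | hG
          · refine ⟨mul_ne_zero hp.ne_zero (pow_ne_zero _ (X_ne_zero _)), ?_⟩
            have := hp'.mul ((isHomogeneous_X ℚ (0 : Fin 3)).pow (D - e))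
            rwa [show e + 1 * (D - e) = D by omega] at this
          · exact h𝒢D G hG
        · intro a ha
          rcases hsplit a ha with h1 | h1
          · exact Or.inr ⟨_, Finset.mem_insert_self _ _, by rw [map_mul, h1, zero_mul]⟩
          · rcases hAE a (Finset.mem_filter.mpr ⟨ha, h1⟩) with h2 | ⟨G, hG, h2⟩
            · exact Or.inl h2
            · exact Or.inr ⟨G, Finset.mem_insert_of_mem hG, h2⟩
      · refine ⟨𝒢, h𝒢.trans (Nat.sub_le _ _), h𝒢D,
          (A.filter fun a => eval (ratVec (w a)) p = 0) ∪ E, ?_, ?_⟩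
        · have h1 := hV.card_le hD heD hp' hp (h.mono (Finset.filter_subset
            (fun a => eval (ratVec (w a)) p = 0) A)) (fun a ha => (Finset.mem_filter.mp ha).2)
            (fun a ha => hX a (Finset.mem_filter.mp ha).1) hP hXP hXK hS
            ((Nat.mul_le_mul_left _ (Nat.pow_le_pow_left hle _)).trans hScard)
          refine (Finset.card_union_le _ _).trans ((add_le_add h1 hE).trans ?_)
          calc _ = 12 * D * Q * (e ^ 2 + (d - e) ^ 2) := by ring
            _ ≤ _ := Nat.mul_le_mul_left _ hsq
        · intro a ha
          rcases hsplit a ha with h1 | h1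
          · exact Or.inl (Finset.mem_union_left _ (Finset.mem_filter.mpr ⟨ha, h1⟩))
          · rcases hAE a (Finset.mem_filter.mpr ⟨ha, h1⟩) with h2 | h2
            · exact Or.inl (Finset.mem_union_right _ h2)
            · exact Or.inr h2

theorem card_le_of_dense_incidences {α β : Type*} (T : Finset α) (C C' : Finset β)
    (Z : α → β → Prop) [∀ t c, Decidable (Z t c)] (bad : α → Prop) [DecidablePred bad] {κ : ℕ}
    (hC' : C' ⊆ C) (hcard : C.card ≤ 2 * C'.card) (hC : 0 < C.card)
    (hdense : ∀ c ∈ C', T.card ≤ κ * (T.filter fun t => Z t c).card)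
    (hsparse : ∀ t ∈ T, ¬ bad t → 4 * κ * (C.filter fun c => Z t c).card ≤ C.card) :
    T.card ≤ 4 * κ * (T.filter bad).card := by
  have h1 : C'.card * T.card ≤ κ * ∑ t ∈ T, (C.filter fun c => Z t c).card := by
    calc C'.card * T.card = ∑ c ∈ C', T.card := by rw [Finset.sum_const, smul_eq_mul]
      _ ≤ ∑ c ∈ C', κ * (T.filter fun t => Z t c).card := Finset.sum_le_sum hdense
      _ ≤ ∑ c ∈ C, κ * (T.filter fun t => Z t c).card := Finset.sum_le_sum_of_subset hC'
      _ = _ := by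
        rw [← Finset.mul_sum]
        congr 1
        exact (Finset.sum_card_bipartiteAbove_eq_sum_card_bipartiteBelow Z).symm
  have h2 : 4 * κ * ∑ t ∈ T, (C.filter fun c => Z t c).card ≤
      4 * κ * ((T.filter bad).card * C.card) + T.card * C.card := by
    rw [← Finset.sum_filter_add_sum_filter_not T bad, mul_add]
    refine add_le_add (Nat.mul_le_mul_left _ ?_) ?_
    · rw [← smul_eq_mul, ← Finset.sum_const]
      exact Finset.sum_le_sum fun t _ => Finset.card_filter_le _ _
    · rw [Finset.mul_sum]
      calc _ ≤ ∑ t ∈ T with ¬ bad t, C.card := Finset.sum_le_sum fun t ht =>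
            hsparse t (Finset.mem_filter.mp ht).1 (Finset.mem_filter.mp ht).2
        _ ≤ _ := by
          rw [Finset.sum_const, smul_eq_mul]
          exact Nat.mul_le_mul_right _ (Finset.card_filter_le _ _)
  refine Nat.le_of_mul_le_mul_right ?_ hC
  nlinarith [Nat.mul_le_mul_right T.card hcard]

open scoped Classical in
theorem card_not_linearIndependent_le {ι K E : Type*} [Field K] [AddCommGroup E] [Module K E]
    (s : Finset ι) (v : ι → E) {N m : ℕ} (hm : ∀ k < N, ∀ τ : Fin k → ι, (∀ i, τ i ∈ s) →
      LinearIndependent K (v ∘ τ) →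
        (s.filter fun x => v x ∈ Submodule.span K (Set.range (v ∘ τ))).card ≤ m) :
    ∀ k ≤ N, s.card * ((Fintype.piFinset fun _ : Fin k => s).filter
      fun τ => ¬ LinearIndependent K (v ∘ τ)).card ≤ k * s.card ^ k * m := by
  intro k
  induction k with
  | zero =>
    intro _
    rw [Finset.filter_false_of_mem, Finset.card_empty, mul_zero]
    · exact Nat.zero_le _
    · intro τ _
      rw [not_not]
      exact linearIndependent_empty_type
  | succ k ih =>
    intro hk
    have h1 : ((Fintype.piFinset fun _ : Fin (k + 1) => s).filter
        fun τ => ¬ LinearIndependent K (v ∘ τ)).card ≤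
        ((Fintype.piFinset fun _ : Fin k => s).sigma fun τ =>
          if LinearIndependent K (v ∘ τ) then
            s.filter fun x => v x ∈ Submodule.span K (Set.range (v ∘ τ)) else s).card := by
      refine Finset.card_le_card_of_injOn (fun τ => ⟨Fin.init τ, τ (Fin.last k)⟩) ?_ ?_
      · intro τ hτ
        obtain ⟨hτs, hτ⟩ := Finset.mem_filter.mp hτ
        rw [Fintype.mem_piFinset] at hτs
        refine Finset.mem_sigma.mpr ⟨Fintype.mem_piFinset.mpr fun i => hτs _, ?_⟩
        split_ifs with hli
        · refine Finset.mem_filter.mpr ⟨hτs _, ?_⟩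
          by_contra hmem
          apply hτ
          have h2 := linearIndependent_finSnoc.mpr ⟨hli, hmem⟩
          rwa [← Fin.comp_snoc, Fin.snoc_init_self] at h2
        · exact hτs _
      · intro τ _ τ' _ h
        simp only [Sigma.mk.injEq, heq_eq_eq] at h
        rw [← Fin.snoc_init_self τ, ← Fin.snoc_init_self τ', h.1, h.2]
    have h2 : ((Fintype.piFinset fun _ : Fin k => s).sigma fun τ =>
          if LinearIndependent K (v ∘ τ) then
            s.filter fun x => v x ∈ Submodule.span K (Set.range (v ∘ τ)) else s).card ≤
        s.card ^ k * m + ((Fintype.piFinset fun _ : Fin k => s).filter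
          fun τ => ¬ LinearIndependent K (v ∘ τ)).card * s.card := by
      rw [Finset.card_sigma, ← Finset.sum_filter_add_sum_filter_not _
        fun τ : Fin k → ι => LinearIndependent K (v ∘ τ)]
      refine add_le_add ?_ ?_
      · calc _ ≤ ∑ τ ∈ (Fintype.piFinset fun _ : Fin k => s) with LinearIndependent K (v ∘ τ),
              m := by
              refine Finset.sum_le_sum fun τ hτ => ?_
              obtain ⟨hτs, hτ⟩ := Finset.mem_filter.mp hτ
              rw [if_pos hτ]
              exact hm k (by omega) τ (Fintype.mem_piFinset.mp hτs) hτ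
          _ ≤ _ := by
              rw [Finset.sum_const, smul_eq_mul]
              refine Nat.mul_le_mul_right _ ((Finset.card_filter_le _ _).trans ?_)
              simp
      · rw [← smul_eq_mul, ← Finset.sum_const]
        refine Finset.sum_le_sum fun τ hτ => ?_
        rw [if_neg (Finset.mem_filter.mp hτ).2]
    have h3 := ih (by omega)
    calc _ ≤ s.card * (s.card ^ k * m + ((Fintype.piFinset fun _ : Fin k => s).filter
          fun τ => ¬ LinearIndependent K (v ∘ τ)).card * s.card) :=
          Nat.mul_le_mul_left _ (h1.trans h2)
      _ ≤ s.card * (s.card ^ k * m) + (k * s.card ^ k * m) * s.card := by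
          rw [mul_add, ← mul_assoc s.card (Finset.card _)]
          gcongr
      _ = _ := by ring

/-- A polynomial vector, viewed over the field of rational functions. -/
noncomputable def fracVec {n s : ℕ} (u : Fin s → MvPolynomial (Fin n) ℚ) :
    Fin s → FractionRing (MvPolynomial (Fin n) ℚ) :=
  fun j => algebraMap _ _ (u j)

theorem det_ne_zero_iff_linearIndependent {n s : ℕ}
    {M : Matrix (Fin s) (Fin s) (MvPolynomial (Fin n) ℚ)} :
    M.det ≠ 0 ↔ LinearIndependent (FractionRing (MvPolynomial (Fin n) ℚ))
      fun i => fracVec (M i) := by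
  have h : (fun i => fracVec (M i)) = ((algebraMap (MvPolynomial (Fin n) ℚ)
      (FractionRing (MvPolynomial (Fin n) ℚ))).mapMatrix M).row := rfl
  rw [h, Matrix.linearIndependent_rows_iff_isUnit, Matrix.isUnit_iff_isUnit_det,
    isUnit_iff_ne_zero, ← RingHom.map_det, Ne, Ne,
    map_eq_zero_iff _ (IsFractionRing.injective _ _)]

theorem exists_matrix_extending {n s k D : ℕ} (hk : k ≤ s)
    (v : Fin k → Fin s → MvPolynomial (Fin n) ℚ) (hv : ∀ i j, (v i j).totalDegree ≤ D)
    (hli : LinearIndependent (FractionRing (MvPolynomial (Fin n) ℚ)) fun i => fracVec (v i)) :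
    ∃ M : Matrix (Fin s) (Fin s) (MvPolynomial (Fin n) ℚ), M.det ≠ 0 ∧
      (∀ i, M (Fin.castLE hk i) = v i) ∧ ∀ i j, (M i j).totalDegree ≤ D := by
  obtain ⟨r, hr⟩ := Nat.exists_eq_add_of_le hk
  induction r generalizing k with
  | zero =>
    obtain rfl : s = k := hr
    exact ⟨v, det_ne_zero_iff_linearIndependent.mpr hli, fun i => rfl, hv⟩
  | succ r ih =>
    obtain ⟨j, hj⟩ : ∃ j : Fin s, fracVec (Pi.single j (1 : MvPolynomial (Fin n) ℚ)) ∉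
        Submodule.span (FractionRing (MvPolynomial (Fin n) ℚ))
          (Set.range fun i => fracVec (v i)) := by
      by_contra! hcon
      have htop : Submodule.span (FractionRing (MvPolynomial (Fin n) ℚ))
          (Set.range fun i => fracVec (v i)) = ⊤ := by
        rw [eq_top_iff, ← (Pi.basisFun _ (Fin s)).span_eq, Submodule.span_le]
        rintro _ ⟨j, rfl⟩
        have h1 := hcon j
        have h2 : fracVec (Pi.single j (1 : MvPolynomial (Fin n) ℚ)) =
            Pi.basisFun (FractionRing (MvPolynomial (Fin n) ℚ)) (Fin s) j := by
          ext l
          rw [Pi.basisFun_apply]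
          by_cases hl : l = j
          · subst hl; simp [fracVec]
          · simp [fracVec, hl]
        rwa [h2] at h1
      have h1 := finrank_range_le_card (R := FractionRing (MvPolynomial (Fin n) ℚ))
        (fun i => fracVec (v i))
      rw [Set.finrank, htop, finrank_top, Module.finrank_fin_fun, Fintype.card_fin] at h1
      omega
    obtain ⟨M, hM, hMv, hMD⟩ := ih (k := k + 1) (by omega)
      (Fin.snoc (α := fun _ => Fin s → MvPolynomial (Fin n) ℚ) v (Pi.single j 1)) (fun i l => by
        refine Fin.lastCases ?_ (fun i => ?_) i
        · rw [Fin.snoc_last]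
          by_cases hl : l = j
          · subst hl; simp
          · simp [hl]
        · rw [Fin.snoc_castSucc]
          exact hv i l) (by
        change LinearIndependent _ (fracVec ∘ Fin.snoc (α := fun _ => _) v _)
        rw [Fin.comp_snoc]
        exact linearIndependent_finSnoc.mpr ⟨hli, hj⟩) (by omega)
    refine ⟨M, hM, fun i => ?_, hMD⟩
    have := hMv i.castSucc
    rwa [Fin.snoc_castSucc] at this

theorem det_updateRow_eq_zero {n s k : ℕ} (hk : k < s)
    {v : Fin k → Fin s → MvPolynomial (Fin n) ℚ}
    {M : Matrix (Fin s) (Fin s) (MvPolynomial (Fin n) ℚ)}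
    (hM : ∀ i, M (Fin.castLE hk.le i) = v i) {u : Fin s → MvPolynomial (Fin n) ℚ}
    (hu : fracVec u ∈ Submodule.span (FractionRing (MvPolynomial (Fin n) ℚ))
      (Set.range fun i => fracVec (v i))) : (M.updateRow ⟨k, hk⟩ u).det = 0 := by
  by_contra h
  have h1 := linearIndependent_iff_notMem_span.mp (det_ne_zero_iff_linearIndependent.mp h) ⟨k, hk⟩
  apply h1
  simp only [Matrix.updateRow_self]
  refine Submodule.span_mono ?_ hu
  rintro _ ⟨i, rfl⟩
  have hne : Fin.castLE hk.le i ≠ ⟨k, hk⟩ := by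
    rw [Ne, Fin.ext_iff]
    exact i.2.ne
  exact ⟨Fin.castLE hk.le i, ⟨Set.mem_univ _, hne⟩, by simp only [Matrix.updateRow_ne hne, hM]⟩

theorem exists_annihilator {n s k D : ℕ} (hk : k < s)
    (v : Fin k → Fin s → MvPolynomial (Fin n) ℚ) (hv : ∀ i j, (v i j).totalDegree ≤ D)
    (hli : LinearIndependent (FractionRing (MvPolynomial (Fin n) ℚ)) fun i => fracVec (v i)) :
    ∃ q : Fin s → MvPolynomial (Fin n) ℚ, q ≠ 0 ∧ (∀ j, (q j).totalDegree ≤ s * D) ∧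
      ∀ u : Fin s → MvPolynomial (Fin n) ℚ,
        fracVec u ∈ Submodule.span (FractionRing (MvPolynomial (Fin n) ℚ))
          (Set.range fun i => fracVec (v i)) → ∑ j, u j * q j = 0 := by
  obtain ⟨M, hM, hMv, hMD⟩ := exists_matrix_extending hk.le v hv hli
  have key : ∀ u : Fin s → MvPolynomial (Fin n) ℚ, (M.updateRow ⟨k, hk⟩ u).det =
      ∑ j, u j * (M.updateRow ⟨k, hk⟩ (fun l => if j = l then 1 else 0)).det := by
    intro u
    rw [← Matrix.cramer_transpose_apply]
    have := LinearMap.pi_apply_eq_sum_univ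
      (LinearMap.proj (⟨k, hk⟩ : Fin s) ∘ₗ Matrix.cramer M.transpose) u
    simpa only [LinearMap.comp_apply, LinearMap.proj_apply, Matrix.cramer_transpose_apply,
      smul_eq_mul] using this
  refine ⟨fun j => (M.updateRow ⟨k, hk⟩ (fun l => if j = l then 1 else 0)).det, fun h0 => ?_,
    fun j => ?_, fun u hu => ?_⟩
  · apply hM
    have := key (M ⟨k, hk⟩)
    rw [Matrix.updateRow_eq_self] at this
    rw [this]
    exact Finset.sum_eq_zero fun j _ => mul_eq_zero_of_right _ (congrFun h0 j)
  · refine (totalDegree_det_le _ (fun _ => D) fun i l => ?_).trans (by simp)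
    by_cases hi : i = ⟨k, hk⟩
    · subst hi
      rw [Matrix.updateRow_self]
      split_ifs <;> simp
    · rw [Matrix.updateRow_ne hi]
      exact hMD i l
  · rw [← key u, det_updateRow_eq_zero hk hMv hu]

theorem totalDegree_bind₁_le {n m : ℕ} (p : MvPolynomial (Fin n) ℚ)
    {q : Fin n → MvPolynomial (Fin m) ℚ} (hq : ∀ i, (q i).totalDegree ≤ 1) :
    (bind₁ q p).totalDegree ≤ p.totalDegree := by
  conv_lhs => rw [p.as_sum, map_sum]
  refine totalDegree_finsetSum_le fun u hu => ?_
  rw [bind₁_monomial]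
  refine (totalDegree_mul _ _).trans ?_
  rw [totalDegree_C, zero_add]
  refine (totalDegree_finsetProd _ _).trans (le_trans ?_ (le_totalDegree hu))
  refine Finset.sum_le_sum fun i _ => ?_
  exact (totalDegree_pow _ _).trans (by nlinarith [hq i])

theorem isRelPrime_of_degree_on_lines {n d D : ℕ} {F Q : MvPolynomial (Fin n) ℚ}
    (hF : F.IsHomogeneous d) (hirr : RIrreducible D F) {a : Fin n → ℚ} (ha : eval a F ≠ 0)
    (hQ : Q ≠ 0) (hD : ∀ x, ∃ r : Polynomial ℚ, r.natDegree ≤ D ∧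
      ∀ t, r.eval t = eval (x + t • a) Q) : IsRelPrime F Q := by
  rintro g ⟨h, rfl⟩ ⟨h', rfl⟩
  have hF0 : g * h ≠ 0 := fun h0 => ha (by rw [h0, map_zero])
  have hg := isHomogeneous_of_mul hF hF0
  have hga : eval a g ≠ 0 := fun h0 => ha (by rw [map_mul, h0, zero_mul])
  refine hirr g (dvd_mul_right _ _) ?_
  obtain ⟨x, hx⟩ := exists_eval_ne_zero hQ
  obtain ⟨r, hr, hrx⟩ := hD x
  have h1 : r = (lineShift a g).map (eval x) * (lineShift a h').map (eval x) := by
    refine Polynomial.funext fun t => ?_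
    rw [hrx, Polynomial.eval_mul, eval_lineShift, eval_lineShift, map_mul]
  have h2 : r ≠ 0 := by
    rintro rfl
    have := hrx 0
    rw [Polynomial.eval_zero, zero_smul, add_zero] at this
    exact hx this.symm
  have h3 : g.totalDegree ≤ ((lineShift a g).map (eval x)).natDegree := by
    refine Polynomial.le_natDegree_of_ne_zero ?_
    rw [Polynomial.coeff_map, coeff_lineShift, eval_C, homogeneousComponent_of_mem hg, if_pos rfl]
    exact hga
  have h4 := Polynomial.natDegree_mul (left_ne_zero_of_mul (h1 ▸ h2))
    (right_ne_zero_of_mul (h1 ▸ h2))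
  rw [← h1] at h4
  omega

/-- The Plücker form of two linear functionals. -/
def bracket {n : ℕ} (ξ η : (Fin n → ℚ) →ₗ[ℚ] ℚ) (x y : Fin n → ℚ) : ℚ := ξ x * η y - ξ y * η x

/-- Coordinates, with respect to `a`, `b`, `c`, of a vector of `⟨a, b, c⟩` killed by `ξ` and `η`. -/
def pointVec {n : ℕ} (ξ η : (Fin n → ℚ) →ₗ[ℚ] ℚ) (a b c : Fin n → ℚ) : Fin 3 → ℚ :=
  ![bracket ξ η b c, bracket ξ η c a, bracket ξ η a b]

/-- The linear combination of `a`, `b`, `c` with coefficients `w`. -/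
def comb {n : ℕ} (a b c : Fin n → ℚ) (w : Fin 3 → ℚ) : Fin n → ℚ := w 0 • a + w 1 • b + w 2 • c

theorem comb_pointVec_mem {n : ℕ} (ξ η : (Fin n → ℚ) →ₗ[ℚ] ℚ) (a b c : Fin n → ℚ) :
    ξ (comb a b c (pointVec ξ η a b c)) = 0 ∧ η (comb a b c (pointVec ξ η a b c)) = 0 := by
  constructor <;>
  · simp only [comb, pointVec, bracket, map_add, map_smul, smul_eq_mul, Matrix.cons_val_zero,
      Matrix.cons_val_one, Matrix.cons_val]
    ring

theorem pointVec_eq_smul {n : ℕ} {ξ η : (Fin n → ℚ) →ₗ[ℚ] ℚ} {a b c : Fin n → ℚ} {α β : ℚ}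
    (hξ : ξ (α • a + β • b + c) = 0) (hη : η (α • a + β • b + c) = 0) :
    pointVec ξ η a b c = bracket ξ η a b • ![α, β, 1] := by
  simp only [map_add, map_smul, smul_eq_mul] at hξ hη
  ext l
  fin_cases l
  · simp [pointVec, bracket]
    linear_combination ξ b * hη - η b * hξ
  · simp [pointVec, bracket]
    linear_combination η a * hξ - ξ a * hη
  · simp [pointVec]

theorem exists_pointPoly {n : ℕ} (ξ η : (Fin n → ℚ) →ₗ[ℚ] ℚ) (a b : Fin n → ℚ) :
    ∃ p : Fin 3 → MvPolynomial (Fin n) ℚ, (∀ l, (p l).totalDegree ≤ 1) ∧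
      ∀ c, (fun l => eval c (p l)) = pointVec ξ η a b c := by
  obtain ⟨p₀, h₀, e₀⟩ := exists_poly_eval_eq (ξ b • η - η b • ξ) 0
  obtain ⟨p₁, h₁, e₁⟩ := exists_poly_eval_eq (η a • ξ - ξ a • η) 0
  refine ⟨![p₀, p₁, C (bracket ξ η a b)], fun l => ?_, fun c => ?_⟩
  · fin_cases l <;> simp [h₀, h₁]
  · ext l
    fin_cases l <;> simp [e₀, e₁, pointVec, bracket] <;> ring

theorem totalDegree_monVal_le {n : ℕ} (e : Fin 3 → ℕ) {p : Fin 3 → MvPolynomial (Fin n) ℚ}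
    (hp : ∀ l, (p l).totalDegree ≤ 1) : (monVal e p).totalDegree ≤ ∑ l, e l := by
  refine (totalDegree_finsetProd _ _).trans (Finset.sum_le_sum fun l _ => ?_)
  exact (totalDegree_pow _ _).trans (by nlinarith [hp l])

theorem monVal_smul (e : Fin 3 → ℕ) (t : ℚ) (w : Fin 3 → ℚ) :
    monVal e (t • w) = t ^ (∑ l, e l) * monVal e w := by
  simp [monVal, mul_pow, Finset.prod_mul_distrib, Finset.prod_pow_eq_pow_sum]

theorem eq_zero_of_eval_chart {D : ℕ} {G : MvPolynomial (Fin 3) ℚ} (hG : G.IsHomogeneous D)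
    (h : ∀ α β : ℚ, eval ![α, β, 1] G = 0) : G = 0 := by
  have h1 : X 2 * G = 0 := by
    refine MvPolynomial.funext fun w => ?_
    rw [map_mul, eval_X, map_zero]
    by_cases hw : w 2 = 0
    · rw [hw, zero_mul]
    · have h2 : w = w 2 • ![w 0 / w 2, w 1 / w 2, 1] := by
        ext l
        fin_cases l <;> simp <;> field_simp
      rw [h2, eval_smul_of_isHomogeneous hG, h, mul_zero, mul_zero]
  exact (mul_eq_zero.mp h1).resolve_left (X_ne_zero _)

theorem exists_dual_functionals {n : ℕ} {ξ η : (Fin n → ℚ) →ₗ[ℚ] ℚ} {a b : Fin n → ℚ}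
    (h : bracket ξ η a b ≠ 0) :
    ∃ τ υ : (Fin n → ℚ) →ₗ[ℚ] ℚ, τ a = 1 ∧ τ b = 0 ∧ υ a = 0 ∧ υ b = 1 := by
  refine ⟨(bracket ξ η a b)⁻¹ • (η b • ξ - ξ b • η), (bracket ξ η a b)⁻¹ • (ξ a • η - η a • ξ),
    ?_, ?_, ?_, ?_⟩ <;>
  simp only [LinearMap.smul_apply, LinearMap.sub_apply, smul_eq_mul]
  · rw [inv_mul_eq_one₀ h, bracket]
    ring
  · ring
  · ring
  · rw [inv_mul_eq_one₀ h, bracket]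
    ring

theorem natDegree_monVal_le (e : Fin 3 → ℕ) {p : Fin 3 → Polynomial ℚ}
    (hp : ∀ l, (p l).natDegree ≤ 1) : (monVal e p).natDegree ≤ ∑ l, e l := by
  refine (Polynomial.natDegree_prod_le _ _).trans (Finset.sum_le_sum fun l _ => ?_)
  exact Polynomial.natDegree_pow_le.trans (by nlinarith [hp l])

/-- Substituting the first two coordinates for `a`, `b` in a family of polynomials. -/
theorem Veronese.exists_section {n D N K m E : ℕ} {mon : Fin N → Fin 3 → ℕ}
    (hV : Veronese D N K m mon) {q : Fin N → MvPolynomial (Fin n) ℚ} (hq : q ≠ 0)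
    (hqE : ∀ j, (q j).totalDegree ≤ E) {a b : Fin n → ℚ} {τ υ : (Fin n → ℚ) →ₗ[ℚ] ℚ}
    (ha : τ a = 1) (hb : τ b = 0) (ha' : υ a = 0) (hb' : υ b = 1) :
    ∃ Q : MvPolynomial (Fin n) ℚ, Q ≠ 0 ∧ Q.totalDegree ≤ D + E ∧
      (∀ x, ∃ r : Polynomial ℚ, r.natDegree ≤ D ∧ ∀ t, r.eval t = eval (x + t • a) Q) ∧
      ∀ x, ∃ (c : Fin n → ℚ) (α β : ℚ), x = α • a + β • b + c ∧
        eval x Q = ∑ j, monVal (mon j) ![α, β, 1] * eval c (q j) := by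
  obtain ⟨j₀, hj₀⟩ := Function.ne_iff.mp hq
  obtain ⟨c₀, hc₀⟩ := exists_eval_ne_zero hj₀
  obtain ⟨pA, hA, eA⟩ := exists_poly_eval_eq τ (-τ c₀)
  obtain ⟨pB, hB, eB⟩ := exists_poly_eval_eq υ (-υ c₀)
  have hcc : ∀ i, (X i - pA * C (a i) - pB * C (b i)).totalDegree ≤ 1 := by
    intro i
    refine (totalDegree_sub _ _).trans (max_le ((totalDegree_sub _ _).trans (max_le ?_ ?_)) ?_)
    · rw [totalDegree_X]
    · exact (totalDegree_mul _ _).trans (by simpa using hA)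
    · exact (totalDegree_mul _ _).trans (by simpa using hB)
  set cc : Fin n → MvPolynomial (Fin n) ℚ := fun i => X i - pA * C (a i) - pB * C (b i) with hccdef
  set Q : MvPolynomial (Fin n) ℚ := ∑ j, monVal (mon j) ![pA, pB, 1] * bind₁ cc (q j) with hQdef
  have hev : ∀ x, eval x Q = ∑ j, monVal (mon j) ![τ x - τ c₀, υ x - υ c₀, 1] *
      eval (x - (τ x - τ c₀) • a - (υ x - υ c₀) • b) (q j) := by
    intro x
    rw [hQdef, map_sum]
    refine Finset.sum_congr rfl fun j _ => ?_
    rw [map_mul, monVal_map]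
    refine congrArg₂ (· * ·) (congrArg _ ?_) ?_
    · ext l
      fin_cases l <;> simp [eA, eB, sub_eq_add_neg]
    · rw [show eval x (bind₁ cc (q j)) = eval (fun i => eval x (cc i)) (q j) from
        eval₂Hom_bind₁ _ _ _ _]
      congr 2
      ext i
      simp [hccdef, eA, eB, sub_eq_add_neg]
  refine ⟨Q, fun hQ0 => hj₀ ?_, ?_, fun x => ?_, fun x => ⟨_, _, _, ?_, hev x⟩⟩
  · by_contra
    refine hV.formOf_ne_zero (c := fun j => eval c₀ (q j)) (fun h => hc₀ (congrFun h j₀)) ?_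
    refine eq_zero_of_eval_chart (hV.isHomogeneous_formOf _) fun α β => ?_
    have h1 := hev (α • a + β • b + c₀)
    rw [hQ0, map_zero] at h1
    rw [eval_formOf, h1]
    refine Finset.sum_congr rfl fun j _ => ?_
    have h2 : α • a + β • b + c₀ - α • a - β • b = c₀ := by abel
    simp [ha, hb, ha', hb', h2, mul_comm]
  · refine totalDegree_finsetSum_le fun j _ => (totalDegree_mul _ _).trans (add_le_add ?_ ?_)
    · refine (totalDegree_monVal_le _ fun l => ?_).trans (hV.sum_eq j).le
      fin_cases l <;> simp [hA, hB]
    · exact (totalDegree_bind₁_le _ hcc).trans (hqE j)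
  · refine ⟨∑ j, monVal (mon j) ![Polynomial.C (τ x - τ c₀) + Polynomial.X,
      Polynomial.C (υ x - υ c₀), 1] *
        Polynomial.C (eval (x - (τ x - τ c₀) • a - (υ x - υ c₀) • b) (q j)), ?_, fun t => ?_⟩
    · refine Polynomial.natDegree_sum_le_of_forall_le _ _ fun j _ => ?_
      refine (Polynomial.natDegree_mul_C_le _ _).trans
        ((natDegree_monVal_le _ fun l => ?_).trans (hV.sum_eq j).le)
      fin_cases l
      · exact (Polynomial.natDegree_C_add (a := τ x - τ c₀) (p := Polynomial.X)).le.trans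
          Polynomial.natDegree_X_le
      · exact (Polynomial.natDegree_C _).le.trans zero_le_one
      · exact Polynomial.natDegree_one.le.trans zero_le_one
    · rw [hev, Polynomial.eval_finsetSum]
      refine Finset.sum_congr rfl fun j _ => ?_
      rw [Polynomial.eval_mul, Polynomial.eval_C]
      congr 1
      · rw [← Polynomial.coe_evalRingHom, monVal_map]
        congr 1
        ext l
        fin_cases l
        · simp [ha]
          ring
        · simp [ha']
        · simp
      · congr 2
        ext i
        simp [ha, ha']
        ring
  · abel

theorem Veronese.card_le_of_mem_span {ι : Type*} {n D N K m k : ℕ} {mon : Fin N → Fin 3 → ℕ}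
    (hV : Veronese D N K m mon) {f : MvPolynomial (Fin n) ℚ} {s : Finset ι} {pt : ι → Fin n → ℚ}
    {V : ι → Submodule ℚ (Fin n → ℚ)} (h : IsPlaneFamily f s pt V) (hf : Irreducible f)
    (hd : f.totalDegree ≠ 0) (hncc : IsNCC f)
    (hirr : RIrreducible D (homogeneousComponent f.totalDegree f)) {a b : Fin n → ℚ}
    (ha : eval a (homogeneousComponent f.totalDegree f) ≠ 0)
    {ξ η : ι → (Fin n → ℚ) →ₗ[ℚ] ℚ} (hcut : ∀ i ∈ s, ∀ v ∈ V i, ξ i v = 0 ∧ η i v = 0)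
    (hab : ∀ i ∈ s, bracket (ξ i) (η i) a b ≠ 0) {pp : ι → Fin 3 → MvPolynomial (Fin n) ℚ}
    (hpp : ∀ i c, (fun l => eval c (pp i l)) = pointVec (ξ i) (η i) a b c)
    (hk : k < N) (v : Fin k → Fin N → MvPolynomial (Fin n) ℚ)
    (hv : ∀ i j, (v i j).totalDegree ≤ D)
    (hli : LinearIndependent (FractionRing (MvPolynomial (Fin n) ℚ)) fun i => fracVec (v i))
    {S : Finset ι} (hS : S ⊆ s)
    (hspan : ∀ i ∈ S, fracVec (fun j => monVal (mon j) (pp i)) ∈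
      Submodule.span (FractionRing (MvPolynomial (Fin n) ℚ)) (Set.range fun i => fracVec (v i))) :
    S.card ≤ 4 * f.totalDegree ^ 3 * (D * (N + 1)) := by
  classical
  obtain rfl | ⟨i₀, hi₀⟩ := S.eq_empty_or_nonempty
  · simp
  obtain ⟨τ, υ, h1, h2, h3, h4⟩ := exists_dual_functionals (hab i₀ (hS hi₀))
  obtain ⟨q, hq0, hqD, hq⟩ := exists_annihilator hk v hv hli
  obtain ⟨Q, hQ0, hQD, hQl, hQ⟩ := hV.exists_section hq0 hqD h1 h2 h3 h4
  have hrel := isRelPrime_of_degree_on_lines (homogeneousComponent_isHomogeneous _ f)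
    hirr ha hQ0 hQl
  have hQV : ∀ i ∈ S, ∀ x ∈ V i, eval x Q = 0 := by
    intro i hi x hx
    obtain ⟨c, α, β, rfl, hxQ⟩ := hQ x
    obtain ⟨hξ, hη⟩ := hcut i (hS hi) _ hx
    have h5 := congrArg (eval c) (hq _ (hspan i hi))
    rw [map_sum, map_zero] at h5
    rw [hxQ]
    have h6 : bracket (ξ i) (η i) a b ^ D * ∑ j, monVal (mon j) ![α, β, 1] * eval c (q j) = 0 := by
      rw [← h5, Finset.mul_sum]
      refine Finset.sum_congr rfl fun j _ => ?_
      rw [map_mul, monVal_map, hpp, pointVec_eq_smul hξ hη, monVal_smul, hV.sum_eq, mul_assoc]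
    exact (mul_eq_zero.mp h6).resolve_left (pow_ne_zero _ (hab i (hS hi)))
  have hT : (S.image V).card ≤ 2 * f.totalDegree * (D + N * D) := by
    refine (card_planes_le hrel (S.image V) (fun _ => 0) id ?_ ?_ ?_ ?_).trans ?_
    · intro W hW
      obtain ⟨i, hi, rfl⟩ := Finset.mem_image.mp hW
      exact h.finrank_eq i (hS hi)
    · intro W _ W' _ hWW' _
      exact hWW'
    · intro W hW x hx
      obtain ⟨i, hi, rfl⟩ := Finset.mem_image.mp hW
      rw [zero_add]
      exact h.eval_top hd (hS hi) hx
    · intro W hW x hx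
      obtain ⟨i, hi, rfl⟩ := Finset.mem_image.mp hW
      rw [zero_add]
      exact hQV i hi x hx
    · exact Nat.mul_le_mul
        (Nat.mul_le_mul le_rfl (homogeneousComponent_isHomogeneous _ f).totalDegree_le) hQD
  have hfib : S.card ≤ 2 * f.totalDegree ^ 2 * (S.image V).card := by
    refine Finset.card_le_mul_card_image _ _ fun W _ => ?_
    exact (h.mono ((Finset.filter_subset _ _).trans hS)).card_le_of_eq hf hd hncc W
      fun i hi => (Finset.mem_filter.mp hi).2
  calc S.card ≤ 2 * f.totalDegree ^ 2 * (2 * f.totalDegree * (D + N * D)) :=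
        hfib.trans (Nat.mul_le_mul le_rfl hT)
    _ = _ := by ring

/-- Points of a plane curve of degree `d`, counted with multiplicity at most `μ`, most of which
do not lie on few curves of degree `D`, accumulate on a curve of degree `D`. -/
theorem Veronese.card_le_of_forall_form {D s K m : ℕ} {mon : Fin s → Fin 3 → ℕ}
    (hV : Veronese D s K m mon) (hD : 1 ≤ D) {ι : Type*} {w : ι → Fin 3 → ℤ} {X : Fin 3 → ℕ}
    {P Q : ℕ} (hP : 2 ≤ P) (hXP : ∀ l, X l ≤ P ^ 4)
    (hXK : s.factorial * (∏ l, X l) ^ m < P ^ K) {S : Finset ℕ}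
    (hS : ∀ p ∈ S, p.Prime ∧ P ≤ p ∧ p ≤ Q) (d : ℕ) (hScard : 128 * d ^ 3 ≤ S.card)
    {F : MvPolynomial (Fin 3) ℚ} (hF : F.IsHomogeneous d) (hF0 : F ≠ 0) {A : Finset ι}
    (hA0 : ∀ a ∈ A, w a ≠ 0) (hA : ∀ a ∈ A, eval (ratVec (w a)) F = 0)
    (hX : ∀ a ∈ A, ∀ l, |w a l| ≤ X l) {μ : ℕ}
    (hμ : ∀ a ∈ A, ∀ B ⊆ A, (∀ b ∈ B,
      Submodule.span ℚ {ratVec (w b)} = Submodule.span ℚ {ratVec (w a)}) → B.card ≤ μ)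
    {r : ℕ} (hr : ∀ G : MvPolynomial (Fin 3) ℚ, G ≠ 0 →
      G.IsHomogeneous D → (A.filter fun a => eval (ratVec (w a)) G = 0).card ≤ r) :
    A.card ≤ d * r + 12 * D * Q * d ^ 2 * μ := by
  classical
  obtain ⟨A', hA', hinj, himg⟩ := Finset.exists_subset_injOn_image_eq_of_surjOn
    (A : Set ι) (A.image fun a => Submodule.span ℚ {ratVec (w a)})
    (f := fun a => Submodule.span ℚ {ratVec (w a)}) (by
      rw [Finset.coe_image]; exact Set.surjOn_image _ _)
  have hfam : IsPointFamily A' w :=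
    ⟨fun a ha => hA0 a (hA' ha), fun a ha b hb hab => hinj ha hb hab⟩
  obtain ⟨𝒢, h𝒢, h𝒢D, E, hE, hAE⟩ := hV.exists_cover hD hP hXP hXK hS d hScard hF hF0 hfam
    (fun a ha => hA a (hA' ha)) fun a ha => hX a (hA' ha)
  have hsub : A ⊆ (𝒢.biUnion fun G => A.filter fun a => eval (ratVec (w a)) G = 0) ∪
      ((E ∩ A).biUnion fun e => A.filter fun a =>
        Submodule.span ℚ {ratVec (w a)} = Submodule.span ℚ {ratVec (w e)}) := by
    intro a ha
    obtain ⟨b, hb, hab⟩ := Finset.mem_image.mp (himg ▸ Finset.mem_image_of_mem _ ha)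
    rcases hAE b hb with h1 | ⟨G, hG, h1⟩
    · refine Finset.mem_union_right _ (Finset.mem_biUnion.mpr
        ⟨b, Finset.mem_inter.mpr ⟨h1, hA' hb⟩, Finset.mem_filter.mpr ⟨ha, hab.symm⟩⟩)
    · refine Finset.mem_union_left _ (Finset.mem_biUnion.mpr
        ⟨G, hG, Finset.mem_filter.mpr ⟨ha, ?_⟩⟩)
      refine eval_eq_zero_of_mem_span (h𝒢D G hG).2 h1 ?_
      have hab' : Submodule.span ℚ {ratVec (w b)} = Submodule.span ℚ {ratVec (w a)} := hab
      rw [hab']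
      exact Submodule.mem_span_singleton_self _
  refine (Finset.card_le_card hsub).trans ((Finset.card_union_le _ _).trans (add_le_add ?_ ?_))
  · exact (Finset.card_biUnion_le_card_mul _ _ r fun G hG =>
      hr G (h𝒢D G hG).1 (h𝒢D G hG).2).trans (Nat.mul_le_mul_right _ h𝒢)
  · refine (Finset.card_biUnion_le_card_mul _ _ μ fun e he => ?_).trans (Nat.mul_le_mul_right _
      ((Finset.card_le_card Finset.inter_subset_left).trans hE))
    exact hμ e (Finset.mem_inter.mp he).2 _ (Finset.filter_subset _ _)
      fun b hb => (Finset.mem_filter.mp hb).2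

/-- The grid `{0, …, R-1}ⁿ`. -/
def grid (n R : ℕ) : Finset (Fin n → ℚ) :=
  Fintype.piFinset fun _ => (Finset.range R).map Nat.castEmbedding

theorem card_grid (n R : ℕ) : (grid n R).card = R ^ n := by
  simp [grid]

theorem exists_ratVec_of_mem_grid {n R : ℕ} {c : Fin n → ℚ} (hc : c ∈ grid n R) :
    ∃ z : Fin n → ℤ, ratVec z = c ∧ ∀ k, |z k| ≤ (R : ℤ) ∧ |z k| ≤ (R : ℤ) - 1 := by
  have h1 : ∀ k, ∃ m : ℕ, m < R ∧ (m : ℚ) = c k := fun k => by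
    simpa using Fintype.mem_piFinset.mp hc k
  choose m hm hmc using h1
  refine ⟨fun k => m k, funext hmc, fun k => ?_⟩
  have := hm k
  rw [Nat.abs_cast]
  constructor <;> omega

theorem card_zeros_grid_le {n : ℕ} {p : MvPolynomial (Fin n) ℚ} (hp : p ≠ 0) {R : ℕ} (hR : 0 < R) :
    R * ((grid n R).filter fun c => eval c p = 0).card ≤ p.totalDegree * R ^ n := by
  have h1 := schwartz_zippel_totalDegree hp ((Finset.range R).map Nat.castEmbedding)
  rw [Finset.card_map, Finset.card_range, div_le_div_iff₀ (by positivity) (by positivity)] at h1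
  rw [mul_comm]
  exact_mod_cast h1

theorem exists_grid_eval_ne_zero {n : ℕ} {p : MvPolynomial (Fin n) ℚ} (hp : p ≠ 0) :
    ∃ z : Fin n → ℤ, eval (ratVec z) p ≠ 0 ∧ ∀ k, |z k| ≤ (p.totalDegree : ℤ) := by
  have h1 := card_zeros_grid_le hp (Nat.succ_pos p.totalDegree)
  have h2 : ((grid n (p.totalDegree + 1)).filter fun c => eval c p = 0).card <
      (grid n (p.totalDegree + 1)).card := by
    rw [card_grid]
    have : 0 < (p.totalDegree + 1) ^ n := by positivity
    by_contra! h
    have h3 := Nat.mul_le_mul_left (p.totalDegree + 1) h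
    have h4 := h3.trans h1
    nlinarith
  obtain ⟨c, hc, hc0⟩ : ∃ c ∈ grid n (p.totalDegree + 1), eval c p ≠ 0 := by
    by_contra! h
    rw [Finset.filter_true_of_mem h] at h2
    exact lt_irrefl _ h2
  obtain ⟨z, rfl, hz⟩ := exists_ratVec_of_mem_grid hc
  exact ⟨z, hc0, fun k => by simpa using (hz k).2⟩

theorem exists_single_notMem {n : ℕ} {W : Submodule ℚ (Fin n → ℚ)} (hW : W ≠ ⊤) :
    ∃ i, Pi.single i (1 : ℚ) ∉ W := by
  by_contra! h
  refine hW (eq_top_iff.mpr fun x _ => ?_)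
  rw [← Finset.univ_sum_single x]
  refine W.sum_mem fun i _ => ?_
  rw [show Pi.single i (x i) = x i • (Pi.single i 1 : Fin n → ℚ) by
    rw [← Pi.single_smul, smul_eq_mul, mul_one]]
  exact W.smul_mem _ (h i)

theorem abs_sum_sum_le {n : ℕ} {β : Fin n → Fin n → ℤ} {x y : Fin n → ℤ} {H A A' : ℤ}
    (hβ : ∀ k l, |β k l| ≤ H) (hx : ∀ k, |x k| ≤ A) (hy : ∀ k, |y k| ≤ A') :
    |∑ k, ∑ l, x k * y l * β k l| ≤ n ^ 2 * H * A * A' := by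
  refine (Finset.abs_sum_le_sum_abs _ _).trans ?_
  refine (Finset.sum_le_sum (g := fun _ => (n : ℤ) * (A * A' * H)) fun k _ => ?_).trans ?_
  · refine (Finset.abs_sum_le_sum_abs _ _).trans ?_
    refine (Finset.sum_le_sum (g := fun _ => A * A' * H) fun l _ => ?_).trans ?_
    · rw [abs_mul, abs_mul]
      have h1 := (abs_nonneg (x k)).trans (hx k)
      have h2 := (abs_nonneg (y l)).trans (hy l)
      gcongr
      · exact hx k
      · exact hy l
      · exact hβ k l
    · simp
  · simp
    apply le_of_eq
    ring

theorem ratVec_single {n : ℕ} (k : Fin n) : ratVec (Pi.single k (1 : ℤ)) = Pi.single k (1 : ℚ) := by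
  ext l
  by_cases hk : l = k
  · subst hk; simp [ratVec]
  · simp [ratVec, hk]

theorem apply_eq_sum_single {n : ℕ} (φ : (Fin n → ℚ) →ₗ[ℚ] ℚ) (v : Fin n → ℚ) :
    φ v = ∑ l, v l * φ (Pi.single l 1) := by
  conv_lhs => rw [← Finset.univ_sum_single v, map_sum]
  refine Finset.sum_congr rfl fun i _ => ?_
  rw [← smul_eq_mul, ← map_smul, ← Pi.single_smul, smul_eq_mul, mul_one]

theorem bracket_ratVec {n : ℕ} {ξ η : (Fin n → ℚ) →ₗ[ℚ] ℚ} {β : Fin n → Fin n → ℤ}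
    (hβ : ∀ k l, (β k l : ℚ) = bracket ξ η (Pi.single k 1) (Pi.single l 1)) (x y : Fin n → ℤ) :
    bracket ξ η (ratVec x) (ratVec y) = ((∑ k, ∑ l, x k * y l * β k l : ℤ) : ℚ) := by
  rw [bracket, apply_eq_sum_single ξ, apply_eq_sum_single ξ, apply_eq_sum_single η,
    apply_eq_sum_single η]
  simp only [ratVec]
  push_cast
  simp only [hβ, bracket, Finset.sum_mul_sum]
  rw [Finset.sum_comm (f := fun i j => (y i : ℚ) * ξ (Pi.single i 1) * (x j * η (Pi.single j 1))),
    ← Finset.sum_sub_distrib]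
  refine Finset.sum_congr rfl fun k _ => ?_
  rw [← Finset.sum_sub_distrib]
  exact Finset.sum_congr rfl fun l _ => by ring

/-- Planes of the family which do not meet the span of `a` and `b` transversally are few. -/
theorem IsPlaneFamily.card_bracket_eq_zero_le {ι : Type*} {n : ℕ} {f : MvPolynomial (Fin n) ℚ}
    {s : Finset ι} {pt : ι → Fin n → ℚ} {V : ι → Submodule ℚ (Fin n → ℚ)}
    (h : IsPlaneFamily f s pt V) (hf : Irreducible f) (hd : f.totalDegree ≠ 0)
    {ξ η : ι → (Fin n → ℚ) →ₗ[ℚ] ℚ} (hcut : ∀ i ∈ s, ∀ v, v ∈ V i ↔ ξ i v = 0 ∧ η i v = 0)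
    {a b : Fin n → ℚ} (ha : eval a (homogeneousComponent f.totalDegree f) ≠ 0)
    (hb : b ∉ (dirDeriv f).ker ⊔ Submodule.span ℚ {a}) :
    (s.filter fun i => bracket (ξ i) (η i) a b = 0).card ≤ 2 * f.totalDegree ^ 3 := by
  classical
  set F := homogeneousComponent f.totalDegree f with hF
  have hF0 : F ≠ 0 := fun h0 => ha (by rw [h0, map_zero])
  have hFh : F.IsHomogeneous f.totalDegree := homogeneousComponent_isHomogeneous _ _
  have hFd := hFh.totalDegree hF0
  set g := (lineShift a F).map (eval b) with hg
  have hg0 : g ≠ 0 := by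
    intro h0
    have h1 := congrArg (fun q => q.coeff F.totalDegree) h0
    simp only [hg, Polynomial.coeff_map, coeff_lineShift, eval_C, Polynomial.coeff_zero] at h1
    rw [hFd, homogeneousComponent_of_mem hFh, if_pos rfl] at h1
    exact ha h1
  have hsub : (s.filter fun i => bracket (ξ i) (η i) a b = 0) ⊆
      g.roots.toFinset.biUnion fun t => s.filter fun i => b + t • a ∈ V i := by
    intro i hi
    obtain ⟨his, hi0⟩ := Finset.mem_filter.mp hi
    have haV : ¬(ξ i a = 0 ∧ η i a = 0) := fun h0 => ha (h.eval_top hd his ((hcut i his a).mpr h0))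
    rw [bracket] at hi0
    obtain ⟨t, ht⟩ : ∃ t, b + t • a ∈ V i := by
      by_cases h1 : ξ i a = 0
      · have h2 : η i a ≠ 0 := fun h2 => haV ⟨h1, h2⟩
        refine ⟨-(η i b / η i a), (hcut i his _).mpr ⟨?_, ?_⟩⟩
        · have h3 : ξ i b = 0 := by
            rw [h1, zero_mul, zero_sub, neg_eq_zero] at hi0
            exact (mul_eq_zero.mp hi0).resolve_right h2
          simp [h1, h3]
        · simp [h2]
      · refine ⟨-(ξ i b / ξ i a), (hcut i his _).mpr ⟨?_, ?_⟩⟩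
        · simp [h1]
        · simp only [map_add, map_smul, smul_eq_mul]
          field_simp
          linear_combination hi0
    refine Finset.mem_biUnion.mpr ⟨t, ?_, Finset.mem_filter.mpr ⟨his, ht⟩⟩
    rw [Multiset.mem_toFinset, Polynomial.mem_roots hg0, Polynomial.IsRoot, hg, eval_lineShift]
    exact h.eval_top hd his ht
  refine (Finset.card_le_card hsub).trans ((Finset.card_biUnion_le_card_mul _ _
    (2 * f.totalDegree ^ 2) fun t _ => ?_).trans ?_)
  · refine (h.mono (Finset.filter_subset _ _)).card_le_of_mem hf hd (w := b + t • a) ?_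
      fun i hi => (Finset.mem_filter.mp hi).2
    intro h0
    apply hb
    have h1 : b = (b + t • a) + (-t) • a := by rw [neg_smul]; abel
    rw [h1]
    exact Submodule.add_mem_sup (LinearMap.mem_ker.mpr h0)
      (Submodule.smul_mem _ _ (Submodule.mem_span_singleton_self a))
  · have h1 : g.roots.toFinset.card ≤ f.totalDegree :=
      (Multiset.toFinset_card_le _).trans ((Polynomial.card_roots' _).trans
        ((Polynomial.natDegree_map_le.trans (natDegree_lineShift_le _ _)).trans hFd.le))
    calc _ ≤ f.totalDegree * (2 * f.totalDegree ^ 2) := Nat.mul_le_mul_right _ h1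
      _ = _ := by ring

theorem Veronese.exists_dense_form {ι : Type*} {n D N K m : ℕ} {mon : Fin N → Fin 3 → ℕ}
    (hV : Veronese D N K m mon) (hD : 1 ≤ D) {f : MvPolynomial (Fin n) ℚ} {s : Finset ι}
    {pt : ι → Fin n → ℚ} {V : ι → Submodule ℚ (Fin n → ℚ)} (h : IsPlaneFamily f s pt V)
    (hf : Irreducible f) (hd : f.totalDegree ≠ 0) {a b c : Fin n → ℤ}
    (ha : eval (ratVec a) (homogeneousComponent f.totalDegree f) ≠ 0)
    (hc : ratVec c ∉ (dirDeriv f).ker ⊔ Submodule.span ℚ {ratVec a, ratVec b})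
    {ξ η : ι → (Fin n → ℚ) →ₗ[ℚ] ℚ} (hcut : ∀ i ∈ s, ∀ v, v ∈ V i ↔ ξ i v = 0 ∧ η i v = 0)
    (hab : ∀ i ∈ s, bracket (ξ i) (η i) (ratVec a) (ratVec b) ≠ 0)
    {β : ι → Fin n → Fin n → ℤ} {H R : ℕ} (hβ : ∀ i ∈ s, ∀ k l,
      (β i k l : ℚ) = bracket (ξ i) (η i) (Pi.single k 1) (Pi.single l 1))
    (hβH : ∀ i ∈ s, ∀ k l, |β i k l| ≤ H) (haR : ∀ k, |a k| ≤ (f.totalDegree : ℤ))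
    (hbR : ∀ k, |b k| ≤ 1) (hcR : ∀ k, |c k| ≤ (R : ℤ)) (hR : 1 ≤ R) {P Q : ℕ} (hP : 2 ≤ P)
    (hXP : n ^ 2 * H * R * f.totalDegree ≤ P ^ 4)
    (hXK : N.factorial * (n ^ 6 * H ^ 3 * R ^ 2 * f.totalDegree ^ 2) ^ m < P ^ K) {S : Finset ℕ}
    (hS : ∀ p ∈ S, p.Prime ∧ P ≤ p ∧ p ≤ Q) (hScard : 128 * f.totalDegree ^ 3 ≤ S.card)
    (hM : 2 * (24 * D * Q * f.totalDegree ^ 4) < s.card) :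
    ∃ G : MvPolynomial (Fin 3) ℚ, G ≠ 0 ∧ G.IsHomogeneous D ∧ s.card ≤ 2 * f.totalDegree *
      (s.filter fun i =>
        eval (pointVec (ξ i) (η i) (ratVec a) (ratVec b) (ratVec c)) G = 0).card := by
  classical
  set d := f.totalDegree with hdd
  have hd1 : 1 ≤ d := Nat.one_le_iff_ne_zero.mpr hd
  set F := homogeneousComponent d f with hF
  have hFh : F.IsHomogeneous d := homogeneousComponent_isHomogeneous _ _
  let sub : Fin n → MvPolynomial (Fin 3) ℚ := fun k =>
    C (ratVec a k) * X 0 + C (ratVec b k) * X 1 + C (ratVec c k) * X 2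
  have hsub : ∀ k, (sub k).IsHomogeneous 1 := fun k =>
    (((isHomogeneous_C_mul_X _ _).add (isHomogeneous_C_mul_X _ _)).add (isHomogeneous_C_mul_X _ _))
  have hFc : (aeval sub F).IsHomogeneous d := by simpa using hFh.aeval sub hsub
  have hev : ∀ w : Fin 3 → ℚ, eval w (aeval sub F) =
      eval (comb (ratVec a) (ratVec b) (ratVec c) w) F := by
    intro w
    rw [show eval w (aeval sub F) = eval (fun k => eval w (sub k)) F from
      eval₂Hom_bind₁ _ _ _ _]
    congr 2
    ext k
    simp [sub, comb]
    ring
  have hF0 : aeval sub F ≠ 0 := by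
    intro h0
    have h1 := hev ![1, 0, 0]
    rw [h0, map_zero] at h1
    apply ha
    rw [h1]
    simp [comb]
  let W : ι → Fin 3 → ℤ := fun i => ![∑ k, ∑ l, b k * c l * β i k l,
    ∑ k, ∑ l, c k * a l * β i k l, ∑ k, ∑ l, a k * b l * β i k l]
  have hW : ∀ i ∈ s, ratVec (W i) = pointVec (ξ i) (η i) (ratVec a) (ratVec b) (ratVec c) := by
    intro i hi
    rw [pointVec, bracket_ratVec (hβ i hi), bracket_ratVec (hβ i hi), bracket_ratVec (hβ i hi)]
    ext l
    fin_cases l <;> rfl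
  have hmemV : ∀ i ∈ s, comb (ratVec a) (ratVec b) (ratVec c) (ratVec (W i)) ∈ V i := by
    intro i hi
    rw [hW i hi, hcut i hi]
    exact comb_pointVec_mem _ _ _ _ _
  have hW2 : ∀ i ∈ s, ratVec (W i) 2 ≠ 0 := by
    intro i hi
    rw [hW i hi]
    exact hab i hi
  have hW0 : ∀ i ∈ s, W i ≠ 0 := fun i hi h0 => hW2 i hi (by rw [h0]; simp [ratVec])
  have hWF : ∀ i ∈ s, eval (ratVec (W i)) (aeval sub F) = 0 := fun i hi => by
    rw [hev]
    exact h.eval_top hd hi (hmemV i hi)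
  by_contra! hG
  have key := hV.card_le_of_forall_form hD (w := W)
    (X := ![n ^ 2 * H * R, n ^ 2 * H * R * d, n ^ 2 * H * d]) hP ?_ ?_ hS d hScard hFc hF0 hW0 hWF
    ?_ (μ := 2 * d ^ 2) ?_ (r := (s.card - 1) / (2 * d)) ?_
  · have h1 : 2 * d * ((s.card - 1) / (2 * d)) ≤ s.card - 1 := Nat.mul_div_le _ _
    have h2 : 12 * D * Q * d ^ 2 * (2 * d ^ 2) = 24 * D * Q * d ^ 4 := by ring
    rw [h2] at key
    rw [mul_assoc] at h1
    omega
  · intro l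
    fin_cases l
    · exact (Nat.le_mul_of_pos_right _ hd1).trans hXP
    · exact hXP
    · refine le_trans ?_ hXP
      simp only [Fin.reduceFinMk, Matrix.cons_val]
      exact Nat.mul_le_mul_right _ (Nat.le_mul_of_pos_right _ hR)
  · rw [Fin.prod_univ_three]
    simp only [Matrix.cons_val]
    refine lt_of_eq_of_lt ?_ hXK
    congr 2
    ring
  · intro i hi l
    fin_cases l
    · exact (abs_sum_sum_le (hβH i hi) hbR hcR).trans_eq (by simp)
    · exact (abs_sum_sum_le (hβH i hi) hcR haR).trans_eq (by simp)
    · exact (abs_sum_sum_le (hβH i hi) haR hbR).trans_eq (by simp)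
  · intro i hi B hB hBi
    refine (h.mono hB).card_le_of_mem hf hd
      (w := comb (ratVec a) (ratVec b) (ratVec c) (ratVec (W i))) ?_ fun j hj => ?_
    · intro h0
      apply hc
      set w := ratVec (W i)
      have hw2 : w 2 ≠ 0 := hW2 i hi
      have h1 : ratVec c = (w 2)⁻¹ • comb (ratVec a) (ratVec b) (ratVec c) w +
          ((-((w 2)⁻¹ * w 0)) • ratVec a + (-((w 2)⁻¹ * w 1)) • ratVec b) := by
        ext k
        simp only [comb, Pi.add_apply, Pi.smul_apply, smul_eq_mul]
        field_simp
        ring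
      rw [h1]
      refine Submodule.add_mem_sup (Submodule.smul_mem _ _ (LinearMap.mem_ker.mpr h0)) ?_
      exact Submodule.add_mem _ (Submodule.smul_mem _ _ (Submodule.subset_span (by simp)))
        (Submodule.smul_mem _ _ (Submodule.subset_span (by simp)))
    · have h1 : ratVec (W i) ∈ Submodule.span ℚ {ratVec (W j)} := by
        rw [hBi j hj]
        exact Submodule.mem_span_singleton_self _
      obtain ⟨t, ht⟩ := Submodule.mem_span_singleton.mp h1
      have h2 : comb (ratVec a) (ratVec b) (ratVec c) (ratVec (W i)) =
          t • comb (ratVec a) (ratVec b) (ratVec c) (ratVec (W j)) := by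
        rw [← ht]
        simp [comb, smul_smul]
      rw [h2]
      exact (V j).smul_mem _ (hmemV j (hB hj))
  · intro G hG0 hGD
    have h1 := hG G hG0 hGD
    have h2 : (s.filter fun i => eval (ratVec (W i)) G = 0) = s.filter fun i =>
        eval (pointVec (ξ i) (η i) (ratVec a) (ratVec b) (ratVec c)) G = 0 :=
      Finset.filter_congr fun i hi => by rw [hW i hi]
    rw [h2, Nat.le_div_iff_mul_le (by omega)]
    rw [mul_comm]
    omega

theorem Veronese.card_planes_le {ι : Type*} {n D N K m : ℕ} {mon : Fin N → Fin 3 → ℕ}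
    (hV : Veronese D N K m mon) (hD : 1 ≤ D) (hN : 1 ≤ N) {f : MvPolynomial (Fin n) ℚ}
    {s : Finset ι} {pt : ι → Fin n → ℚ} {V : ι → Submodule ℚ (Fin n → ℚ)}
    (h : IsPlaneFamily f s pt V) (hf : Irreducible f) (hd : f.totalDegree ≠ 0) (hncc : IsNCC f)
    (hirr : RIrreducible D (homogeneousComponent f.totalDegree f))
    {ξ η : ι → (Fin n → ℚ) →ₗ[ℚ] ℚ} (hcut : ∀ i ∈ s, ∀ v, v ∈ V i ↔ ξ i v = 0 ∧ η i v = 0)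
    {β : ι → Fin n → Fin n → ℤ} {H R : ℕ} (hβ : ∀ i ∈ s, ∀ k l,
      (β i k l : ℚ) = bracket (ξ i) (η i) (Pi.single k 1) (Pi.single l 1))
    (hβH : ∀ i ∈ s, ∀ k l, |β i k l| ≤ H)
    (hR : R = 4 * (2 * f.totalDegree) ^ N * (D * N)) {P Q : ℕ} (hP : 2 ≤ P)
    (hXP : n ^ 2 * H * R * f.totalDegree ≤ P ^ 4)
    (hXK : N.factorial * (n ^ 6 * H ^ 3 * R ^ 2 * f.totalDegree ^ 2) ^ m < P ^ K) {S : Finset ℕ}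
    (hS : ∀ p ∈ S, p.Prime ∧ P ≤ p ∧ p ≤ Q) (hScard : 128 * f.totalDegree ^ 3 ≤ S.card) :
    s.card ≤ 2 * f.totalDegree ^ 3 + (2 * (24 * D * Q * f.totalDegree ^ 4) +
      4 * (2 * f.totalDegree) ^ N * (N * (4 * f.totalDegree ^ 3 * (D * (N + 1))))) := by
  classical
  set d := f.totalDegree with hdd
  have hd1 : 1 ≤ d := Nat.one_le_iff_ne_zero.mpr hd
  have hf0 : f ≠ 0 := hf.ne_zero
  set F := homogeneousComponent d f with hF
  have hFh : F.IsHomogeneous d := homogeneousComponent_isHomogeneous _ _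
  obtain ⟨a, ha, haR⟩ := exists_grid_eval_ne_zero (homogeneousComponent_totalDegree_ne_zero hf0)
  have haR' : ∀ k, |a k| ≤ (d : ℤ) := fun k =>
    (haR k).trans (by exact_mod_cast hFh.totalDegree_le)
  have hW := ker_dirDeriv_sup_ne_top hncc (ratVec a) (ratVec a)
  rw [Set.pair_eq_singleton] at hW
  obtain ⟨i₁, hi₁⟩ := exists_single_notMem hW
  obtain ⟨b, hb⟩ : ∃ b : Fin n → ℤ, b = Pi.single i₁ 1 := ⟨_, rfl⟩
  rw [← ratVec_single, ← hb] at hi₁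
  have hbR : ∀ k, |b k| ≤ 1 := by
    intro k
    by_cases hk : k = i₁
    · subst hk; simp [hb]
    · simp [hb, hk]
  rw [← Finset.card_filter_add_card_filter_not (s := s)
    (fun i => bracket (ξ i) (η i) (ratVec a) (ratVec b) = 0)]
  refine add_le_add (h.card_bracket_eq_zero_le hf hd hcut ha hi₁) ?_
  have hs' : (s.filter fun i => ¬bracket (ξ i) (η i) (ratVec a) (ratVec b) = 0) ⊆ s :=
    Finset.filter_subset _ _
  have hab : ∀ i ∈ s.filter fun i => ¬bracket (ξ i) (η i) (ratVec a) (ratVec b) = 0,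
      bracket (ξ i) (η i) (ratVec a) (ratVec b) ≠ 0 := fun i hi => (Finset.mem_filter.mp hi).2
  generalize (s.filter fun i => ¬bracket (ξ i) (η i) (ratVec a) (ratVec b) = 0) = s' at hs' hab ⊢
  by_cases hM : s'.card ≤ 2 * (24 * D * Q * d ^ 4)
  · exact hM.trans (Nat.le_add_right _ _)
  rw [not_le] at hM
  refine le_trans ?_ (Nat.le_add_left _ _)
  have hR2 : 2 ≤ R := by
    have h1 : 0 < (2 * d) ^ N := by positivity
    have h2 : 0 < D * N := by positivity
    rw [hR]
    nlinarith [Nat.mul_le_mul h1 h2]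
  obtain ⟨p, hp0, hp1, hp⟩ :=
    exists_poly_vanishing_on (ker_dirDeriv_sup_ne_top hncc (ratVec a) (ratVec b))
  have hgrid : 0 < (grid n R).card := by rw [card_grid]; positivity
  set W := (dirDeriv f).ker ⊔ Submodule.span ℚ {ratVec a, ratVec b}
  have hgood : (grid n R).card ≤ 2 * ((grid n R).filter fun c => c ∉ W).card := by
    have h1 := card_zeros_grid_le hp0 (show 0 < R by omega)
    rw [← card_grid] at h1
    have h2 : ((grid n R).filter fun c => c ∈ W).card ≤
        ((grid n R).filter fun c => eval c p = 0).card :=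
      Finset.card_le_card (Finset.monotone_filter_right _ fun c _ hc => hp c hc)
    have h3 := Finset.card_filter_add_card_filter_not (s := grid n R) (fun c => c ∈ W)
    have h4 := Nat.mul_le_mul_right ((grid n R).filter fun c => eval c p = 0).card hR2
    have h5 := Nat.mul_le_mul_right (grid n R).card hp1
    omega
  have hpp := fun i => exists_pointPoly (ξ i) (η i) (ratVec a) (ratVec b)
  choose pp hpp1 hpp2 using hpp
  let T := Fintype.piFinset fun _ : Fin N => s'
  let Δ : (Fin N → ι) → MvPolynomial (Fin n) ℚ := fun τ => (monMatrix mon fun r => pp (τ r)).det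
  have hTcard : T.card = s'.card ^ N := by simp [T]
  have hΔdeg : ∀ τ, (Δ τ).totalDegree ≤ D * N := fun τ => by
    refine (totalDegree_det_le _ (fun _ => D) fun r j => ?_).trans (by simp [mul_comm])
    exact (totalDegree_monVal_le _ (hpp1 _)).trans (hV.sum_eq j).le
  have hΔeval : ∀ τ c, eval c (Δ τ) = (monMatrix mon fun r => pointVec (ξ (τ r)) (η (τ r))
      (ratVec a) (ratVec b) c).det := fun τ c => by
    rw [det_monMatrix_map]
    exact congrArg (fun w => (monMatrix mon w).det) (funext fun r => hpp2 _ _)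
  have hinc := card_le_of_dense_incidences T (grid n R) ((grid n R).filter fun c => c ∉ W)
    (fun τ c => eval c (Δ τ) = 0) (fun τ => Δ τ = 0) (κ := (2 * d) ^ N)
    (Finset.filter_subset _ _) hgood hgrid ?_ ?_
  · have hbad : T.filter (fun τ => Δ τ = 0) = T.filter fun τ => ¬LinearIndependent
        (FractionRing (MvPolynomial (Fin n) ℚ))
        ((fun i => fracVec fun j => monVal (mon j) (pp i)) ∘ τ) := by
      refine Finset.filter_congr fun τ _ => ?_
      rw [← not_iff_not, not_not]
      exact det_ne_zero_iff_linearIndependent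
    rw [hbad, hTcard] at hinc
    have hli := card_not_linearIndependent_le (K := FractionRing (MvPolynomial (Fin n) ℚ)) s'
      (fun i => fracVec fun j => monVal (mon j) (pp i)) (N := N)
      (m := 4 * d ^ 3 * (D * (N + 1))) ?_ N le_rfl
    · rcases Nat.eq_zero_or_pos s'.card with h0 | h0
      · rw [h0]; exact Nat.zero_le _
      · have h1 : 0 < s'.card ^ N := by positivity
        refine Nat.le_of_mul_le_mul_left ?_ h1
        calc s'.card ^ N * s'.card ≤ _ := Nat.mul_le_mul_right _ hinc
          _ = 4 * (2 * d) ^ N * (s'.card * _) := by rw [mul_assoc, mul_comm s'.card]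
          _ ≤ 4 * (2 * d) ^ N * _ := Nat.mul_le_mul_left _ hli
          _ = _ := by ring
    · intro k hk τ hτ hτli
      refine hV.card_le_of_mem_span (h.mono hs') hf hd hncc hirr ha
        (fun i hi v hv => (hcut i (hs' hi) v).mp hv) hab hpp2 hk
        (fun i j => monVal (mon j) (pp (τ i))) ?_ hτli (Finset.filter_subset _ _)
        fun i hi => (Finset.mem_filter.mp hi).2
      exact fun i j => (totalDegree_monVal_le _ (hpp1 _)).trans (hV.sum_eq j).le
  · intro c hc
    obtain ⟨hcg, hcW⟩ := Finset.mem_filter.mp hc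
    obtain ⟨z, rfl, hz⟩ := exists_ratVec_of_mem_grid hcg
    obtain ⟨G, hG0, hGD, hG⟩ := hV.exists_dense_form hD (h.mono hs') hf hd ha hcW
      (fun i hi => hcut i (hs' hi)) hab (fun i hi => hβ i (hs' hi)) (fun i hi => hβH i (hs' hi))
      haR' hbR (fun k => (hz k).1) (by omega) hP hXP hXK hS hScard hM
    rw [hTcard]
    refine (Nat.pow_le_pow_left hG N).trans ?_
    rw [mul_pow]
    refine Nat.mul_le_mul_left _ ?_
    have h1 : (s'.filter fun i =>
        eval (pointVec (ξ i) (η i) (ratVec a) (ratVec b) (ratVec z)) G = 0).card ^ N =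
        (Fintype.piFinset fun _ : Fin N => s'.filter fun i =>
          eval (pointVec (ξ i) (η i) (ratVec a) (ratVec b) (ratVec z)) G = 0).card := by simp
    rw [h1]
    refine Finset.card_le_card fun τ hτ => ?_
    rw [Fintype.mem_piFinset] at hτ
    refine Finset.mem_filter.mpr ⟨Fintype.mem_piFinset.mpr fun r =>
      (Finset.mem_filter.mp (hτ r)).1, ?_⟩
    rw [hΔeval]
    exact hV.det_eq_zero hGD hG0 _ fun r => (Finset.mem_filter.mp (hτ r)).2
  · intro τ _ hτ
    have h1 := card_zeros_grid_le hτ (show 0 < R by omega)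
    rw [← card_grid] at h1
    have h2 := h1.trans (Nat.mul_le_mul_right _ (hΔdeg τ))
    have h3 : 0 < D * N := by positivity
    refine Nat.le_of_mul_le_mul_left ?_ h3
    refine le_trans (le_of_eq ?_) h2
    rw [hR]
    ring

/-- Coordinates on `ℚⁿ / V` for which the image of `ℤⁿ` is `ℤ²`. -/
structure IsPlaneCoords {n : ℕ} (V : Submodule ℚ (Fin n → ℚ))
    (π : (Fin n → ℤ) →ₗ[ℤ] (Fin 2 → ℤ)) (ξ η : (Fin n → ℚ) →ₗ[ℚ] ℚ) : Prop where
  surjective : Function.Surjective π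
  apply_zero : ∀ x, (π x 0 : ℚ) = ξ (ratVec x)
  apply_one : ∀ x, (π x 1 : ℚ) = η (ratVec x)
  mem_iff : ∀ v, v ∈ V ↔ ξ v = 0 ∧ η v = 0

theorem exists_smul_eq_ratVec {n : ℕ} (v : Fin n → ℚ) :
    ∃ (N : ℤ) (z : Fin n → ℤ), N ≠ 0 ∧ ratVec z = (N : ℚ) • v := by
  classical
  obtain ⟨b, hb⟩ := IsLocalization.exist_integer_multiples_of_finset (nonZeroDivisors ℤ)
    (Finset.univ.image v)
  choose z hz using fun i => hb (v i) (Finset.mem_image_of_mem v (Finset.mem_univ i))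
  refine ⟨b, z, nonZeroDivisors.coe_ne_zero b, funext fun i => ?_⟩
  have h1 := hz i
  rw [zsmul_eq_mul] at h1
  exact h1

theorem ratVec_eq_sum {n m : ℕ} (π : (Fin n → ℤ) →ₗ[ℤ] (Fin m → ℤ)) (x : Fin n → ℤ) :
    (π.toMatrix'.map (Int.castRingHom ℚ)).mulVecLin (ratVec x) = ratVec (π x) := by
  ext i
  conv_rhs => rw [← LinearMap.toMatrix'_mulVec π x]
  simp [ratVec, Matrix.mulVec, dotProduct]

theorem exists_isPlaneCoords {n : ℕ} (V : Submodule ℚ (Fin n → ℚ))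
    (hV : Module.finrank ℚ V + 2 = n) : ∃ π ξ η, IsPlaneCoords V π ξ η := by
  let Λ : Submodule ℤ (Fin n → ℤ) :=
    (V.restrictScalars ℤ).comap ((Algebra.linearMap ℤ ℚ).compLeft (Fin n))
  have hΛ : ∀ x, x ∈ Λ ↔ ratVec x ∈ V := fun x => Iff.rfl
  have htf : Module.IsTorsionFree ℤ ((Fin n → ℤ) ⧸ Λ) := by
    refine Module.isTorsionFree_iff_smul_eq_zero.mpr fun r q hq => ?_
    obtain ⟨x, rfl⟩ := Submodule.Quotient.mk_surjective _ q
    rw [← Submodule.Quotient.mk_smul, Submodule.Quotient.mk_eq_zero, hΛ] at hq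
    rw [Submodule.Quotient.mk_eq_zero, hΛ]
    refine or_iff_not_imp_left.mpr fun hr => ?_
    have h1 : ratVec (r • x) = (r : ℚ) • ratVec x := by
      ext i
      simp [ratVec]
    rw [h1] at hq
    exact (V.smul_mem_iff (Int.cast_ne_zero.mpr hr)).mp hq
  obtain ⟨r, hr⟩ : ∃ r, Module.finrank ℤ ((Fin n → ℤ) ⧸ Λ) = r := ⟨_, rfl⟩
  let bas := Module.finBasisOfFinrankEq ℤ _ hr
  let π : (Fin n → ℤ) →ₗ[ℤ] (Fin r → ℤ) := bas.equivFun.toLinearMap ∘ₗ Λ.mkQ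
  have hπs : Function.Surjective π := bas.equivFun.surjective.comp Λ.mkQ_surjective
  have hπk : ∀ x, π x = 0 ↔ ratVec x ∈ V := by
    intro x
    rw [← hΛ, ← Submodule.Quotient.mk_eq_zero]
    exact bas.equivFun.map_eq_zero_iff
  let Φ := (π.toMatrix'.map (Int.castRingHom ℚ)).mulVecLin
  have hΦ : ∀ x, Φ (ratVec x) = ratVec (π x) := ratVec_eq_sum π
  have hΦk : Φ.ker = V := by
    ext v
    obtain ⟨N, z, hN, hz⟩ := exists_smul_eq_ratVec v
    have hN' : (N : ℚ) ≠ 0 := Int.cast_ne_zero.mpr hN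
    rw [LinearMap.mem_ker, ← V.smul_mem_iff hN', ← hz, ← hπk]
    have h1 : (N : ℚ) • Φ v = ratVec (π z) := by rw [← map_smul, ← hz, hΦ]
    rw [← smul_eq_zero_iff_right hN', h1]
    constructor
    · intro h
      by_contra h2
      exact ratVec_ne_zero h2 h
    · intro h
      rw [h]
      ext i
      simp [ratVec]
  have hΦs : Function.Surjective Φ := by
    intro y
    obtain ⟨N, z, hN, hz⟩ := exists_smul_eq_ratVec y
    have hN' : (N : ℚ) ≠ 0 := Int.cast_ne_zero.mpr hN
    obtain ⟨x, rfl⟩ := hπs z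
    refine ⟨(N : ℚ)⁻¹ • ratVec x, ?_⟩
    rw [map_smul, hΦ, hz, inv_smul_smul₀ hN']
  have hr2 : r = 2 := by
    have h1 := Φ.finrank_range_add_finrank_ker
    rw [LinearMap.range_eq_top.mpr hΦs, finrank_top, hΦk, Module.finrank_fin_fun,
      Module.finrank_fin_fun] at h1
    omega
  clear_value bas
  subst hr2
  refine ⟨π, LinearMap.proj 0 ∘ₗ Φ, LinearMap.proj 1 ∘ₗ Φ, hπs, fun x => ?_, fun x => ?_,
    fun v => ?_⟩
  · exact (congrFun (hΦ x) 0).symm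
  · exact (congrFun (hΦ x) 1).symm
  · rw [← hΦk, LinearMap.mem_ker, funext_iff, Fin.forall_fin_two]
    rfl

/-- The Plücker coordinates of a plane. -/
def pluecker {n : ℕ} (π : (Fin n → ℤ) →ₗ[ℤ] (Fin 2 → ℤ)) (k l : Fin n) : ℤ :=
  π (Pi.single k 1) 0 * π (Pi.single l 1) 1 - π (Pi.single l 1) 0 * π (Pi.single k 1) 1

theorem IsPlaneCoords.pluecker_eq {n : ℕ} {V : Submodule ℚ (Fin n → ℚ)} {π ξ η}
    (h : IsPlaneCoords V π ξ η) (k l : Fin n) :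
    (pluecker π k l : ℚ) = bracket ξ η (Pi.single k 1) (Pi.single l 1) := by
  simp only [pluecker, bracket, ← ratVec_single]
  push_cast
  rw [h.apply_zero, h.apply_zero, h.apply_one, h.apply_one]

theorem IsPlaneCoords.mem_iff_pluecker {n : ℕ} {V : Submodule ℚ (Fin n → ℚ)} {π ξ η}
    (h : IsPlaneCoords V π ξ η) (v : Fin n → ℚ) :
    v ∈ V ↔ ∀ k, ∑ l, v l * pluecker π l k = 0 := by
  have key : ∀ k, ∑ l, v l * pluecker π l k = bracket ξ η v (Pi.single k 1) := by
    intro k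
    rw [bracket, apply_eq_sum_single ξ v, apply_eq_sum_single η v, Finset.sum_mul,
      Finset.mul_sum, ← Finset.sum_sub_distrib]
    refine Finset.sum_congr rfl fun l _ => ?_
    rw [h.pluecker_eq, bracket]
    ring
  simp only [key]
  constructor
  · intro hv k
    obtain ⟨h1, h2⟩ := (h.mem_iff v).mp hv
    rw [bracket, h1, h2, zero_mul, mul_zero, sub_zero]
  · intro hv
    have h1 : ∀ y, ξ v * η y - ξ y * η v = 0 := by
      have h2 : (ξ v • η - η v • ξ) = 0 := by
        refine LinearMap.pi_ext' fun k => LinearMap.ext_ring ?_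
        have := hv k
        rw [bracket] at this
        simp only [LinearMap.coe_comp, LinearMap.coe_single, Function.comp_apply,
          LinearMap.sub_apply, LinearMap.smul_apply, smul_eq_mul, LinearMap.zero_apply]
        linear_combination this
      intro y
      have := LinearMap.congr_fun h2 y
      simp only [LinearMap.sub_apply, LinearMap.smul_apply, smul_eq_mul,
        LinearMap.zero_apply] at this
      linear_combination this
    obtain ⟨x₀, hx₀⟩ := h.surjective (Pi.single 0 1)
    obtain ⟨x₁, hx₁⟩ := h.surjective (Pi.single 1 1)
    have e0 := h.apply_zero x₀
    have e1 := h.apply_one x₀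
    have e2 := h.apply_zero x₁
    have e3 := h.apply_one x₁
    rw [hx₀] at e0 e1
    rw [hx₁] at e2 e3
    simp at e0 e1 e2 e3
    refine (h.mem_iff v).mpr ⟨?_, ?_⟩
    · have := h1 (ratVec x₁)
      rwa [← e2, ← e3, mul_one, zero_mul, sub_zero] at this
    · have := h1 (ratVec x₀)
      rwa [← e0, ← e1, mul_zero, one_mul, zero_sub, neg_eq_zero] at this

/-- Integral points of `[0, B]ⁿ` reach many elements of a finite quotient of `ℤⁿ`. -/
theorem exists_transversal_in_box {n : ℕ} {G : Type*} [AddCommGroup G] [Finite G]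
    (ψ : (Fin n → ℤ) →+ G) (hψ : Function.Surjective ψ) (B : ℕ) :
    ∃ T : Finset (Fin n → ℤ), (∀ t ∈ T, ∀ k, 0 ≤ t k ∧ t k ≤ B) ∧ Set.InjOn ψ T ∧
      min (Nat.card G) (B + 1) ≤ T.card := by
  classical
  let box : ℕ → Finset (Fin n → ℤ) := fun j => Fintype.piFinset fun _ => Finset.Icc 0 (j : ℤ)
  have hbox : ∀ j x, x ∈ box j ↔ ∀ k, 0 ≤ x k ∧ x k ≤ j := fun j x => by simp [box]
  have hgrow : ∀ j, min (Nat.card G) (j + 1) ≤ ((box j).image ψ).card := by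
    intro j
    induction j with
    | zero =>
      refine (min_le_right _ _).trans (Finset.card_pos.mpr ⟨ψ 0, Finset.mem_image_of_mem _ ?_⟩)
      exact (hbox _ _).mpr fun k => by simp
    | succ j ih =>
      have hsub : (box j).image ψ ⊆ (box (j + 1)).image ψ := by
        refine Finset.image_subset_image fun x hx => (hbox _ _).mpr fun k => ?_
        obtain ⟨h1, h2⟩ := (hbox _ _).mp hx k
        exact ⟨h1, by push_cast; omega⟩
      by_cases heq : (box (j + 1)).image ψ ⊆ (box j).image ψ
      · refine (min_le_left _ _).trans (le_trans ?_ (Finset.card_le_card hsub))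
        let X : AddSubmonoid (Fin n → ℤ) :=
          { carrier := {x | ∀ y ∈ (box j).image ψ, y + ψ x ∈ (box j).image ψ}
            zero_mem' := fun y hy => by simpa using hy
            add_mem' := fun {a b} ha hb y hy => by
              rw [map_add, ← add_assoc]
              exact hb _ (ha _ hy) }
        have hX1 : ∀ k, Pi.single k 1 ∈ X := by
          intro k y hy
          obtain ⟨x, hx, rfl⟩ := Finset.mem_image.mp hy
          rw [← map_add]
          refine heq (Finset.mem_image_of_mem _ ((hbox _ _).mpr fun l => ?_))
          obtain ⟨h1, h2⟩ := (hbox _ _).mp hx l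
          by_cases hl : l = k
          · subst hl
            simp
            omega
          · simp [hl]
            omega
        have huniv : ∀ g : G, g ∈ (box j).image ψ := by
          intro g
          obtain ⟨x, rfl⟩ := hψ g
          have hm : (Nat.card G : ℤ) ≠ 0 := by exact_mod_cast Nat.card_pos.ne'
          have h1 : ψ x = ψ fun k => x k % (Nat.card G : ℤ) := by
            have h2 : x = Nat.card G • (fun k => x k / (Nat.card G : ℤ)) +
                fun k => x k % (Nat.card G : ℤ) := by
              ext k
              simp [Int.mul_ediv_add_emod]
            conv_lhs => rw [h2, map_add, map_nsmul, card_nsmul_eq_zero', zero_add]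
          have h3 : (fun k => x k % (Nat.card G : ℤ)) ∈ X := by
            rw [← Finset.univ_sum_single (fun k => x k % (Nat.card G : ℤ))]
            refine X.sum_mem fun k _ => ?_
            obtain ⟨m, hm'⟩ := Int.eq_ofNat_of_zero_le (Int.emod_nonneg (x k) hm)
            rw [hm', show Pi.single k (m : ℤ) = m • (Pi.single k 1 : Fin n → ℤ) by
              rw [← Pi.single_smul]; simp]
            exact X.nsmul_mem (hX1 k) m
          have h4 := h3 (ψ 0) (Finset.mem_image_of_mem _ ((hbox _ _).mpr fun k => by simp))
          rw [map_zero, zero_add, ← h1] at h4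
          exact h4
        have := Fintype.ofFinite G
        rw [Nat.card_eq_fintype_card, ← Finset.card_univ]
        exact Finset.card_le_card fun g _ => huniv g
      · have h1 : (box j).image ψ ⊂ (box (j + 1)).image ψ := ⟨hsub, heq⟩
        have h2 := Finset.card_lt_card h1
        omega
  obtain ⟨T, hT, hinj, himg⟩ := Finset.exists_subset_injOn_image_eq_of_surjOn
    (box B : Set (Fin n → ℤ)) ((box B).image ψ) (f := ψ) (by
      rw [Finset.coe_image]; exact Set.surjOn_image _ _)
  refine ⟨T, fun t ht => (hbox _ _).mp (hT ht), hinj, ?_⟩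
  rw [← Finset.card_image_of_injOn hinj, himg]
  exact hgrow B

theorem card_quotient_span_pair {u v : Fin 2 → ℤ} (h : u 0 * v 1 - v 0 * u 1 ≠ 0) :
    Nat.card ((Fin 2 → ℤ) ⧸ Submodule.span ℤ (Set.range ![u, v])) =
      (u 0 * v 1 - v 0 * u 1).natAbs := by
  have hdet : (Matrix.of ![u, v]).det = u 0 * v 1 - v 0 * u 1 := by
    rw [Matrix.det_fin_two]
    simp
    ring
  have hli : LinearIndependent ℤ ![u, v] :=
    Matrix.linearIndependent_rows_of_det_ne_zero (A := Matrix.of ![u, v]) (hdet ▸ h)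
  rw [← Submodule.natAbs_det_basis_change (Pi.basisFun ℤ (Fin 2)) _ (Module.Basis.span hli), ← hdet,
    Pi.basisFun_det]
  have hval : (Subtype.val ∘ ⇑(Module.Basis.span hli)) = ![u, v] :=
    _root_.funext fun i => congrArg Subtype.val (Module.Basis.span_apply hli i)
  rw [hval]
  rfl

theorem card_integral_points_le {n B : ℕ} (π : (Fin n → ℤ) →ₗ[ℤ] (Fin 2 → ℤ))
    (hπ : Function.Surjective π) {S : Finset (Fin n → ℤ)} (hS : ∀ x ∈ S, ∀ k, |x k| ≤ (B : ℤ))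
    (hSπ : ∀ x ∈ S, ∀ y ∈ S, π x = π y) {k₀ l₀ : Fin n} (h : pluecker π k₀ l₀ ≠ 0) :
    S.card * min (pluecker π k₀ l₀).natAbs (B + 1) ≤ (3 * B + 1) ^ (n - 2) := by
  classical
  have hkl : k₀ ≠ l₀ := by
    rintro rfl
    exact h (by rw [pluecker]; ring)
  set u := π (Pi.single k₀ 1) with hu
  set v := π (Pi.single l₀ 1) with hv
  set N := Submodule.span ℤ (Set.range ![u, v]) with hN
  have hcard : Nat.card ((Fin 2 → ℤ) ⧸ N) = (pluecker π k₀ l₀).natAbs :=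
    card_quotient_span_pair h
  have : Finite ((Fin 2 → ℤ) ⧸ N) := Nat.finite_of_card_ne_zero (by
    rw [hcard]; exact Int.natAbs_ne_zero.mpr h)
  obtain ⟨T, hT, hTinj, hTcard⟩ := exists_transversal_in_box
    (N.mkQ ∘ₗ π).toAddMonoidHom (N.mkQ_surjective.comp hπ) B
  rw [hcard] at hTcard
  refine (Nat.mul_le_mul_left _ hTcard).trans ?_
  rw [← Finset.card_product]
  let J := {k : Fin n // k ≠ k₀ ∧ k ≠ l₀}
  have hJ : Fintype.card J = n - 2 := by
    have h1 : Fintype.card J = (Finset.univ \ {k₀, l₀} : Finset (Fin n)).card := by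
      refine Fintype.card_of_subtype _ fun k => ?_
      simp [not_or]
    rw [h1, Finset.card_sdiff_of_subset (Finset.subset_univ _), Finset.card_pair hkl]
    simp
  have htarget : (Fintype.piFinset fun _ : J => Finset.Icc (-(B : ℤ)) (2 * B)).card =
      (3 * B + 1) ^ (n - 2) := by
    rw [Fintype.card_piFinset, Finset.prod_const, Finset.card_univ, hJ, Int.card_Icc]
    congr 1
    omega
  rw [← htarget]
  refine Finset.card_le_card_of_injOn (fun p k => p.1 k.1 + p.2 k.1) ?_ ?_
  · rintro ⟨x, t⟩ hp
    obtain ⟨hx, ht⟩ := Finset.mem_product.mp hp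
    refine Fintype.mem_piFinset.mpr fun k => Finset.mem_Icc.mpr ?_
    have h1 := abs_le.mp (hS x hx k.1)
    have h2 := hT t ht k.1
    constructor <;> simp only <;> omega
  · rintro ⟨x, t⟩ hp ⟨y, t'⟩ hp' hEq
    obtain ⟨hx, ht⟩ := Finset.mem_product.mp hp
    obtain ⟨hy, ht'⟩ := Finset.mem_product.mp hp'
    set z := x + t - (y + t') with hz
    have hz0 : ∀ k, k ≠ k₀ → k ≠ l₀ → z k = 0 := fun k h1 h2 => by
      have h3 := congrFun hEq ⟨k, h1, h2⟩
      simp only at h3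
      simp only [hz, Pi.sub_apply, Pi.add_apply]
      omega
    have hzs : z = z k₀ • Pi.single k₀ 1 + z l₀ • Pi.single l₀ 1 := by
      ext k
      by_cases h1 : k = k₀
      · subst h1; simp [hkl]
      · by_cases h2 : k = l₀
        · subst h2; simp [h1]
        · simp [h1, h2, hz0 k h1 h2]
    have hπz : π z = z k₀ • u + z l₀ • v := by
      conv_lhs => rw [hzs, map_add, map_smul, map_smul]
    have hπt : π z = π t - π t' := by
      rw [hz, map_sub, map_add, map_add, hSπ x hx y hy]
      abel
    have htt : t = t' := by
      refine hTinj ht ht' ?_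
      change N.mkQ (π t) = N.mkQ (π t')
      rw [← sub_eq_zero, ← map_sub, ← hπt, hπz, Submodule.mkQ_apply, Submodule.Quotient.mk_eq_zero]
      exact N.add_mem (N.smul_mem _ (Submodule.subset_span ⟨0, rfl⟩))
        (N.smul_mem _ (Submodule.subset_span ⟨1, rfl⟩))
    subst htt
    rw [sub_self, hπz] at hπt
    have e0 := congrFun hπt 0
    have e1 := congrFun hπt 1
    simp only [Pi.add_apply, Pi.smul_apply, smul_eq_mul, Pi.zero_apply] at e0 e1
    have h' : u 0 * v 1 - v 0 * u 1 ≠ 0 := h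
    have hk : z k₀ = 0 := by
      refine (mul_eq_zero.mp (?_ : z k₀ * (u 0 * v 1 - v 0 * u 1) = 0)).resolve_right h'
      linear_combination v 1 * e0 - v 0 * e1
    have hl : z l₀ = 0 := by
      refine (mul_eq_zero.mp (?_ : z l₀ * (u 0 * v 1 - v 0 * u 1) = 0)).resolve_right h'
      linear_combination u 0 * e1 - u 1 * e0
    have hxy : x = y := by
      rw [hk, hl, zero_smul, zero_smul, add_zero] at hzs
      rw [hzs] at hz
      have h5 : x + t = y + t := (sub_eq_zero.mp hz.symm)
      exact add_right_cancel h5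
    rw [hxy]

/-- A Chebyshev-type lower bound for the number of primes in `[P, A P]`. -/
theorem exists_le_card_primes_mul_log :
    ∃ A : ℕ, 1 ≤ A ∧ ∀ P : ℕ, 1 ≤ P →
      (P : ℝ) ≤ ((Finset.Icc P (A * P)).filter Nat.Prime).card * Real.log (A * P) := by
  obtain ⟨C, hC⟩ := Chebyshev.psi_sub_theta_le_mul_sqrt
  obtain ⟨m, hm⟩ := exists_nat_ge (2 * (|C| + 4 + Real.log 4 + 1))
  have hl4 : 0 < Real.log 4 := Real.log_pos (by norm_num)
  have hl2 : 1 / 2 ≤ Real.log 2 := by linarith [Real.log_two_gt_d9]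
  have hm1 : (1 : ℝ) ≤ m := by linarith [abs_nonneg C]
  refine ⟨m ^ 2, ?_, fun P hP => ?_⟩
  · exact Nat.one_le_pow _ _ (by exact_mod_cast hm1)
  have hP' : (1 : ℝ) ≤ P := by exact_mod_cast hP
  have hPs : √(P : ℝ) ≤ P := by
    rw [Real.sqrt_le_left (by linarith)]
    nlinarith
  set n : ℕ := m ^ 2 * P with hn
  have hnr : (n : ℝ) = m ^ 2 * P := by rw [hn]; push_cast; ring
  have hn1 : (1 : ℝ) ≤ n := by rw [hnr]; nlinarith [sq_nonneg ((m : ℝ) - 1)]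
  have hsq : √(n : ℝ) = m * √(P : ℝ) := by
    rw [hnr, Real.sqrt_mul (by positivity), Real.sqrt_sq (by positivity)]
  have hsq1 : √(n : ℝ) ≤ m * P := by
    rw [hsq]
    exact mul_le_mul_of_nonneg_left hPs (by positivity)
  have hlog : Real.log (n + 1) ≤ 4 * √(n : ℝ) := by
    have h1 : Real.log (√(n + 1 : ℝ)) ≤ √(n + 1 : ℝ) :=
      Real.log_le_self (Real.sqrt_nonneg _)
    rw [Real.log_sqrt (by positivity)] at h1
    have h2 : √(n + 1 : ℝ) ≤ 2 * √(n : ℝ) := by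
      rw [Real.sqrt_le_left (by positivity), mul_pow, Real.sq_sqrt (by positivity)]
      linarith
    linarith
  have h1 := Chebyshev.psi_ge n
  have h2 := hC n
  have h3 : C * √(n : ℝ) ≤ |C| * (m * P) :=
    (mul_le_mul_of_nonneg_right (le_abs_self C) (Real.sqrt_nonneg _)).trans
      (mul_le_mul_of_nonneg_left hsq1 (abs_nonneg C))
  have h4 : Chebyshev.theta P ≤ Real.log 4 * P := Chebyshev.theta_le_log4_mul_x (by positivity)
  have h5 : (P : ℝ) ≤ Chebyshev.theta n - Chebyshev.theta P := by
    have h6 : (n : ℝ) * Real.log 2 ≥ m * P * (|C| + 4 + Real.log 4 + 1) := by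
      rw [hnr]
      have : (m : ℝ) * Real.log 2 ≥ |C| + 4 + Real.log 4 + 1 := by nlinarith
      have h7 := mul_le_mul_of_nonneg_left this (by positivity : (0 : ℝ) ≤ m * P)
      linarith
    have h8 : Real.log 4 * P ≤ m * P * Real.log 4 := by
      have := mul_le_mul_of_nonneg_right hm1 (by positivity : 0 ≤ P * Real.log 4)
      linarith
    have h9 : (P : ℝ) ≤ m * P := by nlinarith
    nlinarith
  refine h5.trans ?_
  have hPn : P ≤ n := by
    rw [hn]
    exact Nat.le_mul_of_pos_left _ (pow_pos (by exact_mod_cast hm1) 2)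
  have hsplit : Chebyshev.theta n - Chebyshev.theta P ≤
      ∑ p ∈ (Finset.Icc P n).filter Nat.Prime, Real.log p := by
    rw [Chebyshev.theta_eq_sum_Icc, Chebyshev.theta_eq_sum_Icc,
      Nat.floor_natCast, Nat.floor_natCast,
      sub_le_iff_le_add]
    refine (Finset.sum_le_sum_of_subset_of_nonneg (t := (Finset.Icc P n).filter Nat.Prime ∪
      (Finset.Icc 0 P).filter Nat.Prime) ?_ ?_).trans ?_
    · intro p hp
      simp only [Finset.mem_union, Finset.mem_filter, Finset.mem_Icc] at hp ⊢
      by_cases h : p ≤ P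
      · exact Or.inr ⟨⟨hp.1.1, h⟩, hp.2⟩
      · exact Or.inl ⟨⟨by omega, hp.1.2⟩, hp.2⟩
    · exact fun p _ _ => Real.log_natCast_nonneg p
    · rw [← Finset.sum_union_inter]
      exact le_add_of_nonneg_right (Finset.sum_nonneg fun p _ => Real.log_natCast_nonneg p)
  refine hsplit.trans ?_
  rw [← nsmul_eq_mul]
  refine Finset.sum_le_card_nsmul _ _ _ fun p hp => ?_
  obtain ⟨hp1, hp2⟩ := Finset.mem_filter.mp hp
  rw [show ((m ^ 2 : ℕ) : ℝ) * P = (n : ℝ) by rw [hnr]; push_cast; ring]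
  exact Real.log_le_log (by exact_mod_cast hp2.pos)
    (by exact_mod_cast (Finset.mem_Icc.mp hp1).2)

/-- The maximum of the absolute values of the Plücker coordinates. -/
def plueckerHeight {n : ℕ} (π : (Fin n → ℤ) →ₗ[ℤ] (Fin 2 → ℤ)) : ℕ :=
  Finset.univ.sup fun p : Fin n × Fin n => (pluecker π p.1 p.2).natAbs

theorem natAbs_pluecker_le {n : ℕ} (π : (Fin n → ℤ) →ₗ[ℤ] (Fin 2 → ℤ)) (k l : Fin n) :
    (pluecker π k l).natAbs ≤ plueckerHeight π :=
  Finset.le_sup (f := fun p : Fin n × Fin n => (pluecker π p.1 p.2).natAbs) (Finset.mem_univ (k, l))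

theorem abs_pluecker_le {n : ℕ} (π : (Fin n → ℤ) →ₗ[ℤ] (Fin 2 → ℤ)) (k l : Fin n) :
    |pluecker π k l| ≤ (plueckerHeight π : ℤ) := by
  rw [Int.abs_eq_natAbs]
  exact_mod_cast natAbs_pluecker_le π k l

theorem exists_pluecker_ne_zero {n : ℕ} {π : (Fin n → ℤ) →ₗ[ℤ] (Fin 2 → ℤ)}
    (hπ : Function.Surjective π) : ∃ k l, pluecker π k l ≠ 0 := by
  by_contra! h
  obtain ⟨x, hx⟩ := hπ ![1, 0]
  obtain ⟨y, hy⟩ := hπ ![0, 1]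
  have key : ∀ x : Fin n → ℤ, ∀ j, π x j = ∑ k, x k * π (Pi.single k 1) j := fun x j => by
    conv_lhs => rw [← Finset.univ_sum_single x, map_sum, Finset.sum_apply]
    refine Finset.sum_congr rfl fun k _ => ?_
    rw [show Pi.single k (x k) = x k • (Pi.single k 1 : Fin n → ℤ) by rw [← Pi.single_smul]; simp,
      map_smul, Pi.smul_apply, smul_eq_mul]
  have h1 : π x 0 * π y 1 - π y 0 * π x 1 = ∑ k, ∑ l, x k * y l * pluecker π k l := by
    rw [key x 0, key y 1, key y 0, key x 1, Finset.sum_mul_sum, mul_comm (∑ k, y k * _),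
      Finset.sum_mul_sum, ← Finset.sum_sub_distrib]
    refine Finset.sum_congr rfl fun k _ => ?_
    rw [← Finset.sum_sub_distrib]
    refine Finset.sum_congr rfl fun l _ => ?_
    rw [pluecker]
    ring
  rw [hx, hy] at h1
  simp [h] at h1

theorem exists_natAbs_pluecker_eq_height {n : ℕ} {π : (Fin n → ℤ) →ₗ[ℤ] (Fin 2 → ℤ)}
    (hπ : Function.Surjective π) :
    ∃ k l, pluecker π k l ≠ 0 ∧ (pluecker π k l).natAbs = plueckerHeight π := by
  obtain ⟨k₀, l₀, h0⟩ := exists_pluecker_ne_zero hπ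
  obtain ⟨⟨k, l⟩, -, h⟩ := Finset.exists_mem_eq_sup Finset.univ ⟨(k₀, l₀), Finset.mem_univ _⟩
    fun p : Fin n × Fin n => (pluecker π p.1 p.2).natAbs
  refine ⟨k, l, fun hz => ?_, h.symm⟩
  have h1 := natAbs_pluecker_le π k₀ l₀
  rw [plueckerHeight, h] at h1
  simp [hz] at h1
  exact h0 h1

theorem plueckerHeight_pos {n : ℕ} {π : (Fin n → ℤ) →ₗ[ℤ] (Fin 2 → ℤ)}
    (hπ : Function.Surjective π) : 0 < plueckerHeight π := by
  obtain ⟨k, l, h, h'⟩ := exists_natAbs_pluecker_eq_height hπ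
  rw [← h']
  exact Int.natAbs_pos.mpr h

/-- A family of `(n-2)`-planes in the zero set of `f`, of height at most `H`. -/
structure IsBoundedFamily {n : ℕ} {ι : Type*} (f : MvPolynomial (Fin n) ℚ) (s : Finset ι)
    (a : ι → Fin n → ℚ) (V : ι → Submodule ℚ (Fin n → ℚ))
    (π : ι → (Fin n → ℤ) →ₗ[ℤ] (Fin 2 → ℤ)) (ξ η : ι → (Fin n → ℚ) →ₗ[ℚ] ℚ) (H : ℕ) : Prop where
  planes : IsPlaneFamily f s a V
  coords : ∀ i ∈ s, IsPlaneCoords (V i) (π i) (ξ i) (η i)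
  height_le : ∀ i ∈ s, plueckerHeight (π i) ≤ H

namespace IsBoundedFamily

variable {n : ℕ} {ι : Type*} {f : MvPolynomial (Fin n) ℚ} {s : Finset ι}
    {a : ι → Fin n → ℚ} {V : ι → Submodule ℚ (Fin n → ℚ)}
    {π : ι → (Fin n → ℤ) →ₗ[ℤ] (Fin 2 → ℤ)} {ξ η : ι → (Fin n → ℚ) →ₗ[ℚ] ℚ} {H : ℕ}

theorem card_le (h : IsBoundedFamily f s a V π ξ η H) (hf : Irreducible f)
    (hd : f.totalDegree ≠ 0) (hncc : IsNCC f) :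
    s.card ≤ 2 * f.totalDegree ^ 2 * (2 * H + 1) ^ n ^ 2 := by
  classical
  let μ : ι → Fin n × Fin n → ℤ := fun i p => pluecker (π i) p.1 p.2
  have hμ : s.image μ ⊆ Fintype.piFinset fun _ => Finset.Icc (-(H : ℤ)) H := by
    intro m hm
    obtain ⟨i, hi, rfl⟩ := Finset.mem_image.mp hm
    refine Fintype.mem_piFinset.mpr fun p => Finset.mem_Icc.mpr (abs_le.mp ?_)
    exact (abs_pluecker_le (π i) p.1 p.2).trans (by exact_mod_cast h.height_le i hi)
  have hcard := Finset.card_le_card hμ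
  rw [Fintype.card_piFinset, Finset.prod_const, Finset.card_univ, Fintype.card_prod,
    Fintype.card_fin, ← sq, Int.card_Icc, show (H + 1 - -H : ℤ).toNat = 2 * H + 1 by omega] at hcard
  refine (Finset.card_le_mul_card_image s (2 * f.totalDegree ^ 2) fun m hm => ?_).trans
    (Nat.mul_le_mul_left _ hcard)
  obtain ⟨i, hi, rfl⟩ := Finset.mem_image.mp hm
  refine (h.planes.mono (Finset.filter_subset _ s)).card_le_of_eq hf hd hncc (V i) fun j hj => ?_
  obtain ⟨hj, hji⟩ := Finset.mem_filter.mp hj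
  ext v
  rw [(h.coords j hj).mem_iff_pluecker, (h.coords i hi).mem_iff_pluecker]
  exact forall_congr' fun k => by
    rw [Finset.sum_congr rfl fun l _ => by rw [show pluecker (π j) l k = pluecker (π i) l k from
      congrFun hji (l, k)]]

end IsBoundedFamily

/-- The bound of `Veronese.card_planes_le`, with the primes supplied by Chebyshev's estimate. -/
theorem exists_card_le_of_log_le : ∃ A : ℕ, 1 ≤ A ∧
    ∀ {n : ℕ} {ι : Type} {f : MvPolynomial (Fin n) ℚ} {s : Finset ι}
    {a : ι → Fin n → ℚ} {V : ι → Submodule ℚ (Fin n → ℚ)}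
    {π : ι → (Fin n → ℤ) →ₗ[ℤ] (Fin 2 → ℤ)} {ξ η : ι → (Fin n → ℚ) →ₗ[ℚ] ℚ} {H : ℕ}
    {D N K m P : ℕ} {mon : Fin N → Fin 3 → ℕ},
    Veronese D N K m mon → 1 ≤ D → 1 ≤ N → IsBoundedFamily f s a V π ξ η H →
    Irreducible f → f.totalDegree ≠ 0 → IsNCC f →
    RIrreducible D (homogeneousComponent f.totalDegree f) → 2 ≤ P →
    n ^ 2 * H * (4 * (2 * f.totalDegree) ^ N * (D * N)) * f.totalDegree ≤ P ^ 4 →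
    N.factorial * (n ^ 6 * H ^ 3 * (4 * (2 * f.totalDegree) ^ N * (D * N)) ^ 2 *
      f.totalDegree ^ 2) ^ m < P ^ K →
    128 * (f.totalDegree : ℝ) ^ 3 * Real.log (A * P) ≤ P →
    s.card ≤ 2 * f.totalDegree ^ 3 + (2 * (24 * D * (A * P) * f.totalDegree ^ 4) +
      4 * (2 * f.totalDegree) ^ N * (N * (4 * f.totalDegree ^ 3 * (D * (N + 1))))) := by
  obtain ⟨A, hA, hprimes⟩ := exists_le_card_primes_mul_log
  refine ⟨A, hA, ?_⟩
  intro n ι f s a V π ξ η H D N K m P mon hV hD hN h hf hd hncc hirr hP hXP hXK hlog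
  refine hV.card_planes_le (S := (Finset.Icc P (A * P)).filter Nat.Prime)
    (β := fun i => pluecker (π i)) hD hN h.planes hf hd hncc hirr
    (fun i hi v => (h.coords i hi).mem_iff v) (fun i hi k l => (h.coords i hi).pluecker_eq k l)
    (fun i hi k l => (abs_pluecker_le (π i) k l).trans (by exact_mod_cast h.height_le i hi))
    rfl hP hXP hXK (fun p hp => ?_) ?_
  · obtain ⟨h1, h2⟩ := Finset.mem_filter.mp hp
    exact ⟨h2, Finset.mem_Icc.mp h1⟩
  · have h1 := hprimes P (by omega)
    have h2 : 0 < Real.log (A * P) := Real.log_pos (by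
      have : 1 * 2 ≤ A * P := Nat.mul_le_mul hA hP
      exact_mod_cast this)
    have h3 := le_of_mul_le_mul_right (hlog.trans h1) h2
    exact_mod_cast h3

theorem exists_log_add_le (K : ℝ) (A₁ : ℕ) :
    ∃ A : ℕ, A₁ ≤ A ∧ 1 ≤ A ∧ 128 * (K + Real.log A) ≤ A := by
  obtain ⟨m, hm⟩ := exists_nat_ge (512 + |K| + A₁)
  have hK := abs_nonneg K
  have hA : (0 : ℝ) ≤ A₁ := by positivity
  have hm0 : (512 : ℝ) ≤ m := by linarith
  have hmm : (m : ℝ) ≤ m ^ 2 := by nlinarith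
  refine ⟨m ^ 2, ?_, ?_, ?_⟩
  · have : (A₁ : ℝ) ≤ (m ^ 2 : ℕ) := by push_cast; linarith
    exact_mod_cast this
  · have : (1 : ℝ) ≤ (m ^ 2 : ℕ) := by push_cast; linarith
    exact_mod_cast this
  · push_cast
    rw [Real.log_pow]
    have h1 := Real.log_le_self (by linarith : (0 : ℝ) ≤ m)
    have h2 := le_abs_self K
    push_cast
    nlinarith

/-- Counting planes of bounded height by means of linear forms. -/
theorem exists_card_le_of_linear (n M : ℕ) (hn : 1 ≤ n) : ∃ C : ℕ,
    ∀ {ι : Type} {f : MvPolynomial (Fin n) ℚ} {s : Finset ι}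
    {a : ι → Fin n → ℚ} {V : ι → Submodule ℚ (Fin n → ℚ)}
    {π : ι → (Fin n → ℤ) →ₗ[ℤ] (Fin 2 → ℤ)} {ξ η : ι → (Fin n → ℚ) →ₗ[ℚ] ℚ} {d H q t : ℕ},
    IsBoundedFamily f s a V π ξ η H → Irreducible f → f.totalDegree = d → 1 ≤ d → IsNCC f →
    RIrreducible 1 (homogeneousComponent d f) →
    d ^ 8 ≤ q ^ 3 → q ≤ 256 * d ^ 3 → 1 ≤ t → t ≤ H → H ≤ t ^ M → d ≤ H ^ M →
    s.card ≤ C * (d ^ 4 * (H * q) + d ^ 7 * t) := by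
  obtain ⟨A₀, hA₀, hmain⟩ := exists_card_le_of_log_le
  obtain ⟨A, hA1, hA, hAlog⟩ := exists_log_add_le
    (Real.log A₀ + Real.log 257 + (M + 3 * M ^ 2 : ℕ)) (100000 * n ^ 6)
  refine ⟨2 + 48 * A₀ * A + 1536, ?_⟩
  intro ι f s a V π ξ η d H q t h hf hfd hd hncc hirr hdq hqd ht htH hHt hdH
  subst hfd
  set d := f.totalDegree
  have hq : 1 ≤ q := by
    by_contra! hq
    have : q = 0 := by omega
    subst this
    have := Nat.pow_pos (n := 8) hd
    omega
  have hH : 1 ≤ H := ht.trans htH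
  set P := A * (H * q + d ^ 3 * t) with hP
  have hn6 : 1 ≤ n ^ 6 := Nat.one_le_pow _ _ hn
  have hn2 : n ^ 2 ≤ n ^ 6 := Nat.pow_le_pow_right hn (by norm_num)
  have hHq : 1 ≤ H * q := Nat.mul_pos hH hq
  have hd3 : 1 ≤ d ^ 3 := Nat.one_le_pow _ _ hd
  have hP1 : A * (H * q) ≤ P := Nat.mul_le_mul_left _ (Nat.le_add_right _ _)
  have hP2 : A * (d ^ 3 * t) ≤ P := Nat.mul_le_mul_left _ (Nat.le_add_left _ _)
  have hP3 : A * H ≤ P := (Nat.mul_le_mul_left _ (Nat.le_mul_of_pos_right _ hq)).trans hP1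
  have hP4 : A * d ^ 3 ≤ P := (Nat.mul_le_mul_left _ (Nat.le_mul_of_pos_right _ ht)).trans hP2
  have hP5 : A ≤ P := (Nat.le_mul_of_pos_right _ hH).trans hP3
  refine (hmain (P := P) veronese_one le_rfl (by norm_num) h hf (by omega) hncc hirr
    (by omega) ?_ ?_
    ?_).trans ?_
  · calc n ^ 2 * H * (4 * (2 * d) ^ 3 * (1 * 3)) * d = (96 * n ^ 2) * H * d ^ 4 := by ring
      _ ≤ A * H * (d ^ 3 * d ^ 3) := by
        gcongr
        · omega
        · rw [← pow_add]
          exact Nat.pow_le_pow_right hd (by norm_num)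
      _ ≤ (A * H) * ((A * d ^ 3) * (A * d ^ 3)) * A := by
        have h1 : 1 ≤ A ^ 3 := Nat.one_le_pow _ _ hA
        calc A * H * (d ^ 3 * d ^ 3) ≤ A * H * (d ^ 3 * d ^ 3) * A ^ 3 :=
              Nat.le_mul_of_pos_right _ h1
          _ = _ := by ring
      _ ≤ P * (P * P) * P := by gcongr
      _ = P ^ 4 := by ring
  · calc Nat.factorial 3 * (n ^ 6 * H ^ 3 * (4 * (2 * d) ^ 3 * (1 * 3)) ^ 2 * d ^ 2) ^ 1
        = (55296 * n ^ 6) * (H ^ 3 * d ^ 8) := by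
          rw [show Nat.factorial 3 = 6 from rfl]
          ring
      _ < A * (H ^ 3 * d ^ 8) := by
        have h1 : 0 < H ^ 3 * d ^ 8 := by positivity
        exact Nat.mul_lt_mul_of_pos_right (by omega) h1
      _ ≤ A ^ 3 * (H ^ 3 * q ^ 3) := by
        gcongr
        exact Nat.le_self_pow (by norm_num) A
      _ = (A * (H * q)) ^ 3 := by ring
      _ ≤ P ^ 3 := by gcongr
  · have hle : H * q + d ^ 3 * t ≤ 257 * t ^ (M + 3 * M ^ 2) := by
      calc H * q + d ^ 3 * t ≤ H * (256 * d ^ 3) + d ^ 3 * H := by gcongr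
        _ = 257 * (H * d ^ 3) := by ring
        _ ≤ 257 * (t ^ M * ((t ^ M) ^ M) ^ 3) := by
          gcongr
          exact hdH.trans (Nat.pow_le_pow_left hHt M)
        _ = 257 * t ^ (M + 3 * M ^ 2) := by
          rw [← pow_mul, ← pow_mul, ← pow_add]
          ring_nf
    have hA₀' : (1 : ℝ) ≤ A₀ := by exact_mod_cast hA₀
    have hA' : (1 : ℝ) ≤ A := by exact_mod_cast hA
    have ht' : (1 : ℝ) ≤ t := by exact_mod_cast ht
    have hlog1 : Real.log (H * q + d ^ 3 * t : ℕ) ≤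
        Real.log 257 + (M + 3 * M ^ 2 : ℕ) * Real.log t := by
      rw [← Real.log_pow, ← Real.log_mul (by norm_num) (by positivity)]
      exact Real.log_le_log (by exact_mod_cast Nat.add_pos_left hHq _) (by exact_mod_cast hle)
    have hlogt : Real.log t ≤ t := Real.log_le_self (by positivity)
    have hlog2 : Real.log (A₀ * P) ≤
        (Real.log A₀ + Real.log 257 + (M + 3 * M ^ 2 : ℕ) + Real.log A) * t := by
      have e1 : Real.log (A₀ * P) =
          Real.log A₀ + (Real.log A + Real.log (H * q + d ^ 3 * t : ℕ)) := by
        have hne : ((H * q + d ^ 3 * t : ℕ) : ℝ) ≠ 0 := by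
          exact_mod_cast (Nat.add_pos_left hHq _).ne'
        rw [hP, Nat.cast_mul, Real.log_mul (by positivity) (by positivity),
          Real.log_mul (by positivity) hne]
      have p1 := Real.log_nonneg hA₀'
      have p2 := Real.log_nonneg hA'
      have p3 : 0 ≤ Real.log 257 := Real.log_nonneg (by norm_num)
      have p4 := mul_le_mul_of_nonneg_left hlogt (Nat.cast_nonneg (α := ℝ) (M + 3 * M ^ 2))
      nlinarith
    have hd3' : (0 : ℝ) ≤ d ^ 3 := by positivity
    calc 128 * (d : ℝ) ^ 3 * Real.log (A₀ * P)
        ≤ 128 * (d : ℝ) ^ 3 *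
          ((Real.log A₀ + Real.log 257 + (M + 3 * M ^ 2 : ℕ) + Real.log A) * t) := by gcongr
      _ = (128 * (Real.log A₀ + Real.log 257 + (M + 3 * M ^ 2 : ℕ) + Real.log A)) *
          (d ^ 3 * t) := by ring
      _ ≤ A * (d ^ 3 * t) := by gcongr
      _ ≤ P := by exact_mod_cast hP2
  · have b1 : d ^ 3 ≤ d ^ 7 * t := (Nat.pow_le_pow_right hd (by norm_num)).trans
      (Nat.le_mul_of_pos_right _ ht)
    have b2 : d ^ 6 ≤ d ^ 7 * t := (Nat.pow_le_pow_right hd (by norm_num)).trans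
      (Nat.le_mul_of_pos_right _ ht)
    calc 2 * d ^ 3 + (2 * (24 * 1 * (A₀ * P) * d ^ 4) +
          4 * (2 * d) ^ 3 * (3 * (4 * d ^ 3 * (1 * (3 + 1)))))
        = 2 * d ^ 3 + (48 * A₀ * A) * (d ^ 4 * (H * q) + d ^ 7 * t) + 1536 * d ^ 6 := by
          rw [hP]
          ring
      _ ≤ 2 * (d ^ 4 * (H * q) + d ^ 7 * t) + (48 * A₀ * A) * (d ^ 4 * (H * q) + d ^ 7 * t) +
          1536 * (d ^ 4 * (H * q) + d ^ 7 * t) := by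
        gcongr <;> omega
      _ = _ := by ring

/-- Counting planes of bounded height by means of quadratic forms. -/
theorem exists_card_le_of_quadratic (n : ℕ) (hn : 1 ≤ n) : ∃ C : ℕ,
    ∀ {ι : Type} {f : MvPolynomial (Fin n) ℚ} {s : Finset ι}
    {a : ι → Fin n → ℚ} {V : ι → Submodule ℚ (Fin n → ℚ)}
    {π : ι → (Fin n → ℤ) →ₗ[ℤ] (Fin 2 → ℤ)} {ξ η : ι → (Fin n → ℚ) →ₗ[ℚ] ℚ} {d h : ℕ},
    IsBoundedFamily f s a V π ξ η (h ^ 13) → Irreducible f → f.totalDegree = d → 1 ≤ d →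
    IsNCC f → RIrreducible 2 (homogeneousComponent d f) → 1 ≤ h →
    s.card ≤ C * (d ^ 9 * h ^ 12) := by
  obtain ⟨A₀, hA₀, hmain⟩ := exists_card_le_of_log_le
  obtain ⟨A, hA1, hA, hAlog⟩ := exists_log_add_le
    (Real.log A₀ + 17) (10 ^ 10 * n ^ 12)
  refine ⟨2 + 96 * A₀ * A + 10 ^ 6, ?_⟩
  intro ι f s a V π ξ η d h hfam hf hfd hd hncc hirr hh
  subst hfd
  set d := f.totalDegree
  set P := A * (d ^ 5 * h ^ 12) with hP
  have hh12 : 1 ≤ h ^ 12 := Nat.one_le_pow _ _ hh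
  have hd5 : 1 ≤ d ^ 5 := Nat.one_le_pow _ _ hd
  have hP1 : A ≤ P := Nat.le_mul_of_pos_right _ (Nat.mul_pos hd5 hh12)
  have hn2 : n ^ 2 ≤ n ^ 12 := Nat.pow_le_pow_right hn (by norm_num)
  have hn12 : 1 ≤ n ^ 12 := Nat.one_le_pow _ _ hn
  refine (hmain (P := P) veronese_two (by norm_num) (by norm_num) hfam hf (by omega) hncc hirr
    (by omega) ?_
    ?_ ?_).trans ?_
  · calc n ^ 2 * h ^ 13 * (4 * (2 * d) ^ 6 * (2 * 6)) * d
        = (3072 * n ^ 2) * (d ^ 7 * h ^ 13) := by ring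
      _ ≤ A ^ 4 * (d ^ 20 * h ^ 48) := by
        gcongr
        · exact le_trans (by omega) (Nat.le_self_pow (by norm_num) A)
        · norm_num
        · norm_num
      _ = P ^ 4 := by rw [hP]; ring
  · calc Nat.factorial 6 * (n ^ 6 * (h ^ 13) ^ 3 * (4 * (2 * d) ^ 6 * (2 * 6)) ^ 2 * d ^ 2) ^ 4
        = (720 * 9437184 ^ 4 * n ^ 24) * (d ^ 56 * h ^ 156) := by
          rw [show Nat.factorial 6 = 720 from rfl]
          ring
      _ < A ^ 13 * (d ^ 56 * h ^ 156) := by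
        refine Nat.mul_lt_mul_of_pos_right ?_ (by positivity)
        calc 720 * 9437184 ^ 4 * n ^ 24 < (10 ^ 10 * n ^ 12) ^ 13 := by
              have h1 : n ^ 24 ≤ n ^ (12 * 13) := Nat.pow_le_pow_right hn (by norm_num)
              have h2 : 0 < n ^ (12 * 13) := Nat.pow_pos hn
              rw [mul_pow, ← pow_mul, ← pow_mul]
              refine (Nat.mul_le_mul_left _ h1).trans_lt (Nat.mul_lt_mul_of_pos_right ?_ h2)
              norm_num
          _ ≤ A ^ 13 := Nat.pow_le_pow_left hA1 13
      _ ≤ A ^ 13 * (d ^ 65 * h ^ 156) := by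
        gcongr
        norm_num
      _ = P ^ 13 := by rw [hP]; ring
  · have hA₀' : (1 : ℝ) ≤ A₀ := by exact_mod_cast hA₀
    have hA' : (1 : ℝ) ≤ A := by exact_mod_cast hA
    have hd' : (1 : ℝ) ≤ d := by exact_mod_cast hd
    have hh' : (1 : ℝ) ≤ h := by exact_mod_cast hh
    have hlog : Real.log (A₀ * P) ≤ (Real.log A₀ + 17 + Real.log A) * (d * h) := by
      have e1 : Real.log (A₀ * P) =
          Real.log A₀ + (Real.log A + (5 * Real.log d + 12 * Real.log h)) := by
        rw [hP]
        push_cast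
        rw [Real.log_mul (by positivity) (by positivity), Real.log_mul (by positivity)
          (by positivity), Real.log_mul (by positivity) (by positivity), Real.log_pow, Real.log_pow]
        norm_num
      have p1 := Real.log_nonneg hA₀'
      have p2 := Real.log_nonneg hA'
      have p3 := Real.log_le_self (by positivity : (0 : ℝ) ≤ d)
      have p4 := Real.log_le_self (by positivity : (0 : ℝ) ≤ h)
      have p5 : (d : ℝ) ≤ d * h := le_mul_of_one_le_right (by positivity) hh'
      have p6 : (h : ℝ) ≤ d * h := le_mul_of_one_le_left (by positivity) hd'
      nlinarith
    calc 128 * (d : ℝ) ^ 3 * Real.log (A₀ * P)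
        ≤ 128 * (d : ℝ) ^ 3 * ((Real.log A₀ + 17 + Real.log A) * (d * h)) := by gcongr
      _ = (128 * (Real.log A₀ + 17 + Real.log A)) * (d ^ 4 * h ^ 1) := by ring
      _ ≤ A * (d ^ 5 * h ^ 12) := by
        gcongr
        all_goals norm_num
      _ = P := by rw [hP]; push_cast; ring
  · have b1 : d ^ 3 ≤ d ^ 9 * h ^ 12 := (Nat.pow_le_pow_right hd (by norm_num)).trans
      (Nat.le_mul_of_pos_right _ hh12)
    have b2 : d ^ 9 ≤ d ^ 9 * h ^ 12 := Nat.le_mul_of_pos_right _ hh12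
    calc 2 * d ^ 3 + (2 * (24 * 2 * (A₀ * P) * d ^ 4) +
          4 * (2 * d) ^ 6 * (6 * (4 * d ^ 3 * (2 * (6 + 1)))))
        = 2 * d ^ 3 + (96 * A₀ * A) * (d ^ 9 * h ^ 12) + 86016 * d ^ 9 := by
          rw [hP]
          ring
      _ ≤ 2 * (d ^ 9 * h ^ 12) + (96 * A₀ * A) * (d ^ 9 * h ^ 12) + 10 ^ 6 * (d ^ 9 * h ^ 12) := by
        gcongr
        norm_num
      _ = _ := by ring

theorem RIrreducible.mono {K : Type*} [CommSemiring K] {n r r' : ℕ} {f : MvPolynomial (Fin n) K}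
    (h : RIrreducible r' f) (hr : r ≤ r') : RIrreducible r f :=
  fun g hg hgr => h g hg (hgr.trans hr)

theorem exists_cube_le_lt (d : ℕ) : ∃ e, e ^ 3 ≤ d ∧ d < (e + 1) ^ 3 := by
  refine ⟨Nat.findGreatest (fun e => e ^ 3 ≤ d) d,
    Nat.findGreatest_spec (P := fun e => e ^ 3 ≤ d) (Nat.zero_le d) (by simp), ?_⟩
  by_contra! h
  have h1 := Nat.le_findGreatest (P := fun e => e ^ 3 ≤ d)
    ((Nat.le_self_pow (by norm_num) _).trans h) h
  omega

theorem exists_card_le_pow (n : ℕ) (hn : 1 ≤ n) : ∃ C : ℕ,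
    ∀ {ι : Type} {f : MvPolynomial (Fin n) ℚ} {s : Finset ι}
    {a : ι → Fin n → ℚ} {V : ι → Submodule ℚ (Fin n → ℚ)}
    {π : ι → (Fin n → ℤ) →ₗ[ℤ] (Fin 2 → ℤ)} {ξ η : ι → (Fin n → ℚ) →ₗ[ℚ] ℚ} {d g : ℕ},
    IsBoundedFamily f s a V π ξ η (g ^ 91) → Irreducible f → f.totalDegree = d → 1 ≤ d →
    IsNCC f → 1 ≤ g →
    (RIrreducible 1 (homogeneousComponent d f) → s.card ≤ C * (d ^ 7 * g ^ 91)) ∧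
    (RIrreducible 2 (homogeneousComponent d f) → s.card ≤ C * (d ^ 7 * g ^ 90)) := by
  obtain ⟨C₁, h₁⟩ := exists_card_le_of_linear n (n ^ 2 + 91) hn
  obtain ⟨C₂, h₂⟩ := exists_card_le_of_quadratic n hn
  refine ⟨257 * C₁ + C₂ + 2 * 3 ^ n ^ 2, ?_⟩
  intro ι f s a V π ξ η d g h hf hfd hd hncc hg
  set H := g ^ 91 with hH
  have hH1 : 1 ≤ H := Nat.one_le_pow _ _ hg
  have hg90 : 1 ≤ g ^ 90 := Nat.one_le_pow _ _ hg
  have h9091 : g ^ 90 ≤ g ^ 91 := Nat.pow_le_pow_right hg (by norm_num)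
  by_cases hdH : d ≤ H ^ (n ^ 2 + 91)
  · have hgH : g ≤ H := Nat.le_self_pow (by norm_num) g
    have hHg : H ≤ g ^ (n ^ 2 + 91) := Nat.pow_le_pow_right hg (by omega)
    refine ⟨fun hirr => ?_, fun hirr => ?_⟩
    · refine (h₁ (q := d ^ 3) h hf hfd hd hncc hirr ?_ (by omega) hg hgH hHg hdH).trans ?_
      · rw [← pow_mul]
        exact Nat.pow_le_pow_right hd (by norm_num)
      · calc C₁ * (d ^ 4 * (H * d ^ 3) + d ^ 7 * g) ≤ C₁ * (d ^ 4 * (H * d ^ 3) + d ^ 7 * H) := by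
              gcongr
          _ = (2 * C₁) * (d ^ 7 * H) := by ring
          _ ≤ (257 * C₁ + C₂ + 2 * 3 ^ n ^ 2) * (d ^ 7 * H) := by
              gcongr
              omega
    · obtain ⟨e, he, he'⟩ := exists_cube_le_lt d
      have he1 : 1 ≤ e := by
        by_contra! h0
        have : e = 0 := by omega
        subst this
        omega
      by_cases hge : g ≤ e
      · have hq1 : d ^ 8 ≤ (256 * e ^ 8) ^ 3 := by
          calc d ^ 8 ≤ ((2 * e) ^ 3) ^ 8 := by
                gcongr
                exact he'.le.trans (by gcongr; omega)
            _ = _ := by ring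
        have hq2 : 256 * e ^ 8 ≤ 256 * d ^ 3 := by
          have h3 : e ^ 8 ≤ e ^ 9 := Nat.pow_le_pow_right he1 (by norm_num)
          have h4 : e ^ 9 ≤ d ^ 3 := by
            calc e ^ 9 = (e ^ 3) ^ 3 := by ring
              _ ≤ d ^ 3 := by gcongr
          omega
        refine (h₁ h hf hfd hd hncc (hirr.mono (by norm_num)) hq1 hq2 hg hgH hHg hdH).trans ?_
        have h5 : g ≤ g ^ 90 := Nat.le_self_pow (by norm_num) g
        calc C₁ * (d ^ 4 * (H * (256 * e ^ 8)) + d ^ 7 * g)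
            = C₁ * (256 * (d ^ 4 * g ^ 90 * (g * e ^ 8)) + d ^ 7 * g) := by
              rw [hH]
              ring
          _ ≤ C₁ * (256 * (d ^ 4 * g ^ 90 * (e * e ^ 8)) + d ^ 7 * g ^ 90) := by gcongr
          _ = C₁ * (256 * (d ^ 4 * g ^ 90 * (e ^ 3) ^ 3) + d ^ 7 * g ^ 90) := by ring
          _ ≤ C₁ * (256 * (d ^ 4 * g ^ 90 * d ^ 3) + d ^ 7 * g ^ 90) := by gcongr
          _ = (257 * C₁) * (d ^ 7 * g ^ 90) := by ring
          _ ≤ _ := by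
              gcongr
              omega
      · have hdg : d ≤ g ^ 3 := he'.le.trans (by gcongr; omega)
        have hH' : H = (g ^ 7) ^ 13 := by rw [hH, ← pow_mul]
        rw [hH'] at h
        refine (h₂ h hf hfd hd hncc hirr (Nat.one_le_pow _ _ hg)).trans ?_
        calc C₂ * (d ^ 9 * (g ^ 7) ^ 12) = C₂ * (d ^ 7 * d ^ 2 * g ^ 84) := by ring
          _ ≤ C₂ * (d ^ 7 * (g ^ 3) ^ 2 * g ^ 84) := by gcongr
          _ = C₂ * (d ^ 7 * g ^ 90) := by ring
          _ ≤ _ := by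
              gcongr
              omega
  · have hdH' : H ^ n ^ 2 ≤ d :=
      (Nat.pow_le_pow_right hH1 (by omega)).trans (Nat.le_of_not_le hdH)
    have key : s.card ≤ (257 * C₁ + C₂ + 2 * 3 ^ n ^ 2) * (d ^ 7 * g ^ 90) := by
      subst hfd
      refine (h.card_le hf (by omega) hncc).trans ?_
      set d := f.totalDegree
      calc 2 * d ^ 2 * (2 * H + 1) ^ n ^ 2 ≤ 2 * d ^ 2 * (3 * H) ^ n ^ 2 := by
            gcongr
            omega
        _ = (2 * 3 ^ n ^ 2) * (d ^ 2 * H ^ n ^ 2) := by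
            rw [mul_pow]
            ring
        _ ≤ (2 * 3 ^ n ^ 2) * (d ^ 2 * d) := by gcongr
        _ = (2 * 3 ^ n ^ 2) * d ^ 3 := by ring
        _ ≤ (257 * C₁ + C₂ + 2 * 3 ^ n ^ 2) * (d ^ 7 * g ^ 90) := by
            refine Nat.mul_le_mul (by omega) ?_
            exact (Nat.pow_le_pow_right hd (by norm_num)).trans (Nat.le_mul_of_pos_right _ hg90)
    exact ⟨fun _ => key.trans (by gcongr), fun _ => key⟩

/-- Summation over dyadic layers of heights. -/
theorem sum_le_of_card_layer_le {ι : Type*} (s : Finset ι) (c h : ι → ℕ) {b B T : ℕ} (hb : 2 ≤ b)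
    (hB : 1 ≤ B) {K : ℝ} {w : ℕ → ℝ} (hpos : ∀ i ∈ s, 0 < h i)
    (hc : ∀ i ∈ s, c i * min (h i) (B + 1) ≤ T)
    (hN : ∀ j, ((s.filter fun i => h i < b ^ (j + 1)).card : ℝ) ≤ K * w j * b ^ j) :
    (∑ i ∈ s, (c i : ℝ)) ≤
      T * (K * ∑ j ∈ Finset.range (Nat.log 2 B + 1), w j) + s.card * (T / (B + 1)) := by
  classical
  have hb0 : (0 : ℝ) < b := by exact_mod_cast (by omega : 0 < b)
  rw [← Finset.sum_filter_add_sum_filter_not s fun i => h i ≤ B]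
  refine add_le_add ?_ ?_
  · have hmaps : ∀ i ∈ s.filter fun i => h i ≤ B,
        Nat.log b (h i) ∈ Finset.range (Nat.log 2 B + 1) := by
      intro i hi
      obtain ⟨his, hiB⟩ := Finset.mem_filter.mp hi
      rw [Finset.mem_range, Nat.lt_succ_iff]
      exact (Nat.log_mono_right hiB).trans (Nat.log_anti_left (by norm_num) hb)
    rw [← Finset.sum_fiberwise_of_maps_to hmaps, Finset.mul_sum, Finset.mul_sum]
    refine Finset.sum_le_sum fun j _ => ?_
    have hterm : ∀ i ∈ (s.filter fun i => h i ≤ B).filter fun i => Nat.log b (h i) = j,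
        (c i : ℝ) ≤ T / b ^ j := by
      intro i hi
      obtain ⟨hi, hij⟩ := Finset.mem_filter.mp hi
      obtain ⟨his, hiB⟩ := Finset.mem_filter.mp hi
      have h1 : b ^ j ≤ min (h i) (B + 1) := by
        have h2 : b ^ j ≤ h i := hij ▸ Nat.pow_log_le_self b (hpos i his).ne'
        exact le_min h2 (h2.trans (by omega))
      rw [le_div_iff₀ (by positivity)]
      exact_mod_cast (Nat.mul_le_mul_left _ h1).trans (hc i his)
    refine (Finset.sum_le_card_nsmul _ _ _ hterm).trans ?_
    rw [nsmul_eq_mul]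
    have hsub : (((s.filter fun i => h i ≤ B).filter fun i => Nat.log b (h i) = j).card : ℝ) ≤
        K * w j * b ^ j := by
      refine le_trans ?_ (hN j)
      norm_cast
      refine Finset.card_le_card fun i hi => ?_
      obtain ⟨hi, hij⟩ := Finset.mem_filter.mp hi
      obtain ⟨his, hiB⟩ := Finset.mem_filter.mp hi
      exact Finset.mem_filter.mpr ⟨his, hij ▸ Nat.lt_pow_succ_log_self (by omega) _⟩
    calc _ ≤ K * w j * b ^ j * ((T : ℝ) / b ^ j) := by gcongr
      _ = T * (K * w j) := by
        field_simp
  · have hterm : ∀ i ∈ s.filter fun i => ¬ h i ≤ B, (c i : ℝ) ≤ T / (B + 1) := by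
      intro i hi
      obtain ⟨his, hiB⟩ := Finset.mem_filter.mp hi
      have h1 := hc i his
      rw [min_eq_right (by omega)] at h1
      rw [le_div_iff₀ (by positivity)]
      exact_mod_cast h1
    refine (Finset.sum_le_card_nsmul _ _ _ hterm).trans ?_
    rw [nsmul_eq_mul]
    gcongr
    exact Finset.filter_subset _ _

theorem homogeneousComponent_map {R S : Type*} [CommSemiring R] [CommSemiring S] {σ : Type*}
    (φ : R →+* S) (d : ℕ) (f : MvPolynomial σ R) :
    homogeneousComponent d (map φ f) = map φ (homogeneousComponent d f) := by
  classical
  ext m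
  rw [coeff_homogeneousComponent, coeff_map, coeff_map, coeff_homogeneousComponent, apply_ite φ,
    map_zero]

/-- The integral points of height at most `B` lying on one of the planes `a i + V i`. -/
theorem ncard_points_le_sum {n : ℕ} {ι : Type*} {s : Finset ι} {a : ι → Fin n → ℚ}
    {V : ι → Submodule ℚ (Fin n → ℚ)} {π : ι → (Fin n → ℤ) →ₗ[ℤ] (Fin 2 → ℤ)}
    {ξ η : ι → (Fin n → ℚ) →ₗ[ℚ] ℚ} (hc : ∀ i ∈ s, IsPlaneCoords (V i) (π i) (ξ i) (η i)) (B : ℕ) :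
    ∃ c : ι → ℕ,
      (∀ i ∈ s, c i * min (plueckerHeight (π i)) (B + 1) ≤ (3 * B + 1) ^ (n - 2)) ∧
      Set.ncard {x : Fin n → ℤ | (∀ i, |x i| ≤ (B : ℤ)) ∧ ∃ i ∈ s, ratVec x - a i ∈ V i} ≤
        ∑ i ∈ s, c i := by
  classical
  let box : Finset (Fin n → ℤ) := Fintype.piFinset fun _ => Finset.Icc (-(B : ℤ)) B
  have hbox : ∀ x, x ∈ box ↔ ∀ k, |x k| ≤ (B : ℤ) := fun x => by
    simp [box, abs_le]
  let S : ι → Finset (Fin n → ℤ) := fun i => box.filter fun x => ratVec x - a i ∈ V i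
  refine ⟨fun i => (S i).card, fun i hi => ?_, ?_⟩
  · obtain ⟨k, l, hkl, hh⟩ := exists_natAbs_pluecker_eq_height (hc i hi).surjective
    rw [← hh]
    refine card_integral_points_le (π i) (hc i hi).surjective
      (fun x hx => (hbox x).mp (Finset.mem_filter.mp hx).1) (fun x hx y hy => ?_) hkl
    have hxy : ratVec x - ratVec y ∈ V i := by
      have := (V i).sub_mem (Finset.mem_filter.mp hx).2 (Finset.mem_filter.mp hy).2
      simpa using this
    obtain ⟨h0, h1⟩ := ((hc i hi).mem_iff _).mp hxy
    rw [map_sub, sub_eq_zero] at h0 h1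
    ext j
    fin_cases j
    · have := (hc i hi).apply_zero x
      rw [h0, ← (hc i hi).apply_zero y] at this
      exact_mod_cast this
    · have := (hc i hi).apply_one x
      rw [h1, ← (hc i hi).apply_one y] at this
      exact_mod_cast this
  · refine le_trans ?_ (Finset.card_biUnion_le (s := s) (t := S))
    rw [← Set.ncard_coe_finset]
    refine Set.ncard_le_ncard (fun x hx => ?_) (Finset.finite_toSet _)
    obtain ⟨hxB, i, hi, hxi⟩ := hx
    exact Finset.mem_coe.mpr (Finset.mem_biUnion.mpr
      ⟨i, hi, Finset.mem_filter.mpr ⟨(hbox x).mpr hxB, hxi⟩⟩)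

/-- The number of integral points on a family of planes, in terms of the layers of heights. -/
theorem ncard_points_le {n : ℕ} (hn : 4 ≤ n) {s : Finset (Set (Fin n → ℚ))}
    {a : Set (Fin n → ℚ) → Fin n → ℚ} {V : Set (Fin n → ℚ) → Submodule ℚ (Fin n → ℚ)}
    {π : Set (Fin n → ℚ) → (Fin n → ℤ) →ₗ[ℤ] (Fin 2 → ℤ)}
    {ξ η : Set (Fin n → ℚ) → (Fin n → ℚ) →ₗ[ℚ] ℚ}
    (hc : ∀ L ∈ s, IsPlaneCoords (V L) (π L) (ξ L) (η L)) {B : ℕ} (hB : 1 ≤ B) {K X : ℝ}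
    (hK : 0 ≤ K) {w : ℕ → ℝ} (hw : ∀ j, 0 ≤ w j)
    (hX : ∑ j ∈ Finset.range (Nat.log 2 B + 1), w j ≤ X)
    (hN : ∀ j, ((s.filter fun L => plueckerHeight (π L) < (2 ^ 91) ^ (j + 1)).card : ℝ) ≤
      K * w j * (2 ^ 91) ^ j) :
    (Set.ncard {x : Fin n → ℤ | (∀ i, |x i| ≤ (B : ℤ)) ∧ ∃ L ∈ s, ratVec x - a L ∈ V L} : ℝ) ≤
      4 ^ (n - 2) * (K * X * B ^ (n - 2) + s.card * B ^ (n - 3)) := by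
  obtain ⟨c, hc1, hc2⟩ := ncard_points_le_sum (a := a) hc B
  have h1 := sum_le_of_card_layer_le s c (fun L => plueckerHeight (π L)) (b := 2 ^ 91) (B := B)
    (T := (3 * B + 1) ^ (n - 2)) (K := K) (w := w) (by norm_num) hB
    (fun L hL => plueckerHeight_pos (hc L hL).surjective) hc1 (by exact_mod_cast hN)
  have h2 : (Set.ncard {x : Fin n → ℤ | (∀ i, |x i| ≤ (B : ℤ)) ∧
      ∃ L ∈ s, ratVec x - a L ∈ V L} : ℝ) ≤ ∑ L ∈ s, (c L : ℝ) := by exact_mod_cast hc2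
  refine h2.trans (h1.trans ?_)
  have hB' : (1 : ℝ) ≤ B := by exact_mod_cast hB
  have hT : (((3 * B + 1) ^ (n - 2) : ℕ) : ℝ) ≤ 4 ^ (n - 2) * B ^ (n - 2) := by
    push_cast
    rw [← mul_pow]
    gcongr
    linarith
  have hT' : (((3 * B + 1) ^ (n - 2) : ℕ) : ℝ) / (B + 1) ≤ 4 ^ (n - 2) * B ^ (n - 3) := by
    rw [div_le_iff₀ (by positivity)]
    refine hT.trans ?_
    rw [show n - 2 = (n - 3) + 1 by omega, pow_succ (B : ℝ), show n - 3 + 1 = n - 2 by omega,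
      ← mul_assoc]
    gcongr
    linarith
  calc (((3 * B + 1) ^ (n - 2) : ℕ) : ℝ) * (K * ∑ j ∈ Finset.range (Nat.log 2 B + 1), w j) +
        s.card * ((((3 * B + 1) ^ (n - 2) : ℕ) : ℝ) / (B + 1))
      ≤ (((3 * B + 1) ^ (n - 2) : ℕ) : ℝ) * (K * X) + s.card * (4 ^ (n - 2) * B ^ (n - 3)) := by
        gcongr
    _ ≤ 4 ^ (n - 2) * B ^ (n - 2) * (K * X) + s.card * (4 ^ (n - 2) * B ^ (n - 3)) := by
        gcongr
        exact mul_nonneg hK ((Finset.sum_nonneg fun j _ => hw j).trans hX)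
    _ = _ := by ring

/-- Counting integral points on `(n-2)`-planes contained in an affine hypersurface: for `n ≥ 4`
there is `c = c(n)` such that for every irreducible (over ℚ) NCC `f ∈ ℤ[x₁,…,xₙ]` of degree
`d ≥ 2`, every finite set `I` of `(n-2)`-dimensional affine subspaces of `ℚⁿ` contained in `V(f)`
and every positive integer `B`: if the top-degree part of `f` is `2`-irreducible over ℚ, the
number of integral points of height `≤ B` on the union is at most `c·(d⁷·B^{n-2} + #I·B^{n-3})`,
and if it is merely `1`-irreducible, at most `c·(d⁷·B^{n-2}·log B + #I·B^{n-3})` for `B ≥ 2`. -/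
theorem counting_on_planes (n : ℕ) (hn : 4 ≤ n) :
    ∃ c : ℝ, ∀ (f : MvPolynomial (Fin n) ℤ) (d : ℕ), f.totalDegree = d → 2 ≤ d →
      Irreducible (MvPolynomial.map (Int.castRingHom ℚ) f) →
      IsNCC (MvPolynomial.map (Int.castRingHom ℚ) f) →
      ∀ I : Set (Set (Fin n → ℚ)), I.Finite →
        (∀ L ∈ I, IsAffinePlane n L ∧
          ∀ x ∈ L, MvPolynomial.eval x (MvPolynomial.map (Int.castRingHom ℚ) f) = 0) →
        ∀ B : ℕ, 1 ≤ B →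
          (RIrreducible 2 (MvPolynomial.map (Int.castRingHom ℚ)
              (MvPolynomial.homogeneousComponent d f)) →
            (Set.ncard {x : Fin n → ℤ | (∀ i, |x i| ≤ (B : ℤ)) ∧
                ∃ L ∈ I, (fun i => (x i : ℚ)) ∈ L} : ℝ)
              ≤ c * ((d : ℝ) ^ 7 * (B : ℝ) ^ (n - 2) + I.ncard * (B : ℝ) ^ (n - 3))) ∧
          (RIrreducible 1 (MvPolynomial.map (Int.castRingHom ℚ)
              (MvPolynomial.homogeneousComponent d f)) → 2 ≤ B →
            (Set.ncard {x : Fin n → ℤ | (∀ i, |x i| ≤ (B : ℤ)) ∧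
                ∃ L ∈ I, (fun i => (x i : ℚ)) ∈ L} : ℝ)
              ≤ c * ((d : ℝ) ^ 7 * (B : ℝ) ^ (n - 2) * Real.log B
                  + I.ncard * (B : ℝ) ^ (n - 3))) := by
  classical
  obtain ⟨C, hC⟩ := exists_card_le_pow n (by omega)
  refine ⟨4 ^ (n - 2) * (C * 2 ^ 91 * 4 + 1), fun f d hfd hd hirr hncc I hI hplanes B hB => ?_⟩
  set F := MvPolynomial.map (Int.castRingHom ℚ) f with hF
  have hFd : F.totalDegree = d := by
    rw [← hfd, hF, totalDegree, support_map_of_injective _ Int.cast_injective, totalDegree]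
  rw [← homogeneousComponent_map, ← hF]
  have h1 : ∀ L : Set (Fin n → ℚ), ∃ (a : Fin n → ℚ) (V : Submodule ℚ (Fin n → ℚ)), L ∈ I →
      Module.finrank ℚ V = n - 2 ∧ L = {x | ∃ v ∈ V, x = a + v} := by
    intro L
    by_cases hL : L ∈ I
    · obtain ⟨a, V, h⟩ := (hplanes L hL).1
      exact ⟨a, V, fun _ => h⟩
    · exact ⟨0, ⊥, fun h => absurd h hL⟩
  choose a V haV using h1
  have h2 : ∀ L : Set (Fin n → ℚ), ∃ π ξ η, L ∈ I → IsPlaneCoords (V L) π ξ η := by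
    intro L
    by_cases hL : L ∈ I
    · obtain ⟨π, ξ, η, h⟩ := exists_isPlaneCoords (V L) (by rw [(haV L hL).1]; omega)
      exact ⟨π, ξ, η, fun _ => h⟩
    · exact ⟨0, 0, 0, fun h => absurd h hL⟩
  choose π ξ η hcoords using h2
  have hmem : ∀ L ∈ I, ∀ x, x ∈ L ↔ x - a L ∈ V L := by
    intro L hL x
    conv_lhs => rw [(haV L hL).2]
    constructor
    · rintro ⟨v, hv, rfl⟩
      simpa using hv
    · exact fun h => ⟨_, h, by abel⟩
  set s := hI.toFinset with hs
  have hsI : ∀ {L}, L ∈ s ↔ L ∈ I := hI.mem_toFinset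
  have hfam : IsPlaneFamily F s a V := by
    refine ⟨fun L hL => by rw [(haV L (hsI.mp hL)).1]; omega, fun L hL L' hL' hV ha => ?_,
      fun L hL v hv => ?_⟩
    · ext x
      rw [hmem L (hsI.mp hL), hmem L' (hsI.mp hL'), ← hV, ← (V L).add_mem_iff_left ha]
      simp
    · refine (hplanes L (hsI.mp hL)).2 _ ((hmem L (hsI.mp hL) _).mpr ?_)
      simpa using hv
  have hbdd : ∀ j : ℕ, IsBoundedFamily F
      (s.filter fun L => plueckerHeight (π L) < (2 ^ 91) ^ (j + 1)) a V π ξ η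
      ((2 ^ (j + 1)) ^ 91) := by
    intro j
    refine ⟨hfam.mono (Finset.filter_subset _ _),
      fun L hL => hcoords L (hsI.mp (Finset.mem_filter.mp hL).1), fun L hL => ?_⟩
    rw [← pow_mul, mul_comm, pow_mul]
    exact (Finset.mem_filter.mp hL).2.le
  have hset : {x : Fin n → ℤ | (∀ i, |x i| ≤ (B : ℤ)) ∧ ∃ L ∈ I, (fun i => (x i : ℚ)) ∈ L} =
      {x : Fin n → ℤ | (∀ i, |x i| ≤ (B : ℤ)) ∧ ∃ L ∈ s, ratVec x - a L ∈ V L} := by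
    ext x
    refine and_congr_right fun _ => exists_congr fun L => ?_
    rw [hsI]
    exact and_congr_right fun hL => hmem L hL _
  have hcard : I.ncard = s.card := Set.ncard_eq_toFinset_card I hI
  have hcoords' : ∀ L ∈ s, IsPlaneCoords (V L) (π L) (ξ L) (η L) := fun L hL =>
    hcoords L (hsI.mp hL)
  have hBn : (0 : ℝ) ≤ (s.card : ℝ) * B ^ (n - 3) := by positivity
  rw [hset, hcard]
  refine ⟨fun h2irr => ?_, fun h1irr hB2 => ?_⟩
  · have hX : ∑ j ∈ Finset.range (Nat.log 2 B + 1), (1 / 2 : ℝ) ^ j ≤ 2 :=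
      sum_geometric_two_le _
    refine (ncard_points_le hn hcoords' hB (K := C * 2 ^ 91 * d ^ 7) (by positivity)
      (fun j => by positivity) hX fun j => ?_).trans ?_
    · have h3 := (hC (hbdd j) hirr hFd (by omega) hncc Nat.one_le_two_pow).2 h2irr
      refine (Nat.cast_le (α := ℝ).mpr h3).trans ?_
      push_cast
      have h4 : (2 : ℝ) ^ (90 * j) = (1 / 2) ^ j * (2 ^ 91) ^ j := by
        rw [← mul_pow, pow_mul]
        norm_num
      calc (C : ℝ) * ((d : ℝ) ^ 7 * (2 ^ (j + 1)) ^ 90) =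
            (C : ℝ) * 2 ^ 90 * (d : ℝ) ^ 7 * 2 ^ (90 * j) := by ring
        _ ≤ (C : ℝ) * 2 ^ 91 * (d : ℝ) ^ 7 * 2 ^ (90 * j) := by
          gcongr <;> norm_num
        _ = _ := by rw [h4]; ring
    · have hq : (0 : ℝ) ≤ (d : ℝ) ^ 7 * (B : ℝ) ^ (n - 2) := by positivity
      rw [mul_assoc (4 ^ (n - 2) : ℝ)]
      gcongr
      nlinarith [mul_nonneg (Nat.cast_nonneg (α := ℝ) C) hBn]
  · have hlogB : 1 / 2 ≤ Real.log B := by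
      have : Real.log 2 ≤ Real.log B :=
        Real.log_le_log (by norm_num) (by exact_mod_cast hB2)
      linarith [Real.log_two_gt_d9]
    have hX : ∑ j ∈ Finset.range (Nat.log 2 B + 1), (1 : ℝ) ≤ 4 * Real.log B := by
      have h3 : (Nat.log 2 B : ℝ) * Real.log 2 ≤ Real.log B := by
        rw [← Real.log_pow]
        exact Real.log_le_log (by positivity)
          (by exact_mod_cast Nat.pow_log_le_self 2 (by omega))
      have h4 : (0 : ℝ) ≤ Nat.log 2 B := by positivity
      have h5 := Real.log_two_gt_d9
      simp only [Finset.sum_const, Finset.card_range, nsmul_eq_mul, mul_one]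
      push_cast
      nlinarith
    refine (ncard_points_le hn hcoords' hB (K := C * 2 ^ 91 * d ^ 7) (by positivity)
      (fun j => by positivity) hX fun j => ?_).trans ?_
    · have h3 := (hC (hbdd j) hirr hFd (by omega) hncc Nat.one_le_two_pow).1 h1irr
      refine (Nat.cast_le (α := ℝ).mpr h3).trans (le_of_eq ?_)
      push_cast
      rw [← pow_mul 2 91 j]
      ring
    · have hq : (0 : ℝ) ≤ (d : ℝ) ^ 7 * (B : ℝ) ^ (n - 2) * Real.log B :=
        mul_nonneg (by positivity) (by linarith)
      rw [mul_assoc (4 ^ (n - 2) : ℝ)]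
      gcongr
      nlinarith [mul_nonneg (Nat.cast_nonneg (α := ℝ) C) hBn]
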